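/- Measure-to-pointwise estimate for subsolutions (Theorem 2.4): For every δ>0 there exists c(δ)>0 depending only on n, λ, Λ and δ such that the following holds. If u satisfies u_t ≤ Lu and 0 ≤ u ≤ 1 in Q₂, and the Lebesgue measure of {u=0}∩Q₁(0,−1) is at least δ, then u ≤ 1−c(δ) in Q₁. -/

import Mathlib

noncomputable section
open scoped BigOperators
open Classical

abbrev SpN (n : ℕ) := EuclideanSpace ℝ (Fin n)

/-- The parabolic cube `Q_r(x₀,t₀) = (x₀,t₀) + (−r,r)ⁿ × (−r²,0]`. -/
def Qcube (n : ℕ) (r : ℝ) (c : SpN n × ℝ) : Set (SpN n × ℝ) :=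
  {p | (∀ i, -r < p.1 i - c.1 i ∧ p.1 i - c.1 i < r) ∧ c.2 - r ^ 2 < p.2 ∧ p.2 ≤ c.2}

/-- The parabolic boundary
`∂ₚQ_r(x₀,t₀) = (x₀,t₀) + ((∂(−r,r)ⁿ × (−r²,0)) ∪ ((−r,r)ⁿ × {−r²}))`. -/
def pBdry (n : ℕ) (r : ℝ) (c : SpN n × ℝ) : Set (SpN n × ℝ) :=
  {p | ((∀ i, |p.1 i - c.1 i| ≤ r) ∧ (∃ i, |p.1 i - c.1 i| = r) ∧
        c.2 - r ^ 2 < p.2 ∧ p.2 < c.2) ∨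
       ((∀ i, -r < p.1 i - c.1 i ∧ p.1 i - c.1 i < r) ∧ p.2 = c.2 - r ^ 2)}

/-- The `i`-th standard basis vector. -/
def eVecN (n : ℕ) (i : Fin n) : SpN n := EuclideanSpace.single i 1

/-- The entry `∂²u/∂xᵢ∂xⱼ` of the spatial Hessian of `u(x,t)` at `p = (x,t)`. -/
def sHessN {n : ℕ} (u : SpN n × ℝ → ℝ) (p : SpN n × ℝ) (i j : Fin n) : ℝ :=
  fderiv ℝ (fun y => fderiv ℝ (fun z => u (z, p.2)) y (eVecN n j)) p.1 (eVecN n i)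

/-- The operator `Lu = tr(A(x) D²ₓu)` at the point `p = (x,t)`. -/
def LopN {n : ℕ} (A : SpN n → Matrix (Fin n) (Fin n) ℝ)
    (u : SpN n × ℝ → ℝ) (p : SpN n × ℝ) : ℝ :=
  ∑ i, ∑ j, A p.1 i j * sHessN u p j i

/-- Uniform ellipticity with symmetric coefficients: `λ|ξ|² ≤ ξ·A(x)ξ ≤ Λ|ξ|²`. -/
def IsEllipticN {n : ℕ} (lam Lam : ℝ) (A : SpN n → Matrix (Fin n) (Fin n) ℝ) : Prop :=
  (∀ x, (A x).IsSymm) ∧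
  ∀ (x ξ : SpN n),
    lam * ‖ξ‖ ^ 2 ≤ ∑ i, ∑ j, ξ i * A x i j * ξ j ∧
      ∑ i, ∑ j, ξ i * A x i j * ξ j ≤ Lam * ‖ξ‖ ^ 2

/-- `u` is (pointwise) a solution of `u_t = Lu` on `Ω`: twice continuously
differentiable in `x`, differentiable in `t`, with `∂ₜu = tr(A(x)D²ₓu)`. -/
def SolvesLN {n : ℕ} (A : SpN n → Matrix (Fin n) (Fin n) ℝ)
    (u : SpN n × ℝ → ℝ) (Ω : Set (SpN n × ℝ)) : Prop :=
  ∀ p ∈ Ω, ContDiffAt ℝ 2 (fun y => u (y, p.2)) p.1 ∧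
    HasDerivAt (fun s => u (p.1, s)) (LopN A u p) p.2

/-- `u` is a pointwise subsolution: `u_t ≤ Lu` on `Ω`. -/
def SubSolvesLN {n : ℕ} (A : SpN n → Matrix (Fin n) (Fin n) ℝ)
    (u : SpN n × ℝ → ℝ) (Ω : Set (SpN n × ℝ)) : Prop :=
  ∀ p ∈ Ω, ContDiffAt ℝ 2 (fun y => u (y, p.2)) p.1 ∧
    DifferentiableAt ℝ (fun s => u (p.1, s)) p.2 ∧
    deriv (fun s => u (p.1, s)) p.2 ≤ LopN A u p

/-- `u` solves the heat equation `∂ₜu = Δu` on `Ω`. -/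
def SolvesHeatN {n : ℕ} (u : SpN n × ℝ → ℝ) (Ω : Set (SpN n × ℝ)) : Prop :=
  ∀ p ∈ Ω, ContDiffAt ℝ 2 (fun y => u (y, p.2)) p.1 ∧
    HasDerivAt (fun s => u (p.1, s)) (∑ i, sHessN u p i i) p.2

/-- `u` is a pointwise subsolution of the heat equation: `∂ₜu ≤ Δu` on `Ω`. -/
def SubSolvesHeatN {n : ℕ} (u : SpN n × ℝ → ℝ) (Ω : Set (SpN n × ℝ)) : Prop :=
  ∀ p ∈ Ω, ContDiffAt ℝ 2 (fun y => u (y, p.2)) p.1 ∧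
    DifferentiableAt ℝ (fun s => u (p.1, s)) p.2 ∧
    deriv (fun s => u (p.1, s)) p.2 ≤ ∑ i, sHessN u p i i

section auxiliary
open Set Filter Topology Asymptotics MeasureTheory

/-! ### Quadratic forms and elliptic matrices -/

/-- The quadratic form of a matrix. -/
def quadForm {n : ℕ} (H : Matrix (Fin n) (Fin n) ℝ) (z : SpN n) : ℝ :=
  ∑ i, ∑ j, z i * H i j * z j

/-- The trace of `B * H`. -/
def trPair {n : ℕ} (B H : Matrix (Fin n) (Fin n) ℝ) : ℝ :=
  ∑ i, ∑ j, B i j * H j i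

/-- A symmetric matrix with ellipticity constants `lam` and `Lam`. -/
def EllMat {n : ℕ} (lam Lam : ℝ) (B : Matrix (Fin n) (Fin n) ℝ) : Prop :=
  B.IsSymm ∧ ∀ ξ : SpN n, lam * ‖ξ‖ ^ 2 ≤ quadForm B ξ ∧ quadForm B ξ ≤ Lam * ‖ξ‖ ^ 2

section quad
variable {n : ℕ}

lemma quadForm_sub (H H' : Matrix (Fin n) (Fin n) ℝ) (z : SpN n) :
    quadForm (H - H') z = quadForm H z - quadForm H' z := by
  simp only [quadForm, ← Finset.sum_sub_distrib, Matrix.sub_apply]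
  refine Finset.sum_congr rfl fun i _ => Finset.sum_congr rfl fun j _ => by ring

lemma quadForm_add (H H' : Matrix (Fin n) (Fin n) ℝ) (z : SpN n) :
    quadForm (H + H') z = quadForm H z + quadForm H' z := by
  simp only [quadForm, ← Finset.sum_add_distrib, Matrix.add_apply]
  refine Finset.sum_congr rfl fun i _ => Finset.sum_congr rfl fun j _ => by ring

lemma quadForm_smul (c : ℝ) (H : Matrix (Fin n) (Fin n) ℝ) (z : SpN n) :
    quadForm (c • H) z = c * quadForm H z := by
  simp only [quadForm, Finset.mul_sum, Matrix.smul_apply, smul_eq_mul]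
  refine Finset.sum_congr rfl fun i _ => Finset.sum_congr rfl fun j _ => by ring

lemma quadForm_smul_right (c : ℝ) (H : Matrix (Fin n) (Fin n) ℝ) (z : SpN n) :
    quadForm H (c • z) = c ^ 2 * quadForm H z := by
  simp only [quadForm, Finset.mul_sum, PiLp.smul_apply, smul_eq_mul]
  refine Finset.sum_congr rfl fun i _ => Finset.sum_congr rfl fun j _ => by ring

lemma quadForm_one (z : SpN n) : quadForm (1 : Matrix (Fin n) (Fin n) ℝ) z = ‖z‖ ^ 2 := by
  rw [EuclideanSpace.real_norm_sq_eq]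
  simp only [quadForm]
  refine Finset.sum_congr rfl fun i _ => ?_
  rw [Finset.sum_eq_single i]
  · simp [sq]
  · intro j _ hj; simp [hj.symm]
  · simp

lemma quadForm_vecMulVec (v z : SpN n) :
    quadForm (Matrix.vecMulVec v v) z = (inner ℝ v z) ^ 2 := by
  have : inner ℝ v z = ∑ i, v i * z i := by
    simp [PiLp.inner_apply, mul_comm]
  rw [this, sq, Finset.sum_mul_sum]
  simp only [quadForm, Matrix.vecMulVec_apply]
  refine Finset.sum_congr rfl fun i _ => Finset.sum_congr rfl fun j _ => by ring

lemma trPair_add (B H H' : Matrix (Fin n) (Fin n) ℝ) :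
    trPair B (H + H') = trPair B H + trPair B H' := by
  simp only [trPair, ← Finset.sum_add_distrib, Matrix.add_apply, mul_add]

lemma trPair_sub (B H H' : Matrix (Fin n) (Fin n) ℝ) :
    trPair B (H - H') = trPair B H - trPair B H' := by
  simp only [trPair, ← Finset.sum_sub_distrib, Matrix.sub_apply, mul_sub]

lemma trPair_smul (c : ℝ) (B H : Matrix (Fin n) (Fin n) ℝ) :
    trPair B (c • H) = c * trPair B H := by
  simp only [trPair, Finset.mul_sum, Matrix.smul_apply, smul_eq_mul]
  refine Finset.sum_congr rfl fun i _ => Finset.sum_congr rfl fun j _ => by ring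

lemma trPair_zero (B : Matrix (Fin n) (Fin n) ℝ) : trPair B 0 = 0 := by
  simp [trPair]

lemma trPair_vecMulVec (B : Matrix (Fin n) (Fin n) ℝ) (v : SpN n) :
    trPair B (Matrix.vecMulVec v v) = quadForm B v := by
  simp only [trPair, quadForm, Matrix.vecMulVec_apply]
  refine Finset.sum_congr rfl fun i _ => Finset.sum_congr rfl fun j _ => by ring

lemma trPair_nonneg {B M : Matrix (Fin n) (Fin n) ℝ} (hs : B.IsSymm)
    (hB : ∀ z, 0 ≤ quadForm B z) (hM : ∀ z, 0 ≤ quadForm M z) : 0 ≤ trPair B M := by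
  have hpsd : B.PosSemidef := by
    refine Matrix.PosSemidef.of_dotProduct_mulVec_nonneg
      (by rw [Matrix.IsHermitian, Matrix.conjTranspose_eq_transpose_of_trivial]; exact hs) ?_
    intro x
    have := hB (WithLp.toLp 2 x)
    simp only [quadForm] at this
    refine this.trans_eq ?_
    simp only [dotProduct, Matrix.mulVec, Finset.mul_sum, Pi.star_apply, star_trivial]
    refine Finset.sum_congr rfl fun i _ => Finset.sum_congr rfl fun j _ => by ring
  obtain ⟨m, a, ha⟩ := Matrix.posSemidef_iff_eq_sum_vecMulVec.1 hpsd
  have : trPair B M = ∑ k, quadForm M (WithLp.toLp 2 (a k)) := by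
    rw [ha]
    simp only [trPair, quadForm, Matrix.sum_apply, Finset.sum_mul, Matrix.vecMulVec_apply,
      star_trivial]
    rw [Finset.sum_comm]
    have : ∀ j : Fin n, ∑ i, ∑ k, a k i * a k j * M j i = ∑ k, ∑ i, a k j * M j i * a k i := by
      intro j
      rw [Finset.sum_comm]
      refine Finset.sum_congr rfl fun i _ => Finset.sum_congr rfl fun j _ => by ring
    rw [Finset.sum_congr rfl fun j _ => this j, Finset.sum_comm]
  rw [this]
  exact Finset.sum_nonneg fun k _ => hM _

lemma EllMat.trPair_mono {lam Lam : ℝ} (hl : 0 ≤ lam) {B M M' : Matrix (Fin n) (Fin n) ℝ}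
    (hB : EllMat lam Lam B) (h : ∀ z, quadForm M z ≤ quadForm M' z) :
    trPair B M ≤ trPair B M' := by
  have := trPair_nonneg (M := M' - M) hB.1 (fun z => le_trans (by positivity) (hB.2 z).1)
    (fun z => by rw [quadForm_sub]; linarith [h z])
  rw [trPair_sub] at this
  linarith

lemma EllMat.quadForm_le_trPair {lam Lam : ℝ} (hl : 0 ≤ lam) {B M : Matrix (Fin n) (Fin n) ℝ}
    (hB : EllMat lam Lam B) (h : ∀ z, 0 ≤ quadForm M z) (e : SpN n) :
    lam * quadForm M e ≤ ‖e‖ ^ 2 * trPair B M := by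
  have h1 : 0 ≤ trPair (‖e‖ ^ 2 • B - lam • Matrix.vecMulVec e e) M := by
    refine trPair_nonneg ?_ ?_ h
    · ext i j
      have := congrFun (congrFun hB.1 i) j
      simp only [Matrix.transpose_apply, Matrix.sub_apply, Matrix.smul_apply,
        Matrix.vecMulVec_apply, smul_eq_mul] at this ⊢
      rw [this]; ring
    · intro z
      rw [quadForm_sub, quadForm_smul, quadForm_smul, quadForm_vecMulVec]
      have h2 := (hB.2 z).1
      have h3 := abs_real_inner_le_norm e z
      have h4 : (inner ℝ e z) ^ 2 ≤ (‖e‖ * ‖z‖) ^ 2 := by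
        rw [← sq_abs]; gcongr
      have h5 := mul_le_mul_of_nonneg_left h2 (sq_nonneg ‖e‖)
      have h6 := mul_le_mul_of_nonneg_left h4 hl
      nlinarith
  have h2 : trPair (‖e‖ ^ 2 • B - lam • Matrix.vecMulVec e e) M
      = ‖e‖ ^ 2 * trPair B M - lam * quadForm M e := by
    have : quadForm M e = ∑ i, ∑ j, e i * e j * M j i := by
      simp only [quadForm]
      rw [Finset.sum_comm]
      refine Finset.sum_congr rfl fun i _ => Finset.sum_congr rfl fun j _ => by ring
    rw [this]
    simp only [trPair, Finset.mul_sum, ← Finset.sum_sub_distrib, Matrix.sub_apply,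
      Matrix.smul_apply, Matrix.vecMulVec_apply, smul_eq_mul]
    refine Finset.sum_congr rfl fun i _ => Finset.sum_congr rfl fun j _ => by ring
  linarith

lemma EllMat.trPair_one_le {lam Lam : ℝ} {B : Matrix (Fin n) (Fin n) ℝ}
    (hB : EllMat lam Lam B) : trPair B 1 ≤ n * Lam := by
  have h1 : ∀ i, B i i ≤ Lam := by
    intro i
    have := (hB.2 (EuclideanSpace.single i 1)).2
    simpa [quadForm, Pi.single_apply, ite_mul] using this
  have h2 : trPair B 1 = ∑ i, B i i := by
    simp only [trPair]
    refine Finset.sum_congr rfl fun i _ => ?_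
    rw [Finset.sum_eq_single i]
    · simp
    · intro j _ hj; simp [hj]
    · simp
  rw [h2]
  calc ∑ i, B i i ≤ ∑ _i : Fin n, Lam := Finset.sum_le_sum fun i _ => h1 i
    _ = n * Lam := by simp

end quad

/-! ### Second-order expansions -/

/-- `f` has the second-order Taylor expansion at `x` with gradient `g` and Hessian `H`. -/
def Peano {n : ℕ} (f : SpN n → ℝ) (x : SpN n) (g : SpN n →L[ℝ] ℝ)
    (H : Matrix (Fin n) (Fin n) ℝ) : Prop :=
  (fun z => f (x + z) - f x - g z - quadForm H z / 2) =o[𝓝 0] fun z => ‖z‖ ^ 2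

section peano
variable {n : ℕ}

lemma Peano.sub {f f' : SpN n → ℝ} {x : SpN n} {g g' : SpN n →L[ℝ] ℝ}
    {H H' : Matrix (Fin n) (Fin n) ℝ} (h : Peano f x g H) (h' : Peano f' x g' H') :
    Peano (fun y => f y - f' y) x (g - g') (H - H') := by
  refine (IsLittleO.sub h h').congr_left fun z => ?_
  simp only [quadForm_sub, sub_apply]
  ring

lemma Peano.add {f f' : SpN n → ℝ} {x : SpN n} {g g' : SpN n →L[ℝ] ℝ}
    {H H' : Matrix (Fin n) (Fin n) ℝ} (h : Peano f x g H) (h' : Peano f' x g' H') :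
    Peano (fun y => f y + f' y) x (g + g') (H + H') := by
  refine (IsLittleO.add h h').congr_left fun z => ?_
  simp only [quadForm_add, add_apply]
  ring

lemma Peano.const_mul {f : SpN n → ℝ} {x : SpN n} {g : SpN n →L[ℝ] ℝ}
    {H : Matrix (Fin n) (Fin n) ℝ} (c : ℝ) (h : Peano f x g H) :
    Peano (fun y => c * f y) x (c • g) (c • H) := by
  refine (IsLittleO.const_mul_left h c).congr_left fun z => ?_
  simp only [quadForm_smul, smul_apply, smul_eq_mul]
  ring

lemma Peano.const (c : ℝ) (x : SpN n) : Peano (fun _ => c) x 0 0 := by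
  refine (isLittleO_zero (fun z : SpN n => ‖z‖ ^ 2) (𝓝 0)).congr_left fun z => ?_
  simp [quadForm]

lemma quadForm_abs_le (H : Matrix (Fin n) (Fin n) ℝ) :
    ∃ C : ℝ, 0 ≤ C ∧ ∀ z : SpN n, |quadForm H z| ≤ C * ‖z‖ ^ 2 := by
  refine ⟨∑ i, ∑ j, |H i j|, by positivity, fun z => ?_⟩
  simp only [quadForm, Finset.sum_mul]
  refine (Finset.abs_sum_le_sum_abs _ _).trans (Finset.sum_le_sum fun i _ => ?_)
  refine (Finset.abs_sum_le_sum_abs _ _).trans (Finset.sum_le_sum fun j _ => ?_)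
  have h1 : |z i| ≤ ‖z‖ := PiLp.norm_apply_le z i
  have h2 : |z j| ≤ ‖z‖ := PiLp.norm_apply_le z j
  rw [abs_mul, abs_mul, sq, mul_comm |z i|, mul_assoc]
  gcongr

lemma Peano.of_eq_add {f : SpN n → ℝ} {x : SpN n} {g : SpN n →L[ℝ] ℝ}
    {H : Matrix (Fin n) (Fin n) ℝ} {R : SpN n → ℝ} {C : ℝ}
    (h : ∀ z, f (x + z) = f x + g z + quadForm H z / 2 + R z) (hR : ∀ᶠ z in 𝓝 0, |R z| ≤ C * ‖z‖ ^ 3) :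
    Peano f x g H := by
  have h1 : (fun z => f (x + z) - f x - g z - quadForm H z / 2) = R := by
    funext z; rw [h]; ring
  rw [Peano, h1]
  have h2 : R =O[𝓝 0] fun z : SpN n => ‖z‖ ^ 3 :=
    IsBigO.of_bound C (hR.mono fun z hz => by simpa using hz)
  exact h2.trans_isLittleO (isLittleO_norm_pow_norm_pow (by norm_num))

lemma Peano.hasFDerivAt {f : SpN n → ℝ} {x : SpN n} {g : SpN n →L[ℝ] ℝ}
    {H : Matrix (Fin n) (Fin n) ℝ} (h : Peano f x g H) : HasFDerivAt f g x := by
  rw [hasFDerivAt_iff_isLittleO_nhds_zero]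
  obtain ⟨C, hC, hH⟩ := quadForm_abs_le H
  have h1 : (fun z : SpN n => ‖z‖ ^ 2) =o[𝓝 0] fun z : SpN n => z := by
    have := isLittleO_norm_pow_id (E' := SpN n) (n := 2) (by norm_num)
    simpa using this
  have h2 : (fun z : SpN n => quadForm H z / 2) =O[𝓝 0] fun z : SpN n => ‖z‖ ^ 2 := by
    refine IsBigO.of_bound C (Eventually.of_forall fun z => ?_)
    have := hH z
    rw [Real.norm_eq_abs, Real.norm_eq_abs, abs_div, abs_of_nonneg (sq_nonneg ‖z‖)]
    have h3 : |(2 : ℝ)| = 2 := by norm_num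
    rw [h3]
    have := abs_nonneg (quadForm H z)
    linarith
  refine ((IsLittleO.trans h h1).add (h2.trans_isLittleO h1)).congr_left fun z => ?_
  ring

lemma Peano.isLocalMax {f : SpN n → ℝ} {x : SpN n} {g : SpN n →L[ℝ] ℝ}
    {H : Matrix (Fin n) (Fin n) ℝ} (h : Peano f x g H) (hm : IsLocalMax f x) :
    g = 0 ∧ ∀ z, quadForm H z ≤ 0 := by
  have hg : g = 0 := hm.hasFDerivAt_eq_zero h.hasFDerivAt
  refine ⟨hg, fun z => ?_⟩
  by_contra! hq
  set q := quadForm H z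
  have hc : 0 < q / (4 * (‖z‖ ^ 2 + 1)) := by positivity
  have h1 := (isLittleO_iff.1 h) hc
  have h2 : ∀ᶠ y in 𝓝 (0 : SpN n), f (x + y) ≤ f x := by
    have : Tendsto (fun y : SpN n => x + y) (𝓝 0) (𝓝 x) := by
      have : Continuous (fun y : SpN n => x + y) := by fun_prop
      simpa using this.tendsto 0
    exact this.eventually hm
  have h3 : Tendsto (fun t : ℝ => t • z) (𝓝[>] 0) (𝓝 0) := by
    have : Continuous (fun t : ℝ => t • z) := by fun_prop
    have h4 := this.tendsto 0
    rw [zero_smul] at h4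
    exact h4.mono_left nhdsWithin_le_nhds
  obtain ⟨t, ⟨ht1, ht2⟩, ht⟩ := ((h3.eventually (h1.and h2)).and self_mem_nhdsWithin).exists
  have ht : 0 < t := ht
  rw [hg, quadForm_smul_right, norm_smul] at ht1
  simp only [zero_apply, Real.norm_eq_abs, abs_of_pos ht] at ht1
  have h5 := (abs_le.1 ht1).1
  rw [abs_of_nonneg (by positivity)] at h5
  have h6 : q / (4 * (‖z‖ ^ 2 + 1)) * (t * ‖z‖) ^ 2 ≤ q / 4 * t ^ 2 := by
    have h8 : ‖z‖ ^ 2 / (‖z‖ ^ 2 + 1) ≤ 1 := by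
      rw [div_le_one (by positivity)]; linarith
    calc q / (4 * (‖z‖ ^ 2 + 1)) * (t * ‖z‖) ^ 2
        = q / 4 * t ^ 2 * (‖z‖ ^ 2 / (‖z‖ ^ 2 + 1)) := by field_simp
      _ ≤ q / 4 * t ^ 2 * 1 := by gcongr
      _ = _ := by ring
  have h7 : 0 < q * t ^ 2 := by positivity
  have h9 : t ^ 2 * quadForm H z = q * t ^ 2 := by ring
  rw [h9] at h5
  linarith

/-- First- and second-order conditions when `f - f'` has a local maximum. -/
lemma Peano.touch {f f' : SpN n → ℝ} {x : SpN n} {g g' : SpN n →L[ℝ] ℝ}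
    {H H' : Matrix (Fin n) (Fin n) ℝ} (h : Peano f x g H) (h' : Peano f' x g' H')
    (hm : IsLocalMax (fun y => f y - f' y) x) :
    g = g' ∧ ∀ z, quadForm H z ≤ quadForm H' z := by
  obtain ⟨h1, h2⟩ := (h.sub h').isLocalMax hm
  refine ⟨sub_eq_zero.1 h1, fun z => ?_⟩
  have := h2 z
  rw [quadForm_sub] at this
  linarith

lemma Peano.normSq (x₀ x : SpN n) :
    Peano (fun y => ‖y - x₀‖ ^ 2) x ((2 : ℝ) • innerSL ℝ (x - x₀)) ((2 : ℝ) • 1) := by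
  refine Peano.of_eq_add (R := fun _ => 0) (C := 0) (fun z => ?_) (by simp)
  rw [show x + z - x₀ = (x - x₀) + z by abel, norm_add_sq_real, quadForm_smul, quadForm_one]
  simp only [smul_apply, innerSL_apply_apply, smul_eq_mul]
  ring

end peano

lemma HasDerivAt.nonneg_of_le_left {φ : ℝ → ℝ} {d s T : ℝ} (h : HasDerivAt φ d s) (hT : T < s)
    (hle : ∀ t ∈ Ioc T s, φ t ≤ φ s) : 0 ≤ d := by
  have h1 : HasDerivWithinAt φ d (Iio s) s := h.hasDerivWithinAt
  rw [hasDerivWithinAt_iff_tendsto_slope' (by simp)] at h1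
  refine ge_of_tendsto h1 ?_
  filter_upwards [Ioo_mem_nhdsLT hT] with t ht
  rw [slope_def_field]
  exact div_nonneg_of_nonpos (by linarith [hle t ⟨ht.1, ht.2.le⟩]) (by linarith [ht.2])

/-! ### First touching times -/

lemma exists_first_touch {X : Type*} [TopologicalSpace X] {K : Set X} (hK : IsCompact K)
    {T₀ T₁ : ℝ} (f : X × ℝ → ℝ)
    (init : ∀ y ∈ K, ∀ᶠ q in 𝓝 y ×ˢ 𝓝[>] T₀, q.1 ∈ K → f q < 0)
    (usc : ∀ y ∈ K, ∀ s ∈ Ioc T₀ T₁, f (y, s) < 0 →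
      ∀ᶠ q in 𝓝 y ×ˢ 𝓝[≥] s, q.1 ∈ K → f q < 0)
    (cont : ∀ y ∈ K, ∀ s ∈ Ioc T₀ T₁, ContinuousWithinAt (fun t => f (y, t)) (Iio s) s)
    (bad : ∃ y ∈ K, ∃ s ∈ Ioc T₀ T₁, 0 ≤ f (y, s)) :
    ∃ y ∈ K, ∃ s ∈ Ioc T₀ T₁, f (y, s) = 0 ∧ ∀ z ∈ K, ∀ t ∈ Ioc T₀ s, f (z, t) ≤ 0 := by
  have tube : ∀ l : Filter ℝ, (∀ y ∈ K, ∀ᶠ q in 𝓝 y ×ˢ l, q.1 ∈ K → f q < 0) →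
      ∀ᶠ t in l, ∀ y ∈ K, f (y, t) < 0 := by
    intro l hl
    have h1 := hK.mem_nhdsSet_prod_of_forall hl
    obtain ⟨p, hp, q, hq, hpq⟩ := eventually_prod_iff.1 h1
    filter_upwards [hq] with t ht y hy
    exact hpq (subset_of_mem_nhdsSet hp hy) ht hy
  set S : Set ℝ := {s | s ∈ Ioc T₀ T₁ ∧ ∃ y ∈ K, 0 ≤ f (y, s)} with hS
  have hne : S.Nonempty := by
    obtain ⟨y, hy, s, hs, h⟩ := bad
    exact ⟨s, hs, y, hy, h⟩
  have hbdd : BddBelow S := ⟨T₀, fun s hs => hs.1.1.le⟩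
  obtain ⟨e, he, hinit⟩ := mem_nhdsGT_iff_exists_Ioo_subset.1 (tube _ init)
  have he : T₀ < e := he
  set s := sInf S
  have hsT : s ∈ Ioc T₀ T₁ := by
    constructor
    · refine he.trans_le (le_csInf hne fun t ht => ?_)
      by_contra! hlt
      obtain ⟨y, hy, h⟩ := ht.2
      exact absurd (hinit ⟨ht.1.1, hlt⟩ y hy) (not_lt.2 h)
    · obtain ⟨t, ht⟩ := hne
      exact (csInf_le hbdd ht).trans ht.1.2
  have hbefore : ∀ t ∈ Ioo T₀ s, ∀ y ∈ K, f (y, t) < 0 := by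
    intro t ht y hy
    by_contra! h
    exact absurd (csInf_le hbdd (show t ∈ S from ⟨⟨ht.1, ht.2.le.trans hsT.2⟩, y, hy, h⟩))
      (not_le.2 ht.2)
  have hat : ∀ y ∈ K, f (y, s) ≤ 0 := by
    intro y hy
    refine le_of_tendsto (cont y hy s hsT) ?_
    filter_upwards [Ioo_mem_nhdsLT hsT.1] with t ht
    exact (hbefore t ht y hy).le
  have hex : ∃ y ∈ K, f (y, s) = 0 := by
    by_contra! hno
    have h1 := tube (𝓝[≥] s) fun y hy => usc y hy s hsT (lt_of_le_of_ne (hat y hy) (hno y hy))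
    obtain ⟨e', he', h2⟩ := mem_nhdsGE_iff_exists_Ico_subset.1 h1
    have he' : s < e' := he'
    obtain ⟨t, htS, hte⟩ := exists_lt_of_csInf_lt hne he'
    obtain ⟨y, hy, h⟩ := htS.2
    exact absurd (h2 ⟨csInf_le hbdd htS, hte⟩ y hy) (not_lt.2 h)
  obtain ⟨y, hy, h0⟩ := hex
  refine ⟨y, hy, s, hsT, h0, fun z hz t ht => ?_⟩
  rcases ht.2.eq_or_lt with rfl | hlt
  · exact hat z hz
  · exact (hbefore t ⟨ht.1, hlt⟩ z hz).le

/-! ### Regular subsolutions -/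

/-- `u` is twice expandable in space and differentiable in time at `p`, and is a subsolution
there for the matrix `B`. -/
def SubAt {n : ℕ} (B : Matrix (Fin n) (Fin n) ℝ) (u : SpN n × ℝ → ℝ) (p : SpN n × ℝ) : Prop :=
  ∃ τ g H, Peano (fun y => u (y, p.2)) p.1 g H ∧ HasDerivAt (fun s => u (p.1, s)) τ p.2 ∧
    τ ≤ trPair B H

/-- Upper semicontinuity from the right in time. -/
def RUsc {n : ℕ} (u : SpN n × ℝ → ℝ) (p : SpN n × ℝ) : Prop :=
  ∀ c, u p < c → ∀ᶠ q in 𝓝 p.1 ×ˢ 𝓝[≥] p.2, u q < c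

/-- Subsolutions that are upper semicontinuous from the right in time. -/
def RSub {n : ℕ} (A : SpN n → Matrix (Fin n) (Fin n) ℝ) (u : SpN n × ℝ → ℝ)
    (Ω : Set (SpN n × ℝ)) : Prop :=
  ∀ p ∈ Ω, SubAt (A p.1) u p ∧ RUsc u p

section subat
variable {n : ℕ}

lemma SubAt.add {B : Matrix (Fin n) (Fin n) ℝ} {u v : SpN n × ℝ → ℝ} {p : SpN n × ℝ}
    (hu : SubAt B u p) (hv : SubAt B v p) : SubAt B (fun q => u q + v q) p := by
  obtain ⟨τ, g, H, h1, h2, h3⟩ := hu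
  obtain ⟨τ', g', H', h1', h2', h3'⟩ := hv
  exact ⟨τ + τ', g + g', H + H', h1.add h1', h2.add h2', by rw [trPair_add]; linarith⟩

lemma SubAt.const_mul {B : Matrix (Fin n) (Fin n) ℝ} {u : SpN n × ℝ → ℝ} {p : SpN n × ℝ} {c : ℝ}
    (hc : 0 ≤ c) (hu : SubAt B u p) : SubAt B (fun q => c * u q) p := by
  obtain ⟨τ, g, H, h1, h2, h3⟩ := hu
  exact ⟨c * τ, c • g, c • H, h1.const_mul c, h2.const_mul c, by rw [trPair_smul]; gcongr⟩

lemma SubAt.const {B : Matrix (Fin n) (Fin n) ℝ} {p : SpN n × ℝ} (c : ℝ) :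
    SubAt B (fun _ => c) p :=
  ⟨0, 0, 0, Peano.const c _, hasDerivAt_const _ _, by rw [trPair_zero]⟩

lemma SubAt.time_shift {B : Matrix (Fin n) (Fin n) ℝ} {u : SpN n × ℝ → ℝ} {p : SpN n × ℝ} {r : ℝ}
    (hu : SubAt B u (p.1, p.2 + r)) : SubAt B (fun q => u (q.1, q.2 + r)) p := by
  obtain ⟨τ, g, H, h1, h2, h3⟩ := hu
  exact ⟨τ, g, H, h1, HasDerivAt.comp_add_const p.2 r h2, h3⟩

lemma RUsc.add {u v : SpN n × ℝ → ℝ} {p : SpN n × ℝ} (hu : RUsc u p) (hv : RUsc v p) :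
    RUsc (fun q => u q + v q) p := by
  intro c hc
  have hc : u p + v p < c := hc
  filter_upwards [hu (u p + (c - u p - v p) / 2) (by linarith),
    hv (v p + (c - u p - v p) / 2) (by linarith)] with q h1 h2
  linarith

lemma RUsc.const_mul {u : SpN n × ℝ → ℝ} {p : SpN n × ℝ} {a : ℝ} (ha : 0 < a) (hu : RUsc u p) :
    RUsc (fun q => a * u q) p := by
  intro c hc
  have hc : a * u p < c := hc
  filter_upwards [hu (c / a) (by rw [lt_div_iff₀ ha]; linarith)] with q h1
  rw [lt_div_iff₀ ha] at h1
  linarith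

lemma RUsc.of_continuousAt {u : SpN n × ℝ → ℝ} {p : SpN n × ℝ} (h : ContinuousAt u p) :
    RUsc u p := by
  intro c hc
  have h1 : ∀ᶠ q in 𝓝 p, u q < c := h.eventually (gt_mem_nhds hc)
  rw [nhds_prod_eq] at h1
  exact h1.filter_mono (Filter.prod_mono le_rfl nhdsWithin_le_nhds)

lemma RUsc.time_shift {u : SpN n × ℝ → ℝ} {p : SpN n × ℝ} {r : ℝ}
    (hu : RUsc u (p.1, p.2 + r)) : RUsc (fun q => u (q.1, q.2 + r)) p := by
  intro c hc
  have h1 : Tendsto (fun t : ℝ => t + r) (𝓝[≥] p.2) (𝓝[≥] (p.2 + r)) := by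
    refine tendsto_nhdsWithin_of_tendsto_nhds_of_eventually_within _ ?_ ?_
    · exact ((continuous_add_const r).tendsto p.2).mono_left nhdsWithin_le_nhds
    · filter_upwards [self_mem_nhdsWithin] with t ht
      have ht : p.2 ≤ t := ht
      exact (by simpa using ht : p.2 + r ≤ t + r)
  exact ((tendsto_id (x := 𝓝 p.1)).prodMap h1).eventually (hu c hc)

/-- The comparison principle for a strict supersolution `β`. -/
lemma comparison {lam Lam : ℝ} (hl : 0 ≤ lam) {K U : Set (SpN n)} (hK : IsCompact K)
    (hU : IsOpen U) (hUK : U ⊆ K) {T₀ T₁ : ℝ} {A : SpN n → Matrix (Fin n) (Fin n) ℝ}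
    (hA : ∀ y ∈ U, EllMat lam Lam (A y)) {w β : SpN n × ℝ → ℝ}
    (init : ∀ y ∈ K, ∀ᶠ q in 𝓝 y ×ˢ 𝓝[>] T₀, q.1 ∈ K → w q < β q)
    (hw : ∀ y ∈ K, ∀ s ∈ Ioc T₀ T₁, RUsc w (y, s))
    (hwt : ∀ y ∈ K, ∀ s ∈ Ioc T₀ T₁, ContinuousAt (fun t => w (y, t)) s)
    (hβ : ∀ y ∈ K, ∀ s ∈ Ioc T₀ T₁, ContinuousAt β (y, s))
    (lateral : ∀ y ∈ K \ U, ∀ s ∈ Ioc T₀ T₁, w (y, s) < β (y, s))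
    (hsub : ∀ y ∈ U, ∀ s ∈ Ioc T₀ T₁, SubAt (A y) w (y, s))
    (hsup : ∀ y ∈ U, ∀ s ∈ Ioc T₀ T₁, w (y, s) = β (y, s) →
      ∃ τ g H, Peano (fun z => β (z, s)) y g H ∧ HasDerivAt (fun t => β (y, t)) τ s ∧
        trPair (A y) H < τ) :
    ∀ y ∈ K, ∀ s ∈ Ioc T₀ T₁, w (y, s) < β (y, s) := by
  by_contra! hbad
  have hβt : ∀ y ∈ K, ∀ s ∈ Ioc T₀ T₁, ContinuousAt (fun t => β (y, t)) s := by
    intro y hy s hs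
    exact ContinuousAt.comp (f := fun t : ℝ => (y, t)) (hβ y hy s hs) (by fun_prop)
  obtain ⟨y, hy, s, hs, h0, hle⟩ := exists_first_touch hK (T₀ := T₀) (T₁ := T₁)
    (fun q => w q - β q)
    (fun y hy => (init y hy).mono fun q hq hqK => sub_neg.2 (hq hqK))
    (fun y hy s hs h => by
      have h1 : RUsc (fun q => w q + -β q) (y, s) :=
        (hw y hy s hs).add (RUsc.of_continuousAt (hβ y hy s hs).neg)
      refine (h1 0 (by simpa [sub_eq_add_neg] using h)).mono fun q hq _ => ?_
      simpa [sub_eq_add_neg] using hq)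
    (fun y hy s hs => ((hwt y hy s hs).sub (hβt y hy s hs)).continuousWithinAt)
    (by
      obtain ⟨y, hy, s, hs, h⟩ := hbad
      exact ⟨y, hy, s, hs, sub_nonneg.2 h⟩)
  have h0' : w (y, s) = β (y, s) := sub_eq_zero.1 h0
  have hyU : y ∈ U := by
    by_contra hyU
    exact absurd h0' (lateral y ⟨hy, hyU⟩ s hs).ne
  obtain ⟨τ, g, H, h1, h2, h3⟩ := hsub y hyU s hs
  obtain ⟨τ', g', H', h1', h2', h3'⟩ := hsup y hyU s hs h0'
  have hmax : IsLocalMax (fun z => w (z, s) - β (z, s)) y := by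
    filter_upwards [hU.mem_nhds hyU] with z hz
    have := hle z (hUK hz) s ⟨hs.1, le_rfl⟩
    have h0 : w (y, s) - β (y, s) = 0 := h0
    change w (z, s) - β (z, s) ≤ w (y, s) - β (y, s)
    linarith
  have hH := (h1.touch h1' hmax).2
  have ht : 0 ≤ τ - τ' := by
    refine (h2.sub h2').nonneg_of_le_left hs.1 fun t ht => ?_
    have := hle y hy t ht
    have h0 : w (y, s) - β (y, s) = 0 := h0
    change w (y, t) - β (y, t) ≤ w (y, s) - β (y, s)
    linarith
  have := (hA y hyU).trPair_mono hl hH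
  linarith

end subat

/-! ### Automatic upper semicontinuity of subsolutions -/

/-- Baire category on a locally closed set. -/
lemma exists_portion_subset {X : Type*} [TopologicalSpace X] [T2Space X] [LocallyCompactSpace X]
    {P : Set X} (hP : IsLocallyClosed P) (hne : P.Nonempty) (F : ℕ → Set X)
    (hF : ∀ N, ∀ x ∈ P, (∃ᶠ y in 𝓝 x, y ∈ P ∧ y ∈ F N) → x ∈ F N)
    (hU : ∀ x ∈ P, ∃ N, x ∈ F N) :
    ∃ N, ∃ x ∈ P, ∀ᶠ y in 𝓝 x, y ∈ P → y ∈ F N := by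
  have : LocallyCompactSpace P := hP.locallyCompactSpace
  have : Nonempty P := hne.to_subtype
  obtain ⟨N, x, hx⟩ := nonempty_interior_of_iUnion_of_closed
    (f := fun N => ((↑) : P → X) ⁻¹' F N)
    (fun N => by
      rw [← closure_subset_iff_isClosed]
      intro x hx
      refine hF N x x.2 ?_
      rw [mem_closure_iff_frequently] at hx
      have h2 : Tendsto ((↑) : P → X) (𝓝 x) (𝓝 (x : X)) := continuous_subtype_val.tendsto x
      exact h2.frequently (hx.mono fun y hy => ⟨y.2, hy⟩))
    (by
      rw [eq_univ_iff_forall]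
      intro x
      obtain ⟨N, hN⟩ := hU x x.2
      exact mem_iUnion.2 ⟨N, hN⟩)
  refine ⟨N, x, x.2, ?_⟩
  rw [mem_interior_iff_mem_nhds, nhds_subtype_eq_comap, mem_comap] at hx
  obtain ⟨t, ht, hts⟩ := hx
  filter_upwards [ht] with y hy hyP
  exact hts (show (⟨y, hyP⟩ : P) ∈ _ from hy)

section usc
variable {n : ℕ}

lemma SubAt.continuousAt_space {B : Matrix (Fin n) (Fin n) ℝ} {u : SpN n × ℝ → ℝ}
    {p : SpN n × ℝ} (h : SubAt B u p) : ContinuousAt (fun y => u (y, p.2)) p.1 := by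
  obtain ⟨τ, g, H, h1, _, _⟩ := h
  exact h1.hasFDerivAt.continuousAt

lemma SubAt.continuousAt_time {B : Matrix (Fin n) (Fin n) ℝ} {u : SpN n × ℝ → ℝ}
    {p : SpN n × ℝ} (h : SubAt B u p) : ContinuousAt (fun s => u (p.1, s)) p.2 := by
  obtain ⟨τ, g, H, _, h2, _⟩ := h
  exact h2.continuousAt

/-- The paraboloid `c + k (|x - x₀|² + C (t - a))` is a strict supersolution. -/
lemma paraboloid_super {lam Lam : ℝ} {B : Matrix (Fin n) (Fin n) ℝ} (hB : EllMat lam Lam B)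
    (x₀ : SpN n) (a c : ℝ) {k : ℝ} (hk : 0 < k) (y : SpN n) (s : ℝ) :
    ∃ τ g H, Peano (fun z => c + k * (‖z - x₀‖ ^ 2 + (2 * (n * Lam) + 1) * (s - a))) y g H ∧
      HasDerivAt (fun t => c + k * (‖y - x₀‖ ^ 2 + (2 * (n * Lam) + 1) * (t - a))) τ s ∧
      trPair B H < τ := by
  refine ⟨k * (2 * (n * Lam) + 1), 0 + k • ((2 : ℝ) • innerSL ℝ (y - x₀) + 0),
    0 + k • ((2 : ℝ) • 1 + 0), ?_, ?_, ?_⟩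
  · exact (Peano.const c y).add (((Peano.normSq x₀ y).add (Peano.const _ y)).const_mul k)
  · have := ((((hasDerivAt_id s).sub_const a).const_mul (2 * (n * Lam) + 1)).const_add
      (‖y - x₀‖ ^ 2)).const_mul k |>.const_add c
    simpa using this
  · rw [zero_add, add_zero, trPair_smul, trPair_smul]
    have := hB.trPair_one_le
    gcongr
    linarith

lemma RUsc.of_const_add {u : SpN n × ℝ → ℝ} {p : SpN n × ℝ} (α : ℝ) (hu : RUsc u p) :
    RUsc (fun q => u q - α) p := by
  intro c hc
  have hc : u p - α < c := hc
  filter_upwards [hu (c + α) (by linarith)] with q h1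
  linarith

lemma RUsc.sum_shift {u : SpN n × ℝ → ℝ} {p : SpN n × ℝ} {a κ α : ℝ} (j : ℕ)
    (h : ∀ i < j, RUsc u (p.1, a + p.2 + i * κ)) :
    RUsc (fun q => ∑ i ∈ Finset.range j, (u (q.1, a + q.2 + i * κ) - α)) p := by
  induction j with
  | zero => simpa using RUsc.of_continuousAt (u := fun _ => (0 : ℝ)) continuousAt_const
  | succ j ih =>
    simp only [Finset.sum_range_succ]
    refine (ih fun i hi => h i (by omega)).add (RUsc.of_const_add α ?_)
    have := h j (by omega)
    have h2 := RUsc.time_shift (u := u) (p := p) (r := a + j * κ)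
      (by convert this using 2; ring)
    convert h2 using 4; ring

lemma SubAt.sum_shift {B : Matrix (Fin n) (Fin n) ℝ} {u : SpN n × ℝ → ℝ} {p : SpN n × ℝ}
    {a κ α : ℝ} (j : ℕ) (h : ∀ i < j, SubAt B u (p.1, a + p.2 + i * κ)) :
    SubAt B (fun q => ∑ i ∈ Finset.range j, (u (q.1, a + q.2 + i * κ) - α)) p := by
  induction j with
  | zero => simpa using SubAt.const (B := B) (p := p) 0
  | succ j ih =>
    simp only [Finset.sum_range_succ, sub_eq_add_neg]
    simp only [sub_eq_add_neg] at ih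
    refine (ih fun i hi => h i (by omega)).add (SubAt.add ?_ (SubAt.const (-α)))
    have := h j (by omega)
    have h2 := SubAt.time_shift (u := u) (p := p) (r := a + j * κ)
      (by convert this using 2; ring)
    convert h2 using 4; ring

/-- A sum of time translates of a subsolution stays below a paraboloid, the summands being below
`ε` at the initial time. -/
lemma sum_translates_lt {lam Lam : ℝ} (hl : 0 ≤ lam) {x₀ : SpN n} {a b ε σ T κ α m : ℝ}
    {A : SpN n → Matrix (Fin n) (Fin n) ℝ} (hL : 0 ≤ Lam)
    (hA : ∀ y ∈ Metric.closedBall x₀ σ, EllMat lam Lam (A y)) (hσ : 0 < σ) (hε : 0 < ε)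
    {u : SpN n × ℝ → ℝ}
    (hsub : ∀ y ∈ Metric.closedBall x₀ σ, ∀ s ∈ Ico a b, SubAt (A y) u (y, s))
    (hu1 : ∀ y ∈ Metric.closedBall x₀ σ, ∀ s ∈ Ico a b, u (y, s) ≤ α + 1)
    (hua : ∀ y ∈ Metric.closedBall x₀ σ, u (y, a) ≤ α + ε)
    (husc : ∀ y ∈ Metric.closedBall x₀ σ, ∀ s ∈ Ioo a b, RUsc u (y, s))
    (hT : 0 < T) (hTb : a + T < b) (hm : 0 ≤ m) (hmT : m * T ≤ ε)
    (hcase : ∀ y ∈ Metric.closedBall x₀ σ, RUsc u (y, a) ∨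
      ∀ t ∈ Icc a (a + T), u (y, t) ≤ u (y, a) + m * (t - a))
    (hκ : 0 < κ) (j : ℕ) (hjT : (j + 1) * κ ≤ T / 2)
    (hjε : j * (1 / σ ^ 2 * ((2 * (n * Lam) + 1) * κ)) ≤ ε) :
    ∀ y ∈ Metric.closedBall x₀ σ, ∀ s ∈ Ioc 0 (T / 2),
      ∑ i ∈ Finset.range j, (u (y, a + s + i * κ) - α) <
        1 + 3 * j * ε + j * (1 / σ ^ 2) * (‖y - x₀‖ ^ 2 + (2 * (n * Lam) + 1) * (s - 0)) := by
  have hC : 0 < 2 * (n * Lam) + 1 := by positivity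
  induction j with
  | zero =>
    intro y hy s hs
    simp
  | succ j ih =>
    push_cast at hjT hjε ⊢
    have hjκ : 0 ≤ (j : ℝ) * κ := by positivity
    have ih := ih (by linarith) (by
      refine le_trans ?_ hjε
      have : (0 : ℝ) ≤ 1 / σ ^ 2 * ((2 * (n * Lam) + 1) * κ) := by positivity
      nlinarith)
    have hik : ∀ i < j + 1, (i : ℝ) * κ ≤ T / 2 - κ := by
      intro i hi
      have : (i : ℝ) ≤ j := by exact_mod_cast Nat.lt_succ_iff.1 hi
      nlinarith
    have htime : ∀ i < j + 1, ∀ s ∈ Ioc 0 (T / 2), a + s + i * κ ∈ Ioo a b := by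
      intro i hi s hs
      have := hik i hi
      have : (0 : ℝ) ≤ i * κ := by positivity
      exact ⟨by linarith [hs.1], by linarith [hs.2]⟩
    have hk : (0 : ℝ) < (j + 1) * (1 / σ ^ 2) := by positivity
    refine comparison (lam := lam) (Lam := Lam) hl (A := A)
      (w := fun q => ∑ i ∈ Finset.range (j + 1), (u (q.1, a + q.2 + i * κ) - α))
      (β := fun q => 1 + 3 * (j + 1) * ε + (j + 1) * (1 / σ ^ 2) *
        (‖q.1 - x₀‖ ^ 2 + (2 * (n * Lam) + 1) * (q.2 - 0)))
      (isCompact_closedBall x₀ σ) Metric.isOpen_ball Metric.ball_subset_closedBall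
      (fun y hy => hA y (Metric.ball_subset_closedBall hy)) ?_ ?_ ?_ ?_ ?_ ?_ ?_
    · intro y hy
      have hsplit : ∀ q : SpN n × ℝ, ∑ i ∈ Finset.range (j + 1), (u (q.1, a + q.2 + i * κ) - α)
          = (∑ i ∈ Finset.range j, (u (q.1, a + (q.2 + κ) + i * κ) - α)) + (u (q.1, a + q.2) - α) := by
        intro q
        rw [Finset.sum_range_succ']
        congr 1
        · refine Finset.sum_congr rfl fun i _ => ?_
          congr 3; push_cast; ring
        · simp
      have hT2 : κ ∈ Ioc 0 (T / 2) := ⟨hκ, by nlinarith⟩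
      have htail : RUsc (fun q => ∑ i ∈ Finset.range j, (u (q.1, a + (q.2 + κ) + i * κ) - α))
          (y, 0) := by
        refine RUsc.time_shift (u := fun q => ∑ i ∈ Finset.range j, (u (q.1, a + q.2 + i * κ) - α))
          (RUsc.sum_shift j fun i hi => husc y hy _ ?_)
        have := htime i (by omega) κ hT2
        simpa using this
      have hcont : Continuous (fun q : SpN n × ℝ => -(1 + 3 * (j + 1) * ε + (j + 1) * (1 / σ ^ 2) *
        (‖q.1 - x₀‖ ^ 2 + (2 * (n * Lam) + 1) * (q.2 - 0)))) := by fun_prop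
      have hfilt : 𝓝 y ×ˢ 𝓝[>] (0 : ℝ) ≤ 𝓝 y ×ˢ 𝓝[≥] 0 :=
        Filter.prod_mono le_rfl (nhdsWithin_mono _ Ioi_subset_Ici_self)
      rcases hcase y hy with hr | hr
      · have hfirst : RUsc (fun q : SpN n × ℝ => u (q.1, a + q.2) - α) (y, 0) := by
          have := RUsc.time_shift (u := u) (p := (y, 0)) (r := a) (by simpa using hr)
          simpa [add_comm] using this.of_const_add α
        have hall := (htail.add hfirst).add (RUsc.of_continuousAt hcont.continuousAt)
        have hval := ih y hy κ hT2
        have hya := hua y hy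
        have := (hall 0 (by
          simp only [zero_add, add_zero, sub_zero, mul_zero] at hval ⊢
          have h1 : (0 : ℝ) ≤ 1 / σ ^ 2 * ‖y - x₀‖ ^ 2 := by positivity
          have h2 : (j : ℝ) * (1 / σ ^ 2) * (‖y - x₀‖ ^ 2 + (2 * (n * Lam) + 1) * κ) ≤
              j * (1 / σ ^ 2) * ‖y - x₀‖ ^ 2 + ε := by
            have h3 : (0 : ℝ) ≤ 1 / σ ^ 2 * ((2 * (n * Lam) + 1) * κ) := by positivity
            have h4 : (j : ℝ) * (1 / σ ^ 2) * (‖y - x₀‖ ^ 2 + (2 * (n * Lam) + 1) * κ) =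
              j * (1 / σ ^ 2) * ‖y - x₀‖ ^ 2 + j * (1 / σ ^ 2 * ((2 * (n * Lam) + 1) * κ)) := by
              ring
            rw [h4]
            linarith
          nlinarith)).filter_mono hfilt
        filter_upwards [this] with q hq _
        rw [hsplit]
        linarith
      · have hval : ∑ i ∈ Finset.range j, (u (y, a + (0 + κ) + i * κ) - α) < 3 * (j + 1) * ε := by
          have h1 : ∀ i ∈ Finset.range j, u (y, a + (0 + κ) + i * κ) - α ≤ 2 * ε := by
            intro i hi
            have hi' := hik i (by have := Finset.mem_range.1 hi; omega)
            have hi0 : (0 : ℝ) ≤ i * κ := by positivity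
            have h2 := hr (a + (0 + κ) + i * κ) ⟨by linarith, by linarith⟩
            have h3 := hua y hy
            have h4 : m * (a + (0 + κ) + i * κ - a) ≤ m * T := by gcongr; linarith
            linarith
          refine (Finset.sum_le_sum h1).trans_lt ?_
          simp only [Finset.sum_const, Finset.card_range, nsmul_eq_mul]
          have : (0 : ℝ) ≤ j * ε := by positivity
          nlinarith
        have h1 := (htail _ hval).filter_mono hfilt
        have h2 : ∀ᶠ q : SpN n × ℝ in 𝓝 y ×ˢ 𝓝[>] (0 : ℝ), q.2 ∈ Ioo 0 (T / 2) :=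
          tendsto_snd.eventually (Ioo_mem_nhdsGT (by linarith))
        filter_upwards [h1, h2] with q hq hq2 hqK
        rw [hsplit]
        have h3 := hu1 q.1 hqK (a + q.2) ⟨by linarith [hq2.1], by linarith [hq2.2]⟩
        have h4 : (0 : ℝ) ≤ (j + 1) * (1 / σ ^ 2) *
            (‖q.1 - x₀‖ ^ 2 + (2 * (n * Lam) + 1) * (q.2 - 0)) := by
          have : 0 ≤ q.2 - 0 := by linarith [hq2.1]
          positivity
        linarith
    · intro y hy s hs
      exact RUsc.sum_shift _ fun i hi => husc y hy _ (htime i hi s hs)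
    · intro y hy s hs
      exact (SubAt.sum_shift (B := A y) (p := (y, s)) (j + 1) fun i hi => hsub y hy _
        (Ioo_subset_Ico_self (htime i hi s hs))).continuousAt_time
    · intro y hy s hs
      have : Continuous (fun q : SpN n × ℝ => (1 + 3 * (j + 1) * ε + (j + 1) * (1 / σ ^ 2) *
        (‖q.1 - x₀‖ ^ 2 + (2 * (n * Lam) + 1) * (q.2 - 0)))) := by fun_prop
      exact this.continuousAt
    · intro y hy s hs
      have hd : ‖y - x₀‖ = σ := by
        have h1 := mem_closedBall_iff_norm.1 hy.1
        have h2 : ¬ ‖y - x₀‖ < σ := fun h => hy.2 (mem_ball_iff_norm.2 h)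
        linarith [not_lt.1 h2]
      have h1 : ∑ i ∈ Finset.range (j + 1), (u (y, a + s + i * κ) - α) ≤ (j + 1 : ℕ) := by
        have h2 : ∀ i ∈ Finset.range (j + 1), u (y, a + s + i * κ) - α ≤ 1 := by
          intro i hi
          have := hu1 y hy.1 _ (Ioo_subset_Ico_self (htime i (Finset.mem_range.1 hi) s hs))
          linarith
        refine (Finset.sum_le_sum h2).trans ?_
        simp
      push_cast at h1
      refine h1.trans_lt ?_
      have h3 : ((j : ℝ) + 1) * (1 / σ ^ 2) * (‖y - x₀‖ ^ 2 + (2 * (n * Lam) + 1) * (s - 0))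
          = (j + 1) + (j + 1) * (1 / σ ^ 2) * ((2 * (n * Lam) + 1) * s) := by
        rw [hd]; field_simp; ring
      simp only
      rw [h3]
      have h4 : 0 ≤ ((j : ℝ) + 1) * (1 / σ ^ 2) * ((2 * (n * Lam) + 1) * s) := by
        have := hs.1
        positivity
      have h5 : 0 ≤ 3 * ((j : ℝ) + 1) * ε := by positivity
      linarith
    · intro y hy s hs
      exact SubAt.sum_shift _ fun i hi => hsub y (Metric.ball_subset_closedBall hy) _
        (Ioo_subset_Ico_self (htime i hi s hs))
    · intro y hy s hs _
      exact paraboloid_super (hA y (Metric.ball_subset_closedBall hy)) x₀ 0 _ hk y s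

/-- Upper semicontinuity extends down to the initial time near a point where the increments in
time are uniformly bounded by a linear function. -/
lemma rusc_initial_of_dichotomy {lam Lam : ℝ} (hl : 0 ≤ lam) (hL : 0 ≤ Lam) {a b m : ℝ}
    (hab : a < b) (hm : 0 < m) {x₀ : SpN n} {V : Set (SpN n)} (hV : V ∈ 𝓝 x₀)
    {A : SpN n → Matrix (Fin n) (Fin n) ℝ} (hA : ∀ y ∈ V, EllMat lam Lam (A y))
    {u : SpN n × ℝ → ℝ}
    (hsub : ∀ y ∈ V, ∀ s ∈ Ico a b, SubAt (A y) u (y, s))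
    (hu : ∀ y ∈ V, ∀ s ∈ Ico a b, 0 ≤ u (y, s) ∧ u (y, s) ≤ 1)
    (husc : ∀ y ∈ V, ∀ s ∈ Ioo a b, RUsc u (y, s))
    (hcase : ∀ y ∈ V, RUsc u (y, a) ∨
      ∀ t ∈ Icc a (a + 1 / m), t < b → u (y, t) ≤ u (y, a) + m * (t - a)) :
    RUsc u (x₀, a) := by
  intro c hc
  set α := u (x₀, a) with hα
  set ε := (c - α) / 8 with hεd
  have hε : 0 < ε := by simp only [hεd]; linarith
  have hx₀V : x₀ ∈ V := mem_of_mem_nhds hV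
  have hα0 : 0 ≤ α := (hu x₀ hx₀V a ⟨le_rfl, hab⟩).1
  have hcont : ∀ᶠ y in 𝓝 x₀, u (y, a) < α + ε :=
    (hsub x₀ hx₀V a ⟨le_rfl, hab⟩).continuousAt_space.eventually (gt_mem_nhds (by linarith))
  obtain ⟨σ, hσ, hball⟩ := Metric.nhds_basis_closedBall.mem_iff.1 (hcont.and hV)
  have hBV : Metric.closedBall x₀ σ ⊆ V := fun y hy => (hball hy).2
  have hua : ∀ y ∈ Metric.closedBall x₀ σ, u (y, a) ≤ α + ε := fun y hy => (hball hy).1.le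
  obtain ⟨T, hT, hTb, hTm, hmT⟩ : ∃ T, 0 < T ∧ a + T < b ∧ T ≤ 1 / m ∧ m * T ≤ ε := by
    refine ⟨min ((b - a) / 2) (min (1 / m) (ε / m)), ?_, ?_, ?_, ?_⟩
    · have : 0 < b - a := by linarith
      positivity
    · have := min_le_left ((b - a) / 2) (min (1 / m) (ε / m))
      linarith
    · exact (min_le_right _ _).trans (min_le_left _ _)
    · have : min ((b - a) / 2) (min (1 / m) (ε / m)) ≤ ε / m :=
        (min_le_right _ _).trans (min_le_right _ _)
      calc m * _ ≤ m * (ε / m) := by gcongr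
        _ = ε := by field_simp
  set C := 2 * (n * Lam) + 1 with hCd
  have hC : 0 < C := by positivity
  have key : ∀ y ∈ Metric.closedBall x₀ σ, ∀ s ∈ Ioc 0 (T / 2),
      u (y, a + s) ≤ α + 4 * ε + 1 / σ ^ 2 * (‖y - x₀‖ ^ 2 + C * s) := by
    intro y hy s hs
    obtain ⟨M, hM⟩ := exists_nat_gt (1 / ε)
    have hM0 : (0 : ℝ) < M := lt_trans (by positivity) hM
    have hMε : 1 ≤ M * ε := by
      rw [div_lt_iff₀ hε] at hM; exact hM.le
    have hbd : ∀ᶠ κ : ℝ in 𝓝[>] 0, ∑ i ∈ Finset.range M, (u (y, a + s + i * κ) - α) ≤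
        1 + 3 * M * ε + M * (1 / σ ^ 2) * (‖y - x₀‖ ^ 2 + C * (s - 0)) := by
      have e1 : ∀ᶠ κ : ℝ in 𝓝[>] 0, ((M : ℝ) + 1) * κ < T / 2 := by
        have : Tendsto (fun κ : ℝ => ((M : ℝ) + 1) * κ) (𝓝 0) (𝓝 (((M : ℝ) + 1) * 0)) :=
          Continuous.tendsto (by fun_prop) 0
        rw [mul_zero] at this
        exact (this.mono_left nhdsWithin_le_nhds).eventually (gt_mem_nhds (by linarith))
      have e2 : ∀ᶠ κ : ℝ in 𝓝[>] 0, (M : ℝ) * (1 / σ ^ 2 * (C * κ)) < ε := by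
        have : Tendsto (fun κ : ℝ => (M : ℝ) * (1 / σ ^ 2 * (C * κ))) (𝓝 0)
            (𝓝 ((M : ℝ) * (1 / σ ^ 2 * (C * 0)))) :=
          Continuous.tendsto (by fun_prop) 0
        simp only [mul_zero] at this
        exact (this.mono_left nhdsWithin_le_nhds).eventually (gt_mem_nhds hε)
      filter_upwards [e1, e2, self_mem_nhdsWithin] with κ h1 h2 h3
      refine (sum_translates_lt hl hL (fun y hy => hA y (hBV hy)) hσ hε
        (fun y hy => hsub y (hBV hy)) (fun y hy s hs => ?_) hua
        (fun y hy => husc y (hBV hy)) hT hTb hm.le hmT (fun y hy => ?_) h3 M h1.le h2.le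
        y hy s hs).le
      · linarith [(hu y (hBV hy) s hs).2]
      · refine (hcase y (hBV hy)).imp_right fun h t ht => h t ⟨ht.1, by linarith [ht.2]⟩ ?_
        linarith [ht.2]
    have hlim : Tendsto (fun κ : ℝ => ∑ i ∈ Finset.range M, (u (y, a + s + i * κ) - α)) (𝓝[>] 0)
        (𝓝 (∑ _i ∈ Finset.range M, (u (y, a + s) - α))) := by
      refine tendsto_finsetSum _ fun i _ => ?_
      refine Tendsto.sub_const ?_ α
      have h1 : ContinuousAt (fun t => u (y, t)) (a + s) :=
        (hsub y (hBV hy) (a + s) ⟨by linarith [hs.1], by linarith [hs.2]⟩).continuousAt_time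
      have h2 : Tendsto (fun κ : ℝ => a + s + i * κ) (𝓝[>] 0) (𝓝 (a + s)) := by
        have h3 : Continuous (fun κ : ℝ => a + s + i * κ) := by fun_prop
        have h4 := h3.tendsto 0
        rw [mul_zero, add_zero] at h4
        exact h4.mono_left nhdsWithin_le_nhds
      exact h1.tendsto.comp h2
    have := le_of_tendsto hlim hbd
    rw [Finset.sum_const, Finset.card_range, nsmul_eq_mul, sub_zero] at this
    have h5 : (M : ℝ) * (u (y, a + s) - α) ≤
        M * (4 * ε + 1 / σ ^ 2 * (‖y - x₀‖ ^ 2 + C * s)) := by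
      refine this.trans ?_
      rw [mul_add, mul_assoc (M : ℝ)]
      linarith
    linarith [le_of_mul_le_mul_left h5 hM0]
  have e1 : ∀ᶠ q : SpN n × ℝ in 𝓝 x₀ ×ˢ 𝓝[≥] a, q.1 ∈ Metric.closedBall x₀ σ :=
    tendsto_fst.eventually (Metric.closedBall_mem_nhds x₀ hσ)
  have e2 : ∀ᶠ q : SpN n × ℝ in 𝓝 x₀ ×ˢ 𝓝[≥] a, q.2 ∈ Ico a (a + T / 2) :=
    tendsto_snd.eventually (Ico_mem_nhdsGE (by linarith))
  have e3 : ∀ᶠ q : SpN n × ℝ in 𝓝 x₀ ×ˢ 𝓝[≥] a,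
      1 / σ ^ 2 * (‖q.1 - x₀‖ ^ 2 + C * (q.2 - a)) < ε := by
    have h1 : Continuous (fun q : SpN n × ℝ => 1 / σ ^ 2 * (‖q.1 - x₀‖ ^ 2 + C * (q.2 - a))) := by
      fun_prop
    have h2 := h1.tendsto (x₀, a)
    simp only [sub_self, norm_zero, mul_zero, ne_eq, OfNat.ofNat_ne_zero, not_false_eq_true,
      zero_pow, add_zero] at h2
    rw [nhds_prod_eq] at h2
    exact (h2.mono_left (Filter.prod_mono le_rfl nhdsWithin_le_nhds)).eventually (gt_mem_nhds hε)
  filter_upwards [e1, e2, e3] with q h1 h2 h3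
  have hcε : c = α + 8 * ε := by simp only [hεd]; ring
  rcases h2.1.eq_or_lt with h4 | h4
  · have := hua q.1 h1
    have h5 : q = (q.1, a) := by rw [h4]
    rw [h5]
    linarith
  · have := key q.1 h1 (q.2 - a) ⟨by linarith, by linarith [h2.2]⟩
    rw [add_sub_cancel] at this
    linarith

/-- Upper semicontinuity from the right at the initial time of a region where it holds. -/
lemma rusc_initial {lam Lam : ℝ} (hl : 0 ≤ lam) (hL : 0 ≤ Lam) {a b : ℝ}
    (hab : a < b) {V : Set (SpN n)} (hV : IsOpen V)
    {A : SpN n → Matrix (Fin n) (Fin n) ℝ} (hA : ∀ y ∈ V, EllMat lam Lam (A y))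
    {u : SpN n × ℝ → ℝ}
    (hsub : ∀ y ∈ V, ∀ s ∈ Ico a b, SubAt (A y) u (y, s))
    (hu : ∀ y ∈ V, ∀ s ∈ Ico a b, 0 ≤ u (y, s) ∧ u (y, s) ≤ 1)
    (husc : ∀ y ∈ V, ∀ s ∈ Ioo a b, RUsc u (y, s)) :
    ∀ x ∈ V, RUsc u (x, a) := by
  set P : Set (SpN n) := V ∩ {x | ∀ᶠ y in 𝓝 x, RUsc u (y, a)}ᶜ with hP
  have hPl : IsLocallyClosed P :=
    hV.isLocallyClosed.inter (isOpen_setOfPred_eventually_nhds.isClosed_compl).isLocallyClosed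
  by_contra! hbad
  have hne : P.Nonempty := by
    obtain ⟨x, hx, h⟩ := hbad
    exact ⟨x, hx, fun h' => h h'.self_of_nhds⟩
  obtain ⟨N, x, hxP, hx⟩ := exists_portion_subset hPl hne
    (fun m => {y | ∀ t ∈ Icc a (a + 1 / ((m : ℝ) + 1)), t < b →
      u (y, t) ≤ u (y, a) + ((m : ℝ) + 1) * (t - a)})
    (by
      intro m x hx hfr t ht htb
      have c1 := (hsub x hx.1 t ⟨ht.1, htb⟩).continuousAt_space
      have c2 := (hsub x hx.1 a ⟨le_rfl, hab⟩).continuousAt_space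
      exact le_of_tendsto_of_tendsto_of_frequently c1.tendsto
        (c2.tendsto.add_const (((m : ℝ) + 1) * (t - a)))
        (hfr.mono fun y hy => hy.2 t ht htb))
    (by
      intro x hx
      obtain ⟨τ, g, H, _, h2, _⟩ := hsub x hx.1 a ⟨le_rfl, hab⟩
      have h3 := (h2.isBigO_sub).bound
      obtain ⟨C, hC⟩ := h3
      obtain ⟨δ, hδ, hδ'⟩ := Metric.nhds_basis_closedBall.mem_iff.1 hC
      obtain ⟨m, hm⟩ := exists_nat_gt (max C (1 / δ))
      refine ⟨m, fun t ht _ => ?_⟩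
      have hta : 0 ≤ t - a := by linarith [ht.1]
      have hm1 : C ≤ (m : ℝ) + 1 := by linarith [le_max_left C (1 / δ)]
      have hm2 : 1 / ((m : ℝ) + 1) ≤ δ := by
        rw [div_le_iff₀ (by positivity)]
        have : 1 / δ < m := (le_max_right C (1 / δ)).trans_lt hm
        rw [div_lt_iff₀ hδ] at this
        nlinarith
      have := hδ' (show t ∈ Metric.closedBall a δ by
        rw [Metric.mem_closedBall, Real.dist_eq, abs_of_nonneg hta]; linarith [ht.2])
      have this : ‖u (x, t) - u (x, a)‖ ≤ C * ‖t - a‖ := this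
      rw [Real.norm_eq_abs, Real.norm_eq_abs, abs_of_nonneg hta] at this
      have h5 := le_abs_self (u (x, t) - u (x, a))
      nlinarith)
  refine hxP.2 ?_
  filter_upwards [(hV.eventually_mem hxP.1).eventually_nhds, hx.eventually_nhds] with y h1 h2
  refine rusc_initial_of_dichotomy hl hL hab (m := (N : ℝ) + 1) (by positivity)
    (V := {z | z ∈ V ∧ (z ∈ P → ∀ t ∈ Icc a (a + 1 / ((N : ℝ) + 1)), t < b →
      u (z, t) ≤ u (z, a) + ((N : ℝ) + 1) * (t - a))}) (h1.and h2) (fun z hz => hA z hz.1)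
    (fun z hz => hsub z hz.1) (fun z hz => hu z hz.1) (fun z hz => husc z hz.1) (fun z hz => ?_)
  by_cases hzP : z ∈ P
  · exact Or.inr (hz.2 hzP)
  · left
    have : ∀ᶠ y in 𝓝 z, RUsc u (y, a) := by
      by_contra h
      exact hzP ⟨hz.1, h⟩
    exact this.self_of_nhds

/-- Upper semicontinuity from the right when the times of failure have uniformly Lipschitz
slices. -/
lemma rusc_of_lipschitz_times {lam Lam : ℝ} (hl : 0 ≤ lam) (hL : 0 ≤ Lam) {t₁ t₂ : ℝ}
    {V : Set (SpN n)} (hV : IsOpen V)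
    {A : SpN n → Matrix (Fin n) (Fin n) ℝ} (hA : ∀ y ∈ V, EllMat lam Lam (A y))
    {u : SpN n × ℝ → ℝ}
    (hsub : ∀ y ∈ V, ∀ s ∈ Ioo t₁ t₂, SubAt (A y) u (y, s))
    (hu : ∀ y ∈ V, ∀ s ∈ Ioo t₁ t₂, 0 ≤ u (y, s) ∧ u (y, s) ≤ 1) {N : ℝ} (hN : 0 < N)
    (husc : ∀ s ∈ Ioo t₁ t₂, (∀ y ∈ V, RUsc u (y, s)) ∨
      ∀ y ∈ V, ∀ z ∈ V, |u (y, s) - u (z, s)| ≤ N * dist y z) :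
    ∀ x ∈ V, ∀ s ∈ Ioo t₁ t₂, RUsc u (x, s) := by
  intro x hx s₀ hs₀
  set S : Set ℝ := {s | s ∈ Ioo t₁ t₂ ∧
    ∀ y ∈ V, ∀ z ∈ V, |u (y, s) - u (z, s)| ≤ N * dist y z} with hS
  have hSlim : ∀ s ∈ Ioo t₁ t₂, (∃ᶠ t in 𝓝 s, t ∈ S) → s ∈ S := by
    refine fun s hs h => ⟨hs, fun y hy z hz => ?_⟩
    have c1 := (hsub y hy s hs).continuousAt_time
    have c2 := (hsub z hz s hs).continuousAt_time
    exact le_of_tendsto_of_frequently (c1.sub c2).abs (h.mono fun t ht => ht.2 y hy z hz)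
  by_cases hs₀S : s₀ ∈ S
  swap
  · exact ((husc s₀ hs₀).resolve_right fun h => hs₀S ⟨hs₀, h⟩) x hx
  intro c hc
  set α := u (x, s₀) with hα
  set ε := (c - α) / 4 with hεd
  have hε : 0 < ε := by simp only [hεd]; linarith
  have hα0 : 0 ≤ α := (hu x hx s₀ hs₀).1
  obtain ⟨σ, hσ, hball⟩ := Metric.nhds_basis_closedBall.mem_iff.1 (hV.mem_nhds hx)
  obtain ⟨σ', hσ', hσσ, hσN⟩ : ∃ σ', 0 < σ' ∧ σ' ≤ σ ∧ N * σ' ≤ ε := by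
    refine ⟨min σ (ε / N), by positivity, min_le_left _ _, ?_⟩
    calc N * min σ (ε / N) ≤ N * (ε / N) := by gcongr; exact min_le_right _ _
      _ = ε := by field_simp
  have hBV : Metric.closedBall x σ' ⊆ V := (Metric.closedBall_subset_closedBall hσσ).trans hball
  have ht1 : ∀ᶠ t in 𝓝 s₀, u (x, t) < α + ε ∧ t ∈ Ioo t₁ t₂ :=
    ((hsub x hx s₀ hs₀).continuousAt_time.eventually (gt_mem_nhds (by linarith))).and
      (isOpen_Ioo.mem_nhds hs₀)
  obtain ⟨h, hh, hht⟩ := Metric.nhds_basis_closedBall.mem_iff.1 ht1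
  have hht' : ∀ t ∈ Icc s₀ (s₀ + h), u (x, t) < α + ε ∧ t ∈ Ioo t₁ t₂ := by
    intro t ht
    refine hht (show t ∈ Metric.closedBall s₀ h from ?_)
    rw [Metric.mem_closedBall, Real.dist_eq, abs_of_nonneg (by linarith [ht.1])]
    linarith [ht.2]
  have hSu : ∀ t ∈ S, t ∈ Icc s₀ (s₀ + h) → ∀ y ∈ Metric.closedBall x σ',
      u (y, t) ≤ α + 2 * ε := by
    intro t htS ht y hy
    have h1 := htS.2 y (hBV hy) x hx
    have h2 : N * dist y x ≤ N * σ' := by gcongr; exact hy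
    have h3 := (hht' t ht).1
    have h4 := le_abs_self (u (y, t) - u (x, t))
    linarith
  set C := 2 * (n * Lam) + 1 with hCd
  have hC : 0 < C := by positivity
  have key : ∀ y ∈ Metric.closedBall x σ', ∀ t ∈ Icc s₀ (s₀ + h),
      u (y, t) < α + 3 * ε + 1 / σ' ^ 2 * (‖y - x‖ ^ 2 + C * (t - s₀)) := by
    intro y hy t ht
    have hnn : 0 ≤ 1 / σ' ^ 2 * (‖y - x‖ ^ 2 + C * (t - s₀)) := by
      have : 0 ≤ t - s₀ := by linarith [ht.1]
      positivity
    by_cases htS : t ∈ S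
    · linarith [hSu t htS ht y hy]
    set R : Set ℝ := S ∩ Icc s₀ t with hR
    have hRne : R.Nonempty := ⟨s₀, hs₀S, le_rfl, ht.1⟩
    have hRb : BddAbove R := ⟨t, fun r hr => hr.2.2⟩
    set a := sSup R with ha
    have ha1 : s₀ ≤ a := le_csSup hRb ⟨hs₀S, le_rfl, ht.1⟩
    have ha2 : a ≤ t := csSup_le hRne fun r hr => hr.2.2
    have haI : a ∈ Ioo t₁ t₂ := (hht' a ⟨ha1, ha2.trans ht.2⟩).2
    have haS : a ∈ S := by
      refine hSlim a haI ?_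
      have := mem_closure_iff_frequently.1 (csSup_mem_closure hRne hRb)
      exact this.mono fun r hr => hr.1
    have hat : a < t := lt_of_le_of_ne ha2 fun h => htS (h ▸ haS)
    have hnot : ∀ r ∈ Ioc a t, r ∉ S := by
      intro r hr hrS
      exact absurd (le_csSup hRb ⟨hrS, ha1.trans hr.1.le, hr.2⟩) (not_le.2 hr.1)
    have hI : ∀ r ∈ Icc a t, r ∈ Ioo t₁ t₂ := fun r hr =>
      (hht' r ⟨ha1.trans hr.1, hr.2.trans ht.2⟩).2
    have husc' : ∀ y ∈ V, ∀ r ∈ Ioc a t, RUsc u (y, r) := by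
      intro y hy r hr
      have hrI := hI r ⟨hr.1.le, hr.2⟩
      exact ((husc r hrI).resolve_right fun h => hnot r hr ⟨hrI, h⟩) y hy
    have hinit : ∀ y ∈ V, RUsc u (y, a) :=
      rusc_initial hl hL hat hV hA
        (fun y hy r hr => hsub y hy r (hI r ⟨hr.1, hr.2.le⟩))
        (fun y hy r hr => hu y hy r (hI r ⟨hr.1, hr.2.le⟩))
        (fun y hy r hr => husc' y hy r ⟨hr.1, hr.2.le⟩)
    have hk : 0 < 1 / σ' ^ 2 := by positivity
    have hβ : Continuous (fun q : SpN n × ℝ => α + 3 * ε + 1 / σ' ^ 2 *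
      (‖q.1 - x‖ ^ 2 + (2 * (n * Lam) + 1) * (q.2 - a))) := by fun_prop
    have := comparison (lam := lam) (Lam := Lam) hl (A := A) (w := u)
      (β := fun q => α + 3 * ε + 1 / σ' ^ 2 *
        (‖q.1 - x‖ ^ 2 + (2 * (n * Lam) + 1) * (q.2 - a))) (T₀ := a) (T₁ := t)
      (isCompact_closedBall x σ') Metric.isOpen_ball Metric.ball_subset_closedBall
      (fun y hy => hA y (hBV (Metric.ball_subset_closedBall hy)))
      (fun y hy => by
        have h1 := hinit y (hBV hy) (α + 3 * ε)
          (by linarith [hSu a haS ⟨ha1, ha2.trans ht.2⟩ y hy])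
        have h2 := h1.filter_mono (Filter.prod_mono (le_refl (𝓝 y))
          (nhdsWithin_mono a Ioi_subset_Ici_self))
        have h3 : ∀ᶠ q : SpN n × ℝ in 𝓝 y ×ˢ 𝓝[>] a, a < q.2 :=
          tendsto_snd.eventually self_mem_nhdsWithin
        filter_upwards [h2, h3] with q h4 h5 _
        have : 0 ≤ 1 / σ' ^ 2 * (‖q.1 - x‖ ^ 2 + (2 * (n * Lam) + 1) * (q.2 - a)) := by
          have : 0 ≤ q.2 - a := by linarith
          positivity
        linarith)
      (fun y hy r hr => husc' y (hBV hy) r hr)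
      (fun y hy r hr => (hsub y (hBV hy) r (hI r ⟨hr.1.le, hr.2⟩)).continuousAt_time)
      (fun y _ r _ => hβ.continuousAt)
      (fun y hy r hr => by
        have hd : ‖y - x‖ = σ' := by
          have h1 := mem_closedBall_iff_norm.1 hy.1
          have h2 : ¬ ‖y - x‖ < σ' := fun h => hy.2 (mem_ball_iff_norm.2 h)
          linarith [not_lt.1 h2]
        have h1 := (hu y (hBV hy.1) r (hI r ⟨hr.1.le, hr.2⟩)).2
        simp only
        rw [hd, mul_add]
        have h2 : 1 / σ' ^ 2 * σ' ^ 2 = 1 := by field_simp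
        have h3 : 0 ≤ 1 / σ' ^ 2 * ((2 * (n * Lam) + 1) * (r - a)) := by
          have : 0 ≤ r - a := by linarith [hr.1]
          positivity
        linarith)
      (fun y hy r hr => hsub y (hBV (Metric.ball_subset_closedBall hy)) r (hI r ⟨hr.1.le, hr.2⟩))
      (fun y hy r hr _ => paraboloid_super
        (hA y (hBV (Metric.ball_subset_closedBall hy))) x a _ hk y r)
      y hy t ⟨hat, le_rfl⟩
    refine this.trans_le ?_
    simp only
    gcongr
  have e1 : ∀ᶠ q : SpN n × ℝ in 𝓝 x ×ˢ 𝓝[≥] s₀, q.1 ∈ Metric.closedBall x σ' :=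
    tendsto_fst.eventually (Metric.closedBall_mem_nhds x hσ')
  have e2 : ∀ᶠ q : SpN n × ℝ in 𝓝 x ×ˢ 𝓝[≥] s₀, q.2 ∈ Ico s₀ (s₀ + h) :=
    tendsto_snd.eventually (Ico_mem_nhdsGE (by linarith))
  have e3 : ∀ᶠ q : SpN n × ℝ in 𝓝 x ×ˢ 𝓝[≥] s₀,
      1 / σ' ^ 2 * (‖q.1 - x‖ ^ 2 + C * (q.2 - s₀)) < ε := by
    have h1 : Continuous (fun q : SpN n × ℝ => 1 / σ' ^ 2 * (‖q.1 - x‖ ^ 2 + C * (q.2 - s₀))) := by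
      fun_prop
    have h2 := h1.tendsto (x, s₀)
    simp only [sub_self, norm_zero, mul_zero, ne_eq, OfNat.ofNat_ne_zero, not_false_eq_true,
      zero_pow, add_zero] at h2
    rw [nhds_prod_eq] at h2
    exact (h2.mono_left (Filter.prod_mono le_rfl nhdsWithin_le_nhds)).eventually (gt_mem_nhds hε)
  filter_upwards [e1, e2, e3] with q h1 h2 h3
  have := key q.1 h1 q.2 ⟨h2.1, h2.2.le⟩
  have hcε : c = α + 4 * ε := by simp only [hεd]; ring
  have h5 : u q = u (q.1, q.2) := rfl
  rw [h5]
  linarith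

/-- Bounded subsolutions with locally Lipschitz slices are upper semicontinuous from the right in
time. -/
theorem rusc_of_subAt {lam Lam : ℝ} (hl : 0 ≤ lam) (hL : 0 ≤ Lam) {t₁ t₂ : ℝ}
    {D : Set (SpN n)} (hD : IsOpen D)
    {A : SpN n → Matrix (Fin n) (Fin n) ℝ} (hA : ∀ y ∈ D, EllMat lam Lam (A y))
    {u : SpN n × ℝ → ℝ}
    (hsub : ∀ y ∈ D, ∀ s ∈ Ioo t₁ t₂, SubAt (A y) u (y, s))
    (hu : ∀ y ∈ D, ∀ s ∈ Ioo t₁ t₂, 0 ≤ u (y, s) ∧ u (y, s) ≤ 1)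
    (hlip : ∀ y ∈ D, ∀ s ∈ Ioo t₁ t₂, ∃ K : NNReal, ∃ W ∈ 𝓝 y,
      LipschitzOnWith K (fun z => u (z, s)) W) :
    ∀ p ∈ D ×ˢ Ioo t₁ t₂, RUsc u p := by
  set Ω := D ×ˢ Ioo t₁ t₂ with hΩ
  have hΩo : IsOpen Ω := hD.prod isOpen_Ioo
  set P : Set (SpN n × ℝ) := Ω ∩ {p | ∀ᶠ q in 𝓝 p, RUsc u q}ᶜ with hP
  have hPl : IsLocallyClosed P :=
    hΩo.isLocallyClosed.inter (isOpen_setOfPred_eventually_nhds.isClosed_compl).isLocallyClosed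
  by_contra! hbad
  have hne : P.Nonempty := by
    obtain ⟨x, hx, h⟩ := hbad
    exact ⟨x, hx, fun h' => h h'.self_of_nhds⟩
  obtain ⟨m, p, hpP, hp⟩ := exists_portion_subset hPl hne
    (fun m => {p | ∀ y ∈ D, ∀ z ∈ D, dist y p.1 < 1 / ((m : ℝ) + 1) →
      dist z p.1 < 1 / ((m : ℝ) + 1) → |u (y, p.2) - u (z, p.2)| ≤ ((m : ℝ) + 1) * dist y z})
    (by
      intro m p hp hfr y hy z hz hyd hzd
      have c1 : Tendsto (fun q : SpN n × ℝ => u (y, q.2)) (𝓝 p) (𝓝 (u (y, p.2))) :=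
        (hsub y hy p.2 hp.1.2).continuousAt_time.tendsto.comp continuous_snd.continuousAt
      have c2 : Tendsto (fun q : SpN n × ℝ => u (z, q.2)) (𝓝 p) (𝓝 (u (z, p.2))) :=
        (hsub z hz p.2 hp.1.2).continuousAt_time.tendsto.comp continuous_snd.continuousAt
      have d1 : ∀ᶠ q : SpN n × ℝ in 𝓝 p, dist y q.1 < 1 / ((m : ℝ) + 1) :=
        (show Continuous fun q : SpN n × ℝ => dist y q.1 by fun_prop).continuousAt.eventually
          (gt_mem_nhds hyd)
      have d2 : ∀ᶠ q : SpN n × ℝ in 𝓝 p, dist z q.1 < 1 / ((m : ℝ) + 1) :=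
        (show Continuous fun q : SpN n × ℝ => dist z q.1 by fun_prop).continuousAt.eventually
          (gt_mem_nhds hzd)
      exact le_of_tendsto_of_frequently (c1.sub c2).abs
        ((hfr.and_eventually (d1.and d2)).mono fun q hq => hq.1.2 y hy z hz hq.2.1 hq.2.2))
    (by
      intro p hp
      obtain ⟨K, W, hW, hK⟩ := hlip p.1 hp.1.1 p.2 hp.1.2
      obtain ⟨δ, hδ, hδW⟩ := Metric.mem_nhds_iff.1 hW
      obtain ⟨m, hm⟩ := exists_nat_gt (max (K : ℝ) (1 / δ))
      refine ⟨m, fun y hy z hz hyd hzd => ?_⟩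
      have hm1 : (K : ℝ) ≤ (m : ℝ) + 1 := by linarith [le_max_left (K : ℝ) (1 / δ)]
      have hm2 : 1 / ((m : ℝ) + 1) ≤ δ := by
        rw [div_le_iff₀ (by positivity)]
        have : 1 / δ < m := (le_max_right (K : ℝ) (1 / δ)).trans_lt hm
        rw [div_lt_iff₀ hδ] at this
        nlinarith
      have := hK.dist_le_mul y (hδW (hyd.trans_le hm2)) z (hδW (hzd.trans_le hm2))
      rw [Real.dist_eq] at this
      exact this.trans (by gcongr))
  refine hpP.2 ?_
  obtain ⟨ρ, hρ, hρ'⟩ := Metric.mem_nhds_iff.1 (hp.and (hΩo.mem_nhds hpP.1))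
  set r := min ρ (1 / (2 * ((m : ℝ) + 1))) with hr
  have hr0 : 0 < r := by positivity
  have hrρ : r ≤ ρ := min_le_left _ _
  have hr2 : r + r ≤ 1 / ((m : ℝ) + 1) := by
    have h1 : r ≤ 1 / (2 * ((m : ℝ) + 1)) := min_le_right _ _
    have h2 : 1 / ((m : ℝ) + 1) = 1 / (2 * ((m : ℝ) + 1)) + 1 / (2 * ((m : ℝ) + 1)) := by
      field_simp; ring
    linarith
  have hbox : ∀ y ∈ Metric.ball p.1 r, ∀ s ∈ Ioo (p.2 - r) (p.2 + r),
      (y, s) ∈ Metric.ball p ρ := by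
    intro y hy s hs
    rw [Metric.mem_ball, Prod.dist_eq, max_lt_iff]
    refine ⟨lt_of_lt_of_le hy hrρ, ?_⟩
    rw [Real.dist_eq, abs_lt]
    constructor <;> linarith [hs.1, hs.2]
  have hfin := rusc_of_lipschitz_times hl hL (t₁ := p.2 - r) (t₂ := p.2 + r)
    (V := Metric.ball p.1 r) Metric.isOpen_ball
    (fun y hy => hA y (hρ' (hbox y hy p.2 ⟨by linarith, by linarith⟩)).2.1)
    (fun y hy s hs => hsub y (hρ' (hbox y hy s hs)).2.1 s (hρ' (hbox y hy s hs)).2.2)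
    (fun y hy s hs => hu y (hρ' (hbox y hy s hs)).2.1 s (hρ' (hbox y hy s hs)).2.2)
    (N := (m : ℝ) + 1) (by positivity)
    (fun s hs => by
      by_cases h : ∃ x ∈ Metric.ball p.1 r, (x, s) ∈ P
      · right
        obtain ⟨x, hx, hxP⟩ := h
        have hF := (hρ' (hbox x hx s hs)).1 hxP
        intro y hy z hz
        refine hF y (hρ' (hbox y hy s hs)).2.1 z (hρ' (hbox z hz s hs)).2.1 ?_ ?_
        · have := dist_triangle_right y x p.1
          linarith [Metric.mem_ball.1 hy, Metric.mem_ball.1 hx]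
        · have := dist_triangle_right z x p.1
          linarith [Metric.mem_ball.1 hz, Metric.mem_ball.1 hx]
      · left
        intro y hy
        by_contra hy'
        exact h ⟨y, hy, (hρ' (hbox y hy s hs)).2, fun h' => hy' h'.self_of_nhds⟩)
  have : Metric.ball p.1 r ×ˢ Ioo (p.2 - r) (p.2 + r) ∈ 𝓝 p :=
    (Metric.isOpen_ball.prod isOpen_Ioo).mem_nhds
      ⟨Metric.mem_ball_self hr0, by constructor <;> linarith⟩
  filter_upwards [this] with q hq
  exact hfin q.1 hq.1 q.2 hq.2

end usc

/-! ### Classical subsolutions -/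

section classical
variable {n : ℕ}

lemma Peano.of_contDiffAt {f : SpN n → ℝ} {x : SpN n} (hf : ContDiffAt ℝ 2 f x) :
    Peano f x (fderiv ℝ f x)
      (fun i j => fderiv ℝ (fun y => fderiv ℝ f y (eVecN n j)) x (eVecN n i)) := by
  have hd : ∀ᶠ y in 𝓝 x, DifferentiableAt ℝ f y :=
    (hf.eventually (by simp)).mono fun y hy => hy.differentiableAt (by norm_num)
  have hL : DifferentiableAt ℝ (fderiv ℝ f) x :=
    (hf.fderiv_right (m := 1) (by norm_num)).differentiableAt (by norm_num)
  set L := fderiv ℝ (fderiv ℝ f) x with hLdef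
  have hquad : ∀ z : SpN n, quadForm
      (fun i j => fderiv ℝ (fun y => fderiv ℝ f y (eVecN n j)) x (eVecN n i)) z = L z z := by
    intro z
    have h1 : ∀ i j, fderiv ℝ (fun y => fderiv ℝ f y (eVecN n j)) x (eVecN n i)
        = L (eVecN n i) (eVecN n j) := by
      intro i j
      have := (hL.hasFDerivAt.clm_apply (hasFDerivAt_const (eVecN n j) x)).fderiv
      rw [this]
      simp [hLdef]
    have h2 : z = ∑ i, z i • eVecN n i := by
      ext k
      simp [eVecN, Finset.sum_apply, Pi.single_apply]
    conv_rhs => rw [h2]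
    simp only [quadForm, h1, map_sum, map_smul, sum_apply, smul_apply, smul_eq_mul, Finset.mul_sum]
    rw [Finset.sum_comm]
    refine Finset.sum_congr rfl fun i _ => Finset.sum_congr rfl fun j _ => by ring
  refine isLittleO_iff.2 ?_
  intro c hc
  have h1 := (isLittleO_iff.1 (hasFDerivAt_iff_isLittleO_nhds_zero.1 hL.hasFDerivAt)) hc
  have h2 : ∀ᶠ z in 𝓝 (0 : SpN n), DifferentiableAt ℝ f (x + z) := by
    have : Tendsto (fun z : SpN n => x + z) (𝓝 0) (𝓝 x) := by
      have : Continuous (fun z : SpN n => x + z) := by fun_prop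
      simpa using this.tendsto 0
    exact this.eventually hd
  obtain ⟨δ, hδ, hδ'⟩ := Metric.mem_nhds_iff.1 (h1.and h2)
  filter_upwards [Metric.ball_mem_nhds 0 hδ] with z hz
  rw [mem_ball_zero_iff] at hz
  have hs : ∀ s ∈ Icc (0 : ℝ) 1, s • z ∈ Metric.ball (0 : SpN n) δ := by
    intro s hs
    rw [mem_ball_zero_iff, norm_smul, Real.norm_eq_abs, abs_of_nonneg hs.1]
    exact lt_of_le_of_lt (mul_le_of_le_one_left (norm_nonneg z) hs.2) hz
  have hder : ∀ s ∈ Icc (0 : ℝ) 1, HasDerivWithinAt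
      (fun s : ℝ => f (x + s • z) - s * fderiv ℝ f x z - s ^ 2 / 2 * L z z)
      ((fderiv ℝ f (x + s • z) - fderiv ℝ f x - L (s • z)) z) (Icc 0 1) s := by
    intro s hs'
    have e1 : HasDerivAt (fun s : ℝ => x + s • z) z s := by
      simpa using ((hasDerivAt_id s).smul_const z).const_add x
    have e2 : HasDerivAt (fun s : ℝ => f (x + s • z)) (fderiv ℝ f (x + s • z) z) s :=
      (hδ' (hs s hs')).2.hasFDerivAt.comp_hasDerivAt s e1
    have e3 : HasDerivAt (fun s : ℝ => s ^ 2 / 2 * L z z) (s * L z z) s := by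
      have := ((hasDerivAt_pow 2 s).div_const 2).mul_const (L z z)
      exact this.congr_deriv (by norm_num)
    have e4 := (e2.sub ((hasDerivAt_id s).mul_const (fderiv ℝ f x z))).sub e3
    refine (e4.congr_deriv ?_).hasDerivWithinAt
    simp
  have hbd : ∀ s ∈ Ico (0 : ℝ) 1,
      ‖(fderiv ℝ f (x + s • z) - fderiv ℝ f x - L (s • z)) z‖ ≤ c * ‖z‖ ^ 2 := by
    intro s hs'
    have hs'' : s ∈ Icc (0 : ℝ) 1 := Ico_subset_Icc_self hs'
    refine (ContinuousLinearMap.le_opNorm _ _).trans ?_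
    have := (hδ' (hs s hs'')).1
    have h3 : ‖s • z‖ ≤ ‖z‖ := by
      rw [norm_smul, Real.norm_eq_abs, abs_of_nonneg hs''.1]
      exact mul_le_of_le_one_left (norm_nonneg z) hs''.2
    have h4 : ‖fderiv ℝ f (x + s • z) - fderiv ℝ f x - L (s • z)‖ ≤ c * ‖z‖ :=
      this.trans (by gcongr)
    calc _ ≤ c * ‖z‖ * ‖z‖ := by gcongr
      _ = _ := by ring
  have := norm_image_sub_le_of_norm_deriv_le_segment_01' hder hbd
  rw [hquad]
  rw [Real.norm_eq_abs, Real.norm_eq_abs, abs_of_nonneg (sq_nonneg ‖z‖)]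
  rw [Real.norm_eq_abs] at this
  refine le_of_eq_of_le ?_ this
  congr 1
  simp
  ring

lemma SubSolvesLN.subAt {A : SpN n → Matrix (Fin n) (Fin n) ℝ} {u : SpN n × ℝ → ℝ}
    {Ω : Set (SpN n × ℝ)} (h : SubSolvesLN A u Ω) {p : SpN n × ℝ} (hp : p ∈ Ω) :
    SubAt (A p.1) u p := by
  obtain ⟨h1, h2, h3⟩ := h p hp
  exact ⟨_, _, _, Peano.of_contDiffAt h1, h2.hasDerivAt, h3⟩

lemma IsEllipticN.ellMat {lam Lam : ℝ} {A : SpN n → Matrix (Fin n) (Fin n) ℝ}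
    (h : IsEllipticN lam Lam A) (x : SpN n) : EllMat lam Lam (A x) :=
  ⟨h.1 x, h.2 x⟩

lemma SubSolvesLN.rSub {lam Lam : ℝ} (hl : 0 ≤ lam) (hL : 0 ≤ Lam)
    {A : SpN n → Matrix (Fin n) (Fin n) ℝ} (hA : ∀ x, EllMat lam Lam (A x))
    {u : SpN n × ℝ → ℝ} {D : Set (SpN n)} (hD : IsOpen D) {t₁ t₂ : ℝ}
    (h : SubSolvesLN A u (D ×ˢ Ioo t₁ t₂))
    (hu : ∀ p ∈ D ×ˢ Ioo t₁ t₂, 0 ≤ u p ∧ u p ≤ 1) :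
    RSub A (fun p => u p - 1) (D ×ˢ Ioo t₁ t₂) := by
  have hr := rusc_of_subAt hl hL (t₁ := t₁) (t₂ := t₂) hD (A := A) (fun y _ => hA y) (u := u)
    (fun y hy s hs => h.subAt (p := (y, s)) ⟨hy, hs⟩) (fun y hy s hs => hu (y, s) ⟨hy, hs⟩)
    (fun y hy s hs => by
      have := (h (y, s) ⟨hy, hs⟩).1
      exact (this.of_le (m := 1) (by norm_num)).exists_lipschitzOnWith)
  intro p hp
  refine ⟨?_, (hr p hp).of_const_add 1⟩
  simpa [sub_eq_add_neg] using (h.subAt hp).add (SubAt.const (-1))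

end classical

/-! ### Scaling -/

section scaling
variable {n : ℕ}

lemma Peano.comp_affine {f : SpN n → ℝ} {x₀ x : SpN n} {r : ℝ} {g : SpN n →L[ℝ] ℝ}
    {H : Matrix (Fin n) (Fin n) ℝ} (h : Peano f (x₀ + r • x) g H) :
    Peano (fun y => f (x₀ + r • y)) x (r • g) (r ^ 2 • H) := by
  have h1 : Tendsto (fun z : SpN n => r • z) (𝓝 0) (𝓝 0) := by
    have : Continuous (fun z : SpN n => r • z) := by fun_prop
    simpa using this.tendsto 0
  have h2 := IsLittleO.comp_tendsto h h1
  have h3 : ((fun z : SpN n => ‖z‖ ^ 2) ∘ fun z => r • z) =O[𝓝 0] fun z : SpN n => ‖z‖ ^ 2 := by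
    refine IsBigO.of_bound (r ^ 2) (Eventually.of_forall fun z => ?_)
    simp [norm_smul, mul_pow]
  refine (h2.trans_isBigO h3).congr_left fun z => ?_
  simp only [Function.comp_apply, smul_add, quadForm_smul, quadForm_smul_right, smul_apply,
    map_smul, smul_eq_mul, add_assoc]

lemma Peano.congr {f f' : SpN n → ℝ} {x : SpN n} {g : SpN n →L[ℝ] ℝ}
    {H : Matrix (Fin n) (Fin n) ℝ} (h : Peano f x g H) (hf : f' =ᶠ[𝓝 x] f) : Peano f' x g H := by
  have h1 : Tendsto (fun z : SpN n => x + z) (𝓝 0) (𝓝 x) := by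
    have : Continuous (fun z : SpN n => x + z) := by fun_prop
    simpa using this.tendsto 0
  refine IsLittleO.congr' h ?_ EventuallyEq.rfl
  filter_upwards [h1.eventually hf] with z hz
  rw [hz, hf.self_of_nhds]

/-- Parabolic dilation. -/
def parScale (c : SpN n × ℝ) (r : ℝ) (p : SpN n × ℝ) : SpN n × ℝ :=
  (c.1 + r • p.1, c.2 + r ^ 2 * p.2)

lemma SubAt.comp_parScale {B : Matrix (Fin n) (Fin n) ℝ} {u : SpN n × ℝ → ℝ} {p c : SpN n × ℝ}
    {r : ℝ} (h : SubAt B u (parScale c r p)) : SubAt B (fun q => u (parScale c r q)) p := by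
  obtain ⟨τ, g, H, h1, h2, h3⟩ := h
  refine ⟨r ^ 2 * τ, r • g, r ^ 2 • H, h1.comp_affine, ?_, by rw [trPair_smul]; gcongr⟩
  have e1 : HasDerivAt (fun s : ℝ => c.2 + r ^ 2 * s) (r ^ 2) p.2 := by
    simpa using ((hasDerivAt_id p.2).const_mul (r ^ 2)).const_add c.2
  change HasDerivAt (fun s => u (c.1 + r • p.1, s)) τ (c.2 + r ^ 2 * p.2) at h2
  exact (HasDerivAt.comp p.2 (h₂ := fun s => u (c.1 + r • p.1, s)) h2 e1).congr_deriv
    (mul_comm _ _)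

lemma RUsc.comp_parScale {u : SpN n × ℝ → ℝ} {p c : SpN n × ℝ} {r : ℝ}
    (h : RUsc u (parScale c r p)) : RUsc (fun q => u (parScale c r q)) p := by
  intro a ha
  have e1 : Tendsto (fun y : SpN n => c.1 + r • y) (𝓝 p.1) (𝓝 (c.1 + r • p.1)) :=
    Continuous.tendsto (by fun_prop) _
  have e2 : Tendsto (fun t : ℝ => c.2 + r ^ 2 * t) (𝓝[≥] p.2) (𝓝[≥] (c.2 + r ^ 2 * p.2)) := by
    refine tendsto_nhdsWithin_of_tendsto_nhds_of_eventually_within _ ?_ ?_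
    · exact (Continuous.tendsto (by fun_prop) p.2).mono_left nhdsWithin_le_nhds
    · filter_upwards [self_mem_nhdsWithin] with t ht
      have ht : p.2 ≤ t := ht
      change c.2 + r ^ 2 * p.2 ≤ c.2 + r ^ 2 * t
      gcongr
  exact (e1.prodMap e2).eventually (h a ha)

lemma RSub.comp_parScale {A : SpN n → Matrix (Fin n) (Fin n) ℝ} {u : SpN n × ℝ → ℝ}
    {Ω : Set (SpN n × ℝ)} (h : RSub A u Ω) (c : SpN n × ℝ) (r : ℝ) :
    RSub (fun x => A (c.1 + r • x)) (fun q => u (parScale c r q)) (parScale c r ⁻¹' Ω) :=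
  fun _ hp => ⟨(h _ hp).1.comp_parScale, (h _ hp).2.comp_parScale⟩

lemma RSub.const_mul {A : SpN n → Matrix (Fin n) (Fin n) ℝ} {u : SpN n × ℝ → ℝ}
    {Ω : Set (SpN n × ℝ)} {a : ℝ} (ha : 0 < a) (h : RSub A u Ω) : RSub A (fun q => a * u q) Ω :=
  fun p hp => ⟨(h p hp).1.const_mul ha.le, (h p hp).2.const_mul ha⟩

lemma RSub.mono {A : SpN n → Matrix (Fin n) (Fin n) ℝ} {u : SpN n × ℝ → ℝ}
    {Ω Ω' : Set (SpN n × ℝ)} (h : RSub A u Ω) (hΩ : Ω' ⊆ Ω) : RSub A u Ω' :=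
  fun p hp => h p (hΩ hp)

/-! ### Propagation of negativity -/

/-- The profile of the spreading barrier. -/
def spreadProfile (b : ℝ) (x : SpN n) (t : ℝ) : ℝ := 1 - ‖x‖ ^ 2 / (1 + b * t)

lemma spreadProfile_peano {b t : ℝ} (hb : 0 < 1 + b * t) (x : SpN n) :
    Peano (fun y => spreadProfile b y t ^ 2) x
      (-(4 * spreadProfile b x t / (1 + b * t)) • innerSL ℝ x)
      (-(4 * spreadProfile b x t / (1 + b * t)) • 1 +
        (8 / (1 + b * t) ^ 2) • Matrix.vecMulVec x x) := by
  set g := 1 + b * t with hg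
  refine Peano.of_eq_add (R := fun z => (4 * inner ℝ x z * ‖z‖ ^ 2 + ‖z‖ ^ 4) / g ^ 2)
    (C := (4 * ‖x‖ + 1) / g ^ 2) (fun z => ?_) ?_
  · simp only [spreadProfile, ← hg]
    rw [quadForm_add, quadForm_smul, quadForm_smul, quadForm_one, quadForm_vecMulVec,
      norm_add_sq_real]
    simp only [smul_apply, innerSL_apply_apply, smul_eq_mul]
    field_simp
    ring
  · filter_upwards [Metric.closedBall_mem_nhds (0 : SpN n) one_pos] with z hz
    rw [mem_closedBall_zero_iff] at hz
    rw [abs_div, abs_of_pos (by positivity : 0 < g ^ 2), div_mul_eq_mul_div]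
    gcongr
    have h1 := abs_real_inner_le_norm x z
    have h2 : ‖z‖ ^ 4 ≤ ‖z‖ ^ 3 := pow_le_pow_of_le_one (norm_nonneg z) hz (by norm_num)
    calc |4 * inner ℝ x z * ‖z‖ ^ 2 + ‖z‖ ^ 4|
        ≤ |4 * inner ℝ x z * ‖z‖ ^ 2| + |‖z‖ ^ 4| := abs_add_le _ _
      _ = 4 * |inner ℝ x z| * ‖z‖ ^ 2 + ‖z‖ ^ 4 := by
          rw [abs_mul, abs_mul, abs_of_nonneg (by positivity : (0 : ℝ) ≤ ‖z‖ ^ 2),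
            abs_of_nonneg (by positivity : (0 : ℝ) ≤ ‖z‖ ^ 4)]
          norm_num
      _ ≤ 4 * (‖x‖ * ‖z‖) * ‖z‖ ^ 2 + ‖z‖ ^ 3 := by gcongr
      _ = _ := by ring

/-- The spreading barrier is a strict supersolution where it is active. -/
lemma spreadBarrier_super {lam Lam : ℝ} (hl : 0 < lam) {B : Matrix (Fin n) (Fin n) ℝ}
    (hB : EllMat lam Lam B) {b b' m ε t : ℝ} (hb : 0 ≤ b) (hbb : b ≤ b') (ht : 0 ≤ t)
    (hm : (8 * lam + (2 * b' + 4 * (n * Lam))) ^ 2 < 32 * lam * m) {x : SpN n}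
    (hs : 0 < spreadProfile b x t) :
    ∃ τ g H, Peano (fun y => ε + -Real.exp (-m * t) * max (spreadProfile b y t) 0 ^ 2) x g H ∧
      HasDerivAt (fun r => ε + -Real.exp (-m * r) * max (spreadProfile b x r) 0 ^ 2) τ t ∧
      trPair B H < τ := by
  set g := 1 + b * t with hg
  have hg1 : 1 ≤ g := by simp only [hg]; nlinarith [mul_nonneg hb ht]
  have hg0 : 0 < g := by linarith
  set s := spreadProfile b x t with hsd
  set E := Real.exp (-m * t) with hE
  have hE0 : 0 < E := Real.exp_pos _
  have hxg : ‖x‖ ^ 2 = (1 - s) * g := by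
    simp only [hsd, spreadProfile, ← hg]; field_simp; ring
  have hc1 : ContinuousAt (fun y : SpN n => spreadProfile b y t) x := by
    unfold spreadProfile; fun_prop
  have hc2 : ContinuousAt (fun r : ℝ => spreadProfile b x r) t := by
    unfold spreadProfile
    refine ContinuousAt.sub continuousAt_const (ContinuousAt.div continuousAt_const (by fun_prop) ?_)
    exact hg0.ne'
  have e1 : ∀ᶠ y in 𝓝 x, ε + -E * max (spreadProfile b y t) 0 ^ 2 =
      ε + -E * spreadProfile b y t ^ 2 := by
    filter_upwards [hc1.eventually (lt_mem_nhds hs)] with y hy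
    rw [max_eq_left (le_of_lt hy)]
  have e2 : ∀ᶠ r in 𝓝 t, ε + -Real.exp (-m * r) * max (spreadProfile b x r) 0 ^ 2 =
      ε + -Real.exp (-m * r) * spreadProfile b x r ^ 2 := by
    filter_upwards [hc2.eventually (lt_mem_nhds hs)] with y hy
    rw [max_eq_left (le_of_lt hy)]
  have d1 : HasDerivAt (fun r : ℝ => spreadProfile b x r) (b * (1 - s) / g) t := by
    have h1 : HasDerivAt (fun r : ℝ => 1 + b * r) b t := by
      simpa using ((hasDerivAt_id t).const_mul b).const_add 1
    have h2 := ((hasDerivAt_const t (‖x‖ ^ 2)).div h1 hg0.ne').const_sub 1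
    refine h2.congr_deriv ?_
    rw [hxg, ← hg]
    field_simp
    ring
  have d2 : HasDerivAt (fun r : ℝ => Real.exp (-m * r)) (E * -m) t := by
    have h1 : HasDerivAt (fun r : ℝ => -m * r) (-m) t := by
      simpa using (hasDerivAt_id t).const_mul (-m)
    exact h1.exp
  have d3 := ((d2.neg.mul (d1.pow 2)).const_add ε)
  refine ⟨_, _, _, ((Peano.const ε x).add ((spreadProfile_peano hg0 x).const_mul (-E))).congr e1,
    d3.congr_of_eventuallyEq e2, ?_⟩
  simp only [zero_add, trPair_smul, trPair_add, trPair_vecMulVec, ← hg, ← hsd, Nat.cast_ofNat,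
    Pi.pow_apply, Pi.neg_apply, ← hE]
  have t1 := hB.trPair_one_le
  have t2 := (hB.2 x).1
  have hs1 : s ≤ 1 := by
    have : 0 ≤ ‖x‖ ^ 2 / (1 + b * t) := by positivity
    simp only [hsd, spreadProfile]; linarith
  have key : -m * g * s ^ 2 + 2 * s * b * (1 - s) + 4 * (n * Lam) * s < 8 * lam * (1 - s) := by
    have h1 : 0 < m := by
      by_contra! h
      nlinarith [sq_nonneg (8 * lam + (2 * b' + 4 * (n * Lam)))]
    have h2 : 0 < m * s ^ 2 - (8 * lam + (2 * b' + 4 * (n * Lam))) * s + 8 * lam := by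
      by_contra! h
      nlinarith [sq_nonneg (2 * m * s - (8 * lam + (2 * b' + 4 * (n * Lam))))]
    have h3 : s * b * (1 - s) ≤ s * b' := by
      have : s * b * (1 - s) ≤ s * b * 1 := by gcongr; linarith
      have : s * b ≤ s * b' := by gcongr
      linarith
    have h4 : m * 1 * s ^ 2 ≤ m * g * s ^ 2 := by gcongr
    nlinarith
  have h5 : 8 * (lam * ‖x‖ ^ 2) / g ^ 2 ≤ 8 / g ^ 2 * quadForm B x := by
    rw [div_mul_eq_mul_div]; gcongr
  have h6 : 4 * s / g * trPair B 1 ≤ 4 * s / g * (n * Lam) := by gcongr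
  have h7 : 8 * (lam * ‖x‖ ^ 2) / g ^ 2 = 8 * lam * (1 - s) / g := by
    rw [hxg]; field_simp
  have h8 : (-m * g * s ^ 2 + 2 * s * b * (1 - s) + 4 * (n * Lam) * s) / g < 8 * lam * (1 - s) / g := by
    gcongr
  have h9 : (-m * g * s ^ 2 + 2 * s * b * (1 - s) + 4 * (n * Lam) * s) / g =
      -m * s ^ 2 + 2 * s * (b * (1 - s) / g) + 4 * s / g * (n * Lam) := by
    field_simp
  have h10 : E * (-m * s ^ 2 + 2 * s * (b * (1 - s) / g)) <
      E * (-(4 * s / g) * trPair B 1 + 8 / g ^ 2 * quadForm B x) := by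
    refine mul_lt_mul_of_pos_left ?_ hE0
    linarith
  norm_num
  linarith

lemma spread_of_initial {lam Lam : ℝ} (hl : 0 < lam) {R Δ₁ Δ : ℝ} (hR : 1 ≤ R)
    (hΔ₁ : 0 < Δ₁) (hΔ : Δ₁ ≤ Δ) {A : SpN n → Matrix (Fin n) (Fin n) ℝ}
    (hA : ∀ x, EllMat lam Lam (A x)) {w : SpN n × ℝ → ℝ} {m : ℝ}
    (hm : (8 * lam + (2 * (2 * R ^ 2 / Δ₁) + 4 * (n * Lam))) ^ 2 < 32 * lam * m)
    (hw : RSub A w (Metric.closedBall 0 (2 * R) ×ˢ Icc 0 Δ))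
    (hw0 : ∀ p ∈ Metric.closedBall 0 (2 * R) ×ˢ Icc 0 Δ, w p ≤ 0)
    (hi : ∀ x ∈ Metric.ball 0 1, w (x, 0) ≤ -1) :
    ∀ x ∈ Metric.closedBall 0 R, w (x, Δ) ≤ -(Real.exp (-m * Δ) / 4) := by
  have hΔ0 : 0 < Δ := by linarith
  set b := 2 * R ^ 2 / Δ with hb
  have hb0 : 0 ≤ b := by positivity
  have hbb : b ≤ 2 * R ^ 2 / Δ₁ := by simp only [hb]; gcongr
  have hgpos : ∀ t ∈ Icc 0 Δ, 0 < 1 + b * t := fun t ht => by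
    have := mul_nonneg hb0 ht.1; linarith
  have hgle : ∀ t ∈ Icc 0 Δ, 1 + b * t ≤ 1 + 2 * R ^ 2 := fun t ht => by
    have : b * t ≤ b * Δ := by gcongr; exact ht.2
    have h2 : b * Δ = 2 * R ^ 2 := by simp only [hb]; field_simp
    linarith
  have key : ∀ ε > 0, ∀ x ∈ Metric.closedBall 0 (2 * R), ∀ t ∈ Ioc 0 Δ,
      w (x, t) < ε + -Real.exp (-m * t) * max (spreadProfile b x t) 0 ^ 2 := by
    intro ε hε
    have hβ : ∀ x : SpN n, ∀ t ∈ Icc 0 Δ, ContinuousAt (fun q : SpN n × ℝ =>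
        ε + -Real.exp (-m * q.2) * max (spreadProfile b q.1 q.2) 0 ^ 2) (x, t) := by
      intro x t ht
      have h1 : ContinuousAt (fun q : SpN n × ℝ => spreadProfile b q.1 q.2) (x, t) := by
        unfold spreadProfile
        exact ContinuousAt.sub continuousAt_const
          (ContinuousAt.div (by fun_prop) (by fun_prop) (hgpos t ht).ne')
      have h2 : ContinuousAt (fun q : SpN n × ℝ => max (spreadProfile b q.1 q.2) 0 ^ 2) (x, t) :=
        (ContinuousAt.sup h1 continuousAt_const).pow 2
      have h3 : ContinuousAt (fun q : SpN n × ℝ => -Real.exp (-m * q.2)) (x, t) := by fun_prop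
      exact continuousAt_const.add (h3.mul h2)
    refine comparison hl.le (A := A) (w := w)
      (β := fun q => ε + -Real.exp (-m * q.2) * max (spreadProfile b q.1 q.2) 0 ^ 2)
      (isCompact_closedBall 0 (2 * R)) Metric.isOpen_ball Metric.ball_subset_closedBall
      (fun y _ => hA y) ?_ ?_ ?_ ?_ ?_ ?_ ?_
    · intro y hy
      have h0 : (y, (0 : ℝ)) ∈ Metric.closedBall (0 : SpN n) (2 * R) ×ˢ Icc 0 Δ :=
        ⟨hy, le_rfl, hΔ0.le⟩
      have h1 := ((hw (y, 0) h0).2).add (RUsc.of_continuousAt (hβ y 0 ⟨le_rfl, hΔ0.le⟩).neg)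
      have h2 := (h1 0 (by
        change w (y, 0) + -(ε + -Real.exp (-m * 0) * max (1 - ‖y‖ ^ 2 / (1 + b * 0)) 0 ^ 2) < 0
        simp only [mul_zero, Real.exp_zero, add_zero, div_one]
        by_cases hy1 : ‖y‖ < 1
        · have h3 := hi y (by simpa using hy1)
          have h4 : max (1 - ‖y‖ ^ 2) 0 ^ 2 ≤ 1 := by
            refine pow_le_one₀ (le_max_right _ _) (max_le ?_ zero_le_one)
            linarith [sq_nonneg ‖y‖]
          linarith
        · have h3 := hw0 _ h0
          have h4 : max (1 - ‖y‖ ^ 2) 0 = 0 := max_eq_right (by nlinarith [not_lt.1 hy1])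
          rw [h4]
          linarith)).filter_mono (Filter.prod_mono (le_refl (𝓝 y))
            (nhdsWithin_mono 0 Ioi_subset_Ici_self))
      filter_upwards [h2] with q hq _
      change w q + -(ε + -Real.exp (-m * q.2) * max (spreadProfile b q.1 q.2) 0 ^ 2) < 0 at hq
      linarith
    · exact fun y hy s hs => (hw (y, s) ⟨hy, Ioc_subset_Icc_self hs⟩).2
    · exact fun y hy s hs => (hw (y, s) ⟨hy, Ioc_subset_Icc_self hs⟩).1.continuousAt_time
    · exact fun y hy s hs => hβ y s (Ioc_subset_Icc_self hs)
    · intro y hy s hs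
      have hs' := Ioc_subset_Icc_self hs
      have hd : ‖y‖ = 2 * R := by
        have h1 := mem_closedBall_zero_iff.1 hy.1
        have h2 : ¬ ‖y‖ < 2 * R := fun h => hy.2 (mem_ball_zero_iff.2 h)
        linarith [not_lt.1 h2]
      have h3 := hw0 _ (show (y, s) ∈ _ from ⟨hy.1, hs'⟩)
      have h4 : spreadProfile b y s ≤ 0 := by
        simp only [spreadProfile, sub_nonpos]
        rw [one_le_div (hgpos s hs'), hd]
        nlinarith [hgle s hs']
      simp only
      rw [max_eq_right h4]
      linarith
    · exact fun y hy s hs =>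
        (hw (y, s) ⟨Metric.ball_subset_closedBall hy, Ioc_subset_Icc_self hs⟩).1
    · intro y hy s hs heq
      have h3 := hw0 _ (show (y, s) ∈ _ from
        ⟨Metric.ball_subset_closedBall hy, Ioc_subset_Icc_self hs⟩)
      refine spreadBarrier_super hl (hA y) hb0 hbb hs.1.le hm ?_
      by_contra! h4
      rw [max_eq_right h4] at heq
      linarith
  intro x hx
  have hx2 : x ∈ Metric.closedBall (0 : SpN n) (2 * R) :=
    Metric.closedBall_subset_closedBall (by linarith) hx
  have h1 : w (x, Δ) ≤ -Real.exp (-m * Δ) * max (spreadProfile b x Δ) 0 ^ 2 := by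
    refine le_of_forall_pos_le_add fun ε hε => ?_
    have := key ε hε x hx2 Δ ⟨hΔ0, le_rfl⟩
    linarith
  have h2 : 1 / 2 ≤ spreadProfile b x Δ := by
    have h3 : 1 + b * Δ = 1 + 2 * R ^ 2 := by simp only [hb]; field_simp
    simp only [spreadProfile, h3]
    have h4 : ‖x‖ ^ 2 ≤ R ^ 2 := by
      have := mem_closedBall_zero_iff.1 hx
      gcongr
    have h5 : ‖x‖ ^ 2 / (1 + 2 * R ^ 2) ≤ 1 / 2 := by
      rw [div_le_iff₀ (by positivity)]; linarith
    linarith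
  have h6 : (1 / 2 : ℝ) ^ 2 ≤ max (spreadProfile b x Δ) 0 ^ 2 := by
    gcongr
    exact h2.trans (le_max_left _ _)
  have hE := Real.exp_pos (-m * Δ)
  nlinarith

/-- Negativity on a ball spreads to larger balls at later times. -/
lemma exists_spread_const (n : ℕ) {lam Lam : ℝ} (hl : 0 < lam) {R Δ₁ Δ₂ : ℝ} (hR : 1 ≤ R)
    (hΔ₁ : 0 < Δ₁) :
    ∃ c : ℝ, 0 < c ∧ ∀ (A : SpN n → Matrix (Fin n) (Fin n) ℝ), (∀ x, EllMat lam Lam (A x)) →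
      ∀ (w : SpN n × ℝ → ℝ) (x₀ : SpN n) (t₀ ρ Δ a : ℝ), 0 < ρ → 0 < a → Δ ∈ Icc Δ₁ Δ₂ →
        RSub A w (Metric.closedBall x₀ (2 * R * ρ) ×ˢ Icc t₀ (t₀ + ρ ^ 2 * Δ)) →
        (∀ p ∈ Metric.closedBall x₀ (2 * R * ρ) ×ˢ Icc t₀ (t₀ + ρ ^ 2 * Δ), w p ≤ 0) →
        (∀ x ∈ Metric.ball x₀ ρ, w (x, t₀) ≤ -a) →
        ∀ x ∈ Metric.closedBall x₀ (R * ρ), w (x, t₀ + ρ ^ 2 * Δ) ≤ -(c * a) := by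
  obtain ⟨m, hm⟩ : ∃ m, (8 * lam + (2 * (2 * R ^ 2 / Δ₁) + 4 * (n * Lam))) ^ 2 < 32 * lam * m :=
    ⟨((8 * lam + (2 * (2 * R ^ 2 / Δ₁) + 4 * (n * Lam))) ^ 2 + 1) / (32 * lam), by
      rw [mul_div_cancel₀ _ (by positivity)]; linarith⟩
  have hm0 : 0 < m := by
    by_contra! h
    nlinarith [sq_nonneg (8 * lam + (2 * (2 * R ^ 2 / Δ₁) + 4 * (n * Lam)))]
  refine ⟨Real.exp (-m * Δ₂) / 4, by positivity, ?_⟩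
  intro A hA w x₀ t₀ ρ Δ a hρ ha hΔ hw hw0 hi x hx
  have hmaps : ∀ p ∈ Metric.closedBall (0 : SpN n) (2 * R) ×ˢ Icc 0 Δ, parScale (x₀, t₀) ρ p ∈
      Metric.closedBall x₀ (2 * R * ρ) ×ˢ Icc t₀ (t₀ + ρ ^ 2 * Δ) := by
    intro p hp
    refine ⟨?_, ?_, ?_⟩
    · have := mem_closedBall_zero_iff.1 hp.1
      rw [mem_closedBall_iff_norm]
      simp only [parScale, add_sub_cancel_left, norm_smul, Real.norm_eq_abs, abs_of_pos hρ]
      rw [mul_comm]; gcongr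
    · have : 0 ≤ ρ ^ 2 * p.2 := mul_nonneg (by positivity) hp.2.1
      simp only [parScale]; linarith
    · have : ρ ^ 2 * p.2 ≤ ρ ^ 2 * Δ := by gcongr; exact hp.2.2
      simp only [parScale]; linarith
  have hres := spread_of_initial hl hR hΔ₁ hΔ.1 (A := fun x => A (x₀ + ρ • x))
    (fun x => hA _) (w := fun q => a⁻¹ * w (parScale (x₀, t₀) ρ q)) hm
    (((hw.comp_parScale (x₀, t₀) ρ).const_mul (inv_pos.2 ha)).mono hmaps)
    (fun p hp => mul_nonpos_of_nonneg_of_nonpos (inv_pos.2 ha).le (hw0 _ (hmaps p hp)))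
    (fun y hy => by
      have h1 := hi (x₀ + ρ • y) (by
        rw [mem_ball_iff_norm, add_sub_cancel_left, norm_smul, Real.norm_eq_abs, abs_of_pos hρ]
        have := mem_ball_zero_iff.1 hy
        nlinarith)
      simp only [parScale, mul_zero, add_zero]
      calc a⁻¹ * w (x₀ + ρ • y, t₀) ≤ a⁻¹ * -a := by gcongr
        _ = -1 := by field_simp)
    (ρ⁻¹ • (x - x₀)) (by
      rw [mem_closedBall_zero_iff, norm_smul, norm_inv, Real.norm_eq_abs, abs_of_pos hρ]
      have := mem_closedBall_iff_norm.1 hx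
      rw [inv_mul_le_iff₀ hρ]; linarith)
  have h2 : parScale (x₀, t₀) ρ (ρ⁻¹ • (x - x₀), Δ) = (x, t₀ + ρ ^ 2 * Δ) := by
    simp [parScale, smul_smul, hρ.ne']
  simp only [h2] at hres
  have h3 : Real.exp (-m * Δ₂) ≤ Real.exp (-m * Δ) := by
    refine Real.exp_le_exp.2 ?_
    have := mul_le_mul_of_nonneg_left hΔ.2 hm0.le
    linarith
  rw [inv_mul_le_iff₀ ha] at hres
  have h4 := mul_le_mul_of_nonneg_left h3 ha.le
  nlinarith

end scaling

/-! ### The parabolic dyadic grid -/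

section grid
variable {n : ℕ}

/-- Index of the spatial dyadic cube of side `2⁻ᵏ` containing `x`. -/
def gridX (k : ℕ) (x : SpN n) : Fin n → ℤ := fun i => ⌊2 ^ k * x i⌋

/-- Index of the time interval of length `4⁻ᵏ` containing `t`. -/
def gridT (k : ℕ) (t : ℝ) : ℤ := ⌊4 ^ k * t⌋

/-- Index of the parabolic dyadic box of level `k` containing `p`. -/
def gridIdx (k : ℕ) (p : SpN n × ℝ) : (Fin n → ℤ) × ℤ := (gridX k p.1, gridT k p.2)

/-- The parabolic dyadic box of level `k` with index `I`. -/
def gridBox (k : ℕ) (I : (Fin n → ℤ) × ℤ) : Set (SpN n × ℝ) := {p | gridIdx k p = I}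

lemma gridBox_eq_prod (k : ℕ) (I : (Fin n → ℤ) × ℤ) :
    gridBox k I = {x | gridX k x = I.1} ×ˢ {t | gridT k t = I.2} := by
  ext p
  simp [gridBox, gridIdx, Prod.ext_iff]

lemma gridT_eq_iff {k : ℕ} {t : ℝ} {m : ℤ} :
    gridT k t = m ↔ t ∈ Ico ((m : ℝ) / 4 ^ k) ((m : ℝ) / 4 ^ k + 1 / 4 ^ k) := by
  have h : (0 : ℝ) < 4 ^ k := by positivity
  rw [gridT, Int.floor_eq_iff, mem_Ico, div_le_iff₀ h, ← add_div, lt_div_iff₀ h, mul_comm t]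

lemma gridX_eq_iff {k : ℕ} {x : SpN n} {m : Fin n → ℤ} :
    gridX k x = m ↔ ∀ i, x i ∈ Ico ((m i : ℝ) / 2 ^ k) ((m i : ℝ) / 2 ^ k + 1 / 2 ^ k) := by
  have h : (0 : ℝ) < 2 ^ k := by positivity
  rw [funext_iff]
  refine forall_congr' fun i => ?_
  rw [gridX, Int.floor_eq_iff, mem_Ico, div_le_iff₀ h, ← add_div, lt_div_iff₀ h, mul_comm (x i)]

lemma setOf_gridT_eq (k : ℕ) (m : ℤ) :
    {t | gridT k t = m} = Ico ((m : ℝ) / 4 ^ k) ((m : ℝ) / 4 ^ k + 1 / 4 ^ k) :=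
  Set.ext fun _ => gridT_eq_iff

lemma setOf_gridX_eq (k : ℕ) (m : Fin n → ℤ) :
    {x : SpN n | gridX k x = m} = WithLp.ofLp ⁻¹'
      (Set.pi univ fun i => Ico ((m i : ℝ) / 2 ^ k) ((m i : ℝ) / 2 ^ k + 1 / 2 ^ k)) := by
  ext x
  simp only [mem_ofPred_eq, gridX_eq_iff, mem_preimage, mem_univ_pi]

lemma measurableSet_gridX (k : ℕ) (m : Fin n → ℤ) :
    MeasurableSet {x : SpN n | gridX k x = m} := by
  rw [setOf_gridX_eq]
  exact (PiLp.volume_preserving_ofLp (Fin n)).measurable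
    (MeasurableSet.univ_pi fun i => measurableSet_Ico)

lemma measurableSet_gridBox (k : ℕ) (I : (Fin n → ℤ) × ℤ) : MeasurableSet (gridBox k I) := by
  rw [gridBox_eq_prod, setOf_gridT_eq]
  exact (measurableSet_gridX k _).prod measurableSet_Ico

lemma volume_gridBox (k : ℕ) (I : (Fin n → ℤ) × ℤ) :
    volume (gridBox k I) = ENNReal.ofReal ((1 / 2 ^ k) ^ (n + 2)) := by
  rw [gridBox_eq_prod, setOf_gridT_eq, Measure.volume_eq_prod, Measure.prod_prod, setOf_gridX_eq,
    (PiLp.volume_preserving_ofLp (Fin n)).measure_preimage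
      (MeasurableSet.univ_pi fun i => measurableSet_Ico).nullMeasurableSet, volume_pi_pi]
  simp only [Real.volume_Ico, add_sub_cancel_left, Finset.prod_const, Finset.card_univ,
    Fintype.card_fin]
  rw [← ENNReal.ofReal_pow (by positivity), ← ENNReal.ofReal_mul (by positivity), pow_add]
  congr 2
  rw [div_pow, one_pow, ← pow_mul, mul_comm k, pow_mul]
  norm_num

lemma measurableSet_setOf_gridIdx_mem (k : ℕ) (J : Set ((Fin n → ℤ) × ℤ)) :
    MeasurableSet {p : SpN n × ℝ | gridIdx k p ∈ J} := by
  have : {p : SpN n × ℝ | gridIdx k p ∈ J} = ⋃ I ∈ J, gridBox k I := by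
    ext p; simp [gridBox]
  rw [this]
  exact MeasurableSet.biUnion (to_countable J) fun I _ => measurableSet_gridBox k I

lemma floor_two_pow_half (k : ℕ) (a : ℝ) : ⌊2 ^ k * a⌋ = ⌊2 ^ (k + 1) * a⌋ / 2 := by
  have := Int.floor_div_natCast (2 ^ (k + 1) * a) 2
  push_cast at this
  rw [← this]
  congr 1
  rw [pow_succ]; ring

lemma floor_four_pow_quarter (k : ℕ) (a : ℝ) : ⌊4 ^ k * a⌋ = ⌊4 ^ (k + 1) * a⌋ / 4 := by
  have := Int.floor_div_natCast (4 ^ (k + 1) * a) 4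
  push_cast at this
  rw [← this]
  congr 1
  rw [pow_succ]; ring

lemma gridIdx_eq_of_le {j k : ℕ} (hjk : j ≤ k) {p q : SpN n × ℝ}
    (h : gridIdx k p = gridIdx k q) : gridIdx j p = gridIdx j q := by
  induction k, hjk using Nat.le_induction with
  | base => exact h
  | succ k _ ih =>
    refine ih (Prod.ext (funext fun i => ?_) ?_)
    · have := congrFun (congrArg Prod.fst h) i
      simp only [gridIdx, gridX] at this ⊢
      rw [floor_two_pow_half, this, ← floor_two_pow_half]
    · have := congrArg Prod.snd h
      simp only [gridIdx, gridT] at this ⊢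
      rw [floor_four_pow_quarter, this, ← floor_four_pow_quarter]

lemma norm_le_of_coord_le {x : SpN n} {a : ℝ} (h : ∀ i, |x i| ≤ a) : ‖x‖ ≤ n * a := by
  rcases Nat.eq_zero_or_pos n with rfl | hn
  · simp [EuclideanSpace.norm_eq]
  · have h0 : 0 ≤ a := (abs_nonneg _).trans (h ⟨0, hn⟩)
    refine abs_le_of_sq_le_sq' ?_ (by positivity) |>.2
    rw [EuclideanSpace.norm_sq_eq]
    calc ∑ i, ‖x i‖ ^ 2 ≤ ∑ _i : Fin n, a ^ 2 := by
          gcongr with i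
          exact h i
      _ = n * a ^ 2 := by simp
      _ ≤ n * n * a ^ 2 := by
          have : (1 : ℝ) ≤ n := by exact_mod_cast hn
          gcongr
          nlinarith
      _ = (n * a) ^ 2 := by ring

lemma abs_sub_lt_of_gridIdx_eq {k : ℕ} {p q : SpN n × ℝ} (h : gridIdx k p = gridIdx k q) :
    (∀ i, |p.1 i - q.1 i| < 1 / 2 ^ k) ∧ |p.2 - q.2| < 1 / 4 ^ k := by
  have h1 := gridX_eq_iff.1 (congrArg Prod.fst h)
  have h2 := gridX_eq_iff.1 (rfl : gridX k q.1 = _)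
  have h3 := gridT_eq_iff.1 (congrArg Prod.snd h)
  have h4 := gridT_eq_iff.1 (rfl : gridT k q.2 = _)
  refine ⟨fun i => ?_, ?_⟩
  · have a := h1 i
    have b := h2 i
    simp only [gridIdx, mem_Ico] at a b
    rw [abs_lt]; constructor <;> linarith
  · simp only [gridIdx, mem_Ico] at h3 h4
    rw [abs_lt]; constructor <;> linarith

lemma norm_sub_le_of_gridIdx_eq {k : ℕ} {p q : SpN n × ℝ} (h : gridIdx k p = gridIdx k q) :
    ‖p.1 - q.1‖ ≤ n * (1 / 2 ^ k) :=
  norm_le_of_coord_le fun i => ((abs_sub_lt_of_gridIdx_eq h).1 i).le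

variable {α : Type*} [MeasurableSpace α] {μ : Measure α}

lemma measure_gridIdx_preimage_le (Ψ : α → SpN n × ℝ) {Y : Set α} {C : ENNReal} {k : ℕ}
    {J : Set ((Fin n → ℤ) × ℤ)}
    (h : ∀ I ∈ J, μ (Y ∩ Ψ ⁻¹' gridBox k I) ≤ C * volume (gridBox (n := n) k I)) :
    μ (Y ∩ Ψ ⁻¹' {p | gridIdx k p ∈ J}) ≤ C * volume {p : SpN n × ℝ | gridIdx k p ∈ J} := by
  have e : {p : SpN n × ℝ | gridIdx k p ∈ J} = ⋃ I ∈ J, gridBox k I := by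
    ext p; simp [gridBox]
  have hd : J.PairwiseDisjoint (gridBox (n := n) k) := fun I _ I' _ hne =>
    Set.disjoint_left.2 fun p hp hp' => hne (hp.symm.trans hp')
  rw [e, measure_biUnion (to_countable J) hd fun I _ => measurableSet_gridBox k I,
    ← ENNReal.tsum_mul_left]
  simp only [preimage_iUnion, inter_iUnion]
  exact (measure_biUnion_le μ (to_countable J) _).trans
    (ENNReal.tsum_le_tsum fun I => h I I.2)

/-- The measure of a set is controlled by that of its image, if it is on small dyadic boxes. -/
lemma measure_le_of_gridBox (Ψ : α → SpN n × ℝ) {Y : Set α} {C : ENNReal} (hC : C ≠ ⊤) {N : ℕ}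
    (h : ∀ k ≥ N, ∀ I, (Y ∩ Ψ ⁻¹' gridBox k I).Nonempty →
      μ (Y ∩ Ψ ⁻¹' gridBox k I) ≤ C * volume (gridBox (n := n) k I)) :
    μ Y ≤ C * volume (Ψ '' Y) := by
  have key : ∀ U, IsOpen U → Ψ '' Y ⊆ U → μ Y ≤ C * volume U := by
    intro U hU hYU
    set S : ℕ → Set α := fun k => Y ∩ Ψ ⁻¹' {p | gridIdx (k + N) p ∈
      {I | gridBox (k + N) I ⊆ U}} with hS
    have hmono : Monotone S := by
      refine monotone_nat_of_le_succ fun k y hy => ⟨hy.1, fun q hq => hy.2 ?_⟩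
      exact gridIdx_eq_of_le (by omega) hq
    have hun : Y ⊆ ⋃ k, S k := by
      intro y hy
      obtain ⟨ε, hε, hball⟩ := Metric.isOpen_iff.1 hU (Ψ y) (hYU (mem_image_of_mem _ hy))
      have t1 : Tendsto (fun k : ℕ => (n : ℝ) * (1 / 2) ^ k) atTop (𝓝 (n * 0)) :=
        (tendsto_pow_atTop_nhds_zero_of_lt_one (by norm_num) (by norm_num)).const_mul _
      have t2 : Tendsto (fun k : ℕ => (1 / 4 : ℝ) ^ k) atTop (𝓝 0) :=
        tendsto_pow_atTop_nhds_zero_of_lt_one (by norm_num) (by norm_num)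
      rw [mul_zero] at t1
      obtain ⟨k, hk1, hk2, hkN⟩ := ((t1.eventually (gt_mem_nhds hε)).and
        ((t2.eventually (gt_mem_nhds hε)).and (eventually_ge_atTop N))).exists
      refine mem_iUnion.2 ⟨k - N, hy, ?_⟩
      have e : k - N + N = k := by omega
      change gridBox (k - N + N) (gridIdx (k - N + N) (Ψ y)) ⊆ U
      rw [e]
      intro q hq
      refine hball ?_
      have hq' : gridIdx k q = gridIdx k (Ψ y) := hq
      have a1 := norm_sub_le_of_gridIdx_eq hq'
      have a2 := (abs_sub_lt_of_gridIdx_eq hq').2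
      rw [← one_div_pow] at a1 a2
      rw [Metric.mem_ball, Prod.dist_eq, max_lt_iff, dist_eq_norm, Real.dist_eq]
      exact ⟨a1.trans_lt hk1, a2.trans hk2⟩
    calc μ Y ≤ μ (⋃ k, S k) := measure_mono hun
      _ = ⨆ k, μ (S k) := hmono.measure_iUnion
      _ ≤ C * volume U := iSup_le fun k => by
          refine (measure_gridIdx_preimage_le Ψ (C := C) (J := {I | gridBox (k + N) I ⊆ U})
            fun I _ => ?_).trans ?_
          · rcases (Y ∩ Ψ ⁻¹' gridBox (k + N) I).eq_empty_or_nonempty with h0 | h0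
            · rw [h0]; simp
            · exact h _ (by omega) I h0
          · gcongr
            intro p hp
            exact hp rfl
  rcases eq_or_ne C 0 with rfl | hC0
  · simpa using key univ isOpen_univ (subset_univ _)
  rw [Set.measure_eq_iInf_isOpen (Ψ '' Y) volume]
  rw [ENNReal.mul_iInf_of_ne hC0 hC]
  refine le_iInf fun U => ?_
  rw [ENNReal.mul_iInf_of_ne hC0 hC]
  refine le_iInf fun hU => ?_
  rw [ENNReal.mul_iInf_of_ne hC0 hC]
  exact le_iInf fun hU' => key U hU' hU

end grid

/-! ### Contact points with sliding paraboloids -/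

section contact
variable {n : ℕ}

/-- `p` is the first contact of `w` with the sliding paraboloid of vertex `q.1` and height `q.2`,
and `w` is regular with constant `K` at scale `1 / (N + 1)` near `p`. -/
structure ContactAt (w : SpN n × ℝ → ℝ) (K : ℝ) (N : ℕ) (q p : SpN n × ℝ) : Prop where
  norm_add_le : ‖p.1‖ + 1 / (N + 1 : ℝ) ≤ 3 / 4
  time_mem : p.2 ∈ Ioc (0 : ℝ) 1
  eq : w p = q.2 + 4 * ‖p.1 - q.1‖ ^ 2 - p.2
  le : ∀ z, ‖z‖ ≤ 3 / 4 → ∀ s ∈ Ioc 0 p.2, w (z, s) ≤ q.2 + 4 * ‖z - q.1‖ ^ 2 - s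
  lower : ∀ z : SpN n, ‖z‖ < 1 / (N + 1 : ℝ) →
    w p + inner ℝ ((8 : ℝ) • (p.1 - q.1)) z - K * ‖z‖ ^ 2 ≤ w (p.1 + z, p.2)
  time : ∀ s ∈ Ico 0 (1 / (N + 1 : ℝ)), w p - w (p.1, p.2 - s) ≤ K * s

lemma peano_slidingParaboloid (y x : SpN n) (a : ℝ) :
    Peano (fun z => a + 4 * ‖z - y‖ ^ 2) x (innerSL ℝ ((8 : ℝ) • (x - y))) ((8 : ℝ) • 1) := by
  have h := (Peano.const a x).add ((Peano.normSq y x).const_mul 4)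
  have e1 : (0 : SpN n →L[ℝ] ℝ) + (4 : ℝ) • ((2 : ℝ) • innerSL ℝ (x - y)) =
      innerSL ℝ ((8 : ℝ) • (x - y)) := by
    rw [zero_add, smul_smul, map_smul]; norm_num
  have e2 : (0 : Matrix (Fin n) (Fin n) ℝ) + (4 : ℝ) • ((2 : ℝ) • 1) = (8 : ℝ) • 1 := by
    rw [zero_add, smul_smul]; norm_num
  rw [e1, e2] at h
  exact h

lemma exists_contact {lam Lam : ℝ} (hl : 0 < lam) (hL : 0 ≤ Lam)
    {A : SpN n → Matrix (Fin n) (Fin n) ℝ} (hA : ∀ x, EllMat lam Lam (A x)) {w : SpN n × ℝ → ℝ}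
    (hw : RSub A w (Metric.closedBall 0 1 ×ˢ Icc 0 1))
    (hw0 : ∀ p ∈ Metric.closedBall 0 1 ×ˢ Icc 0 1, w p ≤ 0) (h : -(1 / 2) < w (0, 1))
    {q : SpN n × ℝ} (hq : q ∈ Metric.ball 0 (1 / 4) ×ˢ Ioo 0 (1 / 4)) :
    ∃ p N, ContactAt w ((8 * (n * Lam) + 1) / lam + 8 * (n * Lam) + 1) N q p := by
  obtain ⟨y, a⟩ := q
  have hy : ‖y‖ < 1 / 4 := mem_ball_zero_iff.1 hq.1
  have ha : a ∈ Ioo (0 : ℝ) (1 / 4) := hq.2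
  have hdom : ∀ z : SpN n, ‖z‖ ≤ 3 / 4 → ∀ s ∈ Icc (0 : ℝ) 1,
      (z, s) ∈ Metric.closedBall (0 : SpN n) 1 ×ˢ Icc (0 : ℝ) 1 := fun z hz s hs =>
    ⟨mem_closedBall_zero_iff.2 (hz.trans (by norm_num)), hs⟩
  have hcont : Continuous fun p : SpN n × ℝ => a + 4 * ‖p.1 - y‖ ^ 2 - p.2 := by fun_prop
  have husc : ∀ z : SpN n, ‖z‖ ≤ 3 / 4 → ∀ s ∈ Icc (0 : ℝ) 1,
      RUsc (fun p => w p + -(a + 4 * ‖p.1 - y‖ ^ 2 - p.2)) (z, s) := fun z hz s hs =>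
    (hw _ (hdom z hz s hs)).2.add (RUsc.of_continuousAt hcont.neg.continuousAt)
  obtain ⟨x, hx, t, ht, hxt, hle⟩ := exists_first_touch
    (isCompact_closedBall (0 : SpN n) (3 / 4)) (T₀ := 0) (T₁ := 1)
    (fun p => w p + -(a + 4 * ‖p.1 - y‖ ^ 2 - p.2))
    (fun z hz => by
      have hz' := mem_closedBall_zero_iff.1 hz
      have h0 := hw0 _ (hdom z hz' 0 ⟨le_rfl, zero_le_one⟩)
      have := husc z hz' 0 ⟨le_rfl, zero_le_one⟩ 0 (by
        change w (z, 0) + -(a + 4 * ‖z - y‖ ^ 2 - 0) < 0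
        have := sq_nonneg ‖z - y‖
        linarith [ha.1])
      refine (this.filter_mono (Filter.prod_mono (le_refl (𝓝 z))
        (nhdsWithin_mono 0 Ioi_subset_Ici_self))).mono fun _ h _ => h)
    (fun z hz s hs hneg => (husc z (mem_closedBall_zero_iff.1 hz) s (Ioc_subset_Icc_self hs) 0
      hneg).mono fun _ h _ => h)
    (fun z hz s hs => by
      have h1 := (hw _ (hdom z (mem_closedBall_zero_iff.1 hz) s
        (Ioc_subset_Icc_self hs))).1.continuousAt_time
      have h2 : ContinuousAt (fun t : ℝ => -(a + 4 * ‖z - y‖ ^ 2 - t)) s := by fun_prop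
      exact (h1.add h2).continuousWithinAt)
    ⟨0, by simp; norm_num, 1, ⟨zero_lt_one, le_rfl⟩, by
      simp only [zero_sub, norm_neg]
      nlinarith [norm_nonneg y, ha.2]⟩
  have hx' := mem_closedBall_zero_iff.1 hx
  have hmem := hdom x hx' t (Ioc_subset_Icc_self ht)
  have heq : w (x, t) = a + 4 * ‖x - y‖ ^ 2 - t := by
    simp only at hxt
    linarith
  have hle' : ∀ z : SpN n, ‖z‖ ≤ 3 / 4 → ∀ s ∈ Ioc 0 t, w (z, s) ≤ a + 4 * ‖z - y‖ ^ 2 - s := by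
    intro z hz s hs
    have := hle z (mem_closedBall_zero_iff.2 hz) s hs
    simp only at this
    linarith
  have hx34 : ‖x‖ < 3 / 4 := by
    have h1 := hw0 _ hmem
    have h2 : ‖x - y‖ < 1 / 2 := by
      by_contra! hcon
      nlinarith [ht.2, ha.1]
    have h3 : ‖x‖ ≤ ‖x - y‖ + ‖y‖ := by simpa using norm_add_le (x - y) y
    linarith
  obtain ⟨τ, g, H, h1, h2, h3⟩ := (hw _ hmem).1
  simp only at h1 h2 h3
  have hP := peano_slidingParaboloid y x (a - t)
  obtain ⟨hg, hH⟩ := h1.touch hP (by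
    have : ∀ᶠ z in 𝓝 x, ‖z‖ < 3 / 4 :=
      (continuous_norm.tendsto x).eventually (gt_mem_nhds hx34)
    filter_upwards [this] with z hz
    have := hle' z hz.le t ⟨ht.1, le_rfl⟩
    linarith)
  have hτ : 0 ≤ τ + 1 := by
    have hd := h2.add (hasDerivAt_id t)
    refine hd.nonneg_of_le_left ht.1 fun s hs => ?_
    have := hle' x hx34.le s hs
    simp only [Pi.add_apply, id]
    linarith
  have hn0 : 0 ≤ n * Lam := by positivity
  have htr : trPair (A x) ((8 : ℝ) • 1) ≤ 8 * (n * Lam) := by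
    rw [trPair_smul]
    have := (hA x).trPair_one_le
    linarith
  have hτ2 : τ ≤ 8 * (n * Lam) := (h3.trans ((hA x).trPair_mono hl.le hH)).trans htr
  have hHlow : ∀ z, -((8 * (n * Lam) + 1) / lam * ‖z‖ ^ 2) ≤ quadForm H z := by
    intro z
    have e1 := (hA x).quadForm_le_trPair hl.le (M := (8 : ℝ) • 1 - H)
      (fun z => by rw [quadForm_sub]; linarith [hH z]) z
    rw [quadForm_sub, trPair_sub] at e1
    have e2 : ‖z‖ ^ 2 * (trPair (A x) ((8 : ℝ) • 1) - trPair (A x) H) ≤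
        ‖z‖ ^ 2 * (8 * (n * Lam) + 1) := by
      gcongr
      linarith
    have e3 : 0 ≤ quadForm ((8 : ℝ) • (1 : Matrix (Fin n) (Fin n) ℝ)) z := by
      rw [quadForm_smul, quadForm_one]; positivity
    have e4 : -quadForm H z * lam ≤ (8 * (n * Lam) + 1) * ‖z‖ ^ 2 := by nlinarith
    have e5 := (le_div_iff₀ hl).2 e4
    rw [mul_div_right_comm] at e5
    linarith
  have E1 : ∀ᶠ z in 𝓝 (0 : SpN n), w (x, t) + inner ℝ ((8 : ℝ) • (x - y)) z -
      ((8 * (n * Lam) + 1) / lam + 8 * (n * Lam) + 1) * ‖z‖ ^ 2 ≤ w (x + z, t) := by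
    filter_upwards [h1.bound one_pos] with z hz
    rw [Real.norm_eq_abs, Real.norm_eq_abs, one_mul, abs_of_nonneg (sq_nonneg ‖z‖), hg,
      innerSL_apply_apply] at hz
    have := (abs_le.1 hz).1
    have e := hHlow z
    have e2 : 0 ≤ (8 * (n * Lam) + 1) / lam * ‖z‖ ^ 2 := by positivity
    have e3 : 0 ≤ 8 * (n * Lam) * ‖z‖ ^ 2 := by positivity
    linarith
  have E2 : ∀ᶠ s in 𝓝 (0 : ℝ), w (x, t) - w (x, t - s) ≤
      τ * s + 1 * |s| := by
    have hsub : Tendsto (fun s : ℝ => t - s) (𝓝 0) (𝓝 t) :=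
      Continuous.tendsto' (by fun_prop) _ _ (by simp)
    have := hsub.eventually ((hasDerivAt_iff_isLittleO.1 h2).bound one_pos)
    filter_upwards [this] with s hs
    simp only [Real.norm_eq_abs, smul_eq_mul] at hs
    have h4 := (abs_le.1 hs).1
    rw [show t - s - t = -s by ring, abs_neg] at h4
    linarith
  obtain ⟨ε₁, hε₁, hE1⟩ := Metric.eventually_nhds_iff.1 E1
  obtain ⟨ε₂, hε₂, hE2⟩ := Metric.eventually_nhds_iff.1 E2
  obtain ⟨N, hN⟩ := exists_nat_one_div_lt
    (lt_min (lt_min hε₁ hε₂) (by linarith : 0 < 3 / 4 - ‖x‖))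
  rw [lt_min_iff, lt_min_iff] at hN
  refine ⟨(x, t), N, ?_, ht, heq, hle', ?_, ?_⟩
  · simp only; linarith [hN.2]
  · intro z hz
    exact hE1 (by rw [dist_zero_right]; exact hz.trans hN.1.1)
  · intro s hs
    have := hE2 (y := s) (by
      rw [dist_zero_right, Real.norm_eq_abs, abs_of_nonneg hs.1]; exact hs.2.trans hN.1.2)
    rw [abs_of_nonneg hs.1] at this
    have e1 : τ * s ≤ 8 * (n * Lam) * s := mul_le_mul_of_nonneg_right hτ2 hs.1
    have e2 : 0 ≤ (8 * (n * Lam) + 1) / lam * s := mul_nonneg (by positivity) hs.1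
    simp only
    linarith

/-- Vertices and heights of paraboloids with nearby contact points are close. -/
lemma ContactAt.compare_of_le {w : SpN n × ℝ → ℝ} {K : ℝ} (hK : 0 ≤ K) {N : ℕ}
    {q p q' p' : SpN n × ℝ} (h : ContactAt w K N q p) (h' : ContactAt w K N q' p') {r : ℝ}
    (hr : 0 < r) (hrN : (n + 1) * r < 1 / (N + 1 : ℝ)) (hx : ‖p'.1 - p.1‖ ≤ n * r)
    (htt : p.2 ≤ p'.2) (ht : p'.2 - p.2 ≤ r ^ 2) (hr2 : r ^ 2 < 1 / (N + 1 : ℝ)) {C : ℝ}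
    (hC : K * (n + 1) ^ 2 + 4 * n ^ 2 + K + 5 ≤ C) :
    ‖(8 : ℝ) • (p.1 - q.1) - (8 : ℝ) • (p'.1 - q'.1)‖ ≤ C * r ∧
      |q'.2 - q.2 - inner ℝ ((8 : ℝ) • (p.1 - q.1)) (q'.1 - q.1)| ≤
        (C + C * n + C ^ 2) * r ^ 2 := by
  obtain ⟨x, t⟩ := p
  obtain ⟨x', t'⟩ := p'
  obtain ⟨y, a⟩ := q
  obtain ⟨y', a'⟩ := q'
  simp only at hx htt ht ⊢
  set d := x' - x with hd
  set G := (8 : ℝ) • (x - y) with hG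
  set G' := (8 : ℝ) • (x' - y') with hG'
  have hxy : x - y = (1 / 8 : ℝ) • G := by rw [hG, smul_smul]; norm_num
  have hxy' : x' - y' = (1 / 8 : ℝ) • G' := by rw [hG', smul_smul]; norm_num
  have hn0 : (0 : ℝ) ≤ n := Nat.cast_nonneg n
  have hN0 : (0 : ℝ) < 1 / (N + 1 : ℝ) := by positivity
  have hd2 : ‖d‖ ^ 2 ≤ (n * r) ^ 2 := by gcongr
  -- expansions of the two paraboloids around the contact points
  have P1 : ∀ z : SpN n, ∀ s, a + 4 * ‖x + z - y‖ ^ 2 - s =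
      w (x, t) + inner ℝ G z + 4 * ‖z‖ ^ 2 + (t - s) := by
    intro z s
    have e := h.eq
    simp only at e
    rw [e, show x + z - y = (x - y) + z by abel, norm_add_sq_real, hG, real_inner_smul_left]
    ring
  have P2 : ∀ z : SpN n, ∀ s, a' + 4 * ‖x' + z - y'‖ ^ 2 - s =
      w (x', t') + inner ℝ G' z + 4 * ‖z‖ ^ 2 + (t' - s) := by
    intro z s
    have e := h'.eq
    simp only at e
    rw [e, show x' + z - y' = (x' - y') + z by abel, norm_add_sq_real, hG', real_inner_smul_left]
    ring
  have up : w (x', t') - w (x, t) ≤ inner ℝ G d + 4 * ‖d‖ ^ 2 + K * r ^ 2 := by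
    have e1 := h'.time (t' - t) ⟨by linarith, by linarith⟩
    have e2 := h.le x' (by
      have := h'.norm_add_le
      simp only at this
      linarith) t ⟨h.time_mem.1, le_rfl⟩
    simp only [sub_sub_cancel] at e1 e2
    have e3 := P1 d t
    rw [hd, add_sub_cancel, ← hd] at e3
    have e4 : K * (t' - t) ≤ K * r ^ 2 := by gcongr
    linarith
  have low : ∀ z : SpN n, ‖d + z‖ < 1 / (N + 1 : ℝ) →
      w (x, t) + inner ℝ G (d + z) - K * ‖d + z‖ ^ 2 ≤
        w (x', t') + inner ℝ G' z + 4 * ‖z‖ ^ 2 + r ^ 2 := by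
    intro z hz
    have e1 := h.lower (d + z) hz
    have e2 := h'.le (x + (d + z)) (by
      have := h.norm_add_le
      simp only at this
      linarith [_root_.norm_add_le x (d + z)]) t ⟨h.time_mem.1, htt⟩
    have e3 := P2 z t
    have e4 : x + (d + z) = x' + z := by rw [hd]; abel
    simp only at e1 e2
    rw [e4] at e1 e2
    linarith
  have he : ‖G - G'‖ ≤ C * r := by
    rcases eq_or_ne (G - G') 0 with h0 | h0
    · rw [h0, norm_zero]
      have : 0 ≤ C := le_trans (by positivity) hC
      positivity
    have h0' : 0 < ‖G - G'‖ := norm_pos_iff.2 h0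
    set v := (r / ‖G - G'‖) • (G - G') with hv
    have hvn : ‖v‖ = r := by
      rw [hv, norm_smul, norm_div, norm_norm, Real.norm_eq_abs, abs_of_pos hr]
      field_simp
    have hiv : inner ℝ (G - G') v = r * ‖G - G'‖ := by
      rw [hv, real_inner_smul_right, real_inner_self_eq_norm_sq]
      field_simp
    have hdv : ‖d + v‖ ≤ (n + 1) * r := by
      have := _root_.norm_add_le d v
      linarith
    have e := low v (by linarith)
    have e2 : K * ‖d + v‖ ^ 2 ≤ K * ((n + 1) * r) ^ 2 := by gcongr
    rw [inner_add_right, hvn] at e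
    rw [inner_sub_left] at hiv
    have e3 : r * ‖G - G'‖ ≤ r * ((K * (n + 1) ^ 2 + 4 * n ^ 2 + K + 5) * r) := by nlinarith
    have e4 := le_of_mul_le_mul_left e3 hr
    have e5 : (K * (n + 1) ^ 2 + 4 * n ^ 2 + K + 5) * r ≤ C * r := by gcongr
    linarith
  refine ⟨he, ?_⟩
  have hC0 : 0 ≤ C := le_trans (by positivity) hC
  have E : a' - a - inner ℝ G (y' - y) =
      (w (x', t') - w (x, t)) - inner ℝ G d - ‖G - G'‖ ^ 2 / 16 + (t' - t) := by
    have e1 := h.eq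
    have e2 := h'.eq
    simp only at e1 e2
    have e3 : y' - y = d + (1 / 8 : ℝ) • (G - G') := by
      rw [smul_sub, ← hxy, ← hxy', hd]; abel
    have f1 : ‖G‖ = 8 * ‖x - y‖ := by rw [hG, norm_smul]; norm_num
    have f2 : ‖G'‖ = 8 * ‖x' - y'‖ := by rw [hG', norm_smul]; norm_num
    have f3 := norm_sub_sq_real G G'
    have f4 : inner ℝ G (G - G') = ‖G‖ ^ 2 - inner ℝ G G' := by
      rw [inner_sub_right, real_inner_self_eq_norm_sq]
    rw [f1, f2] at f3
    rw [e3, inner_add_right, real_inner_smul_right, e1, e2, f3, f4, f1]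
    ring
  have low0 := low (-d) (by simpa using hN0)
  rw [add_neg_cancel] at low0
  simp only [inner_zero_right, norm_zero, inner_neg_right, norm_neg] at low0
  have hin : |inner ℝ (G - G') d| ≤ (C * r) * (n * r) :=
    (abs_real_inner_le_norm _ _).trans (by gcongr)
  rw [inner_sub_left] at hin
  have hin' := abs_le.1 hin
  have he2 : ‖G - G'‖ ^ 2 ≤ (C * r) ^ 2 := by gcongr
  have he0 := sq_nonneg ‖G - G'‖
  have hC' : (K * (n + 1) ^ 2 + 4 * n ^ 2 + K + 5) * r ^ 2 ≤ C * r ^ 2 := by gcongr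
  have hK1 : 0 ≤ K * (n + 1) ^ 2 * r ^ 2 := by positivity
  have hK2 : 0 ≤ K * r ^ 2 := by positivity
  have hK3 : 0 ≤ C * n * r ^ 2 := by positivity
  have hK4 : 0 ≤ C ^ 2 * r ^ 2 := by positivity
  rw [E, abs_le]
  constructor <;> nlinarith

end contact

section contact
variable {n : ℕ}

lemma ContactAt.exists_compare (n : ℕ) {K : ℝ} (hK : 0 ≤ K) :
    ∃ C : ℝ, 0 ≤ C ∧ ∀ (w : SpN n × ℝ → ℝ) (N : ℕ) (q p q' p' : SpN n × ℝ) (r : ℝ),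
      ContactAt w K N q p → ContactAt w K N q' p' → 0 < r → (n + 1) * r < 1 / (N + 1 : ℝ) →
      r ^ 2 < 1 / (N + 1 : ℝ) → ‖p'.1 - p.1‖ ≤ n * r → |p'.2 - p.2| ≤ r ^ 2 →
      ‖q'.1 - q.1‖ ≤ C * r ∧
        |q'.2 - q.2 - inner ℝ ((8 : ℝ) • (p.1 - q.1)) (q'.1 - q.1)| ≤ C * r ^ 2 := by
  set C := K * (n + 1) ^ 2 + 4 * n ^ 2 + K + 5 with hC
  have hC0 : 0 ≤ C := by positivity
  refine ⟨(C + C * n + C ^ 2) + C * (n + C) + (n + C), by positivity, ?_⟩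
  intro w N q p q' p' r h h' hr hrN hr2 hx ht
  have main : ‖(8 : ℝ) • (p.1 - q.1) - (8 : ℝ) • (p'.1 - q'.1)‖ ≤ C * r →
      ‖q'.1 - q.1‖ ≤ (n + C) * r := by
    intro he
    have e : q'.1 - q.1 = (p'.1 - p.1) +
        (1 / 8 : ℝ) • ((8 : ℝ) • (p.1 - q.1) - (8 : ℝ) • (p'.1 - q'.1)) := by
      rw [smul_sub, smul_smul, smul_smul]; norm_num; abel
    rw [e]
    refine (_root_.norm_add_le _ _).trans ?_
    rw [norm_smul]
    norm_num
    have := norm_nonneg ((8 : ℝ) • (p.1 - q.1) - (8 : ℝ) • (p'.1 - q'.1))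
    linarith
  have hle : (n + C) * r ≤ ((C + C * n + C ^ 2) + C * (n + C) + (n + C)) * r := by
    have : 0 ≤ (C + C * n + C ^ 2) + C * (n + C) := by positivity
    exact mul_le_mul_of_nonneg_right (by linarith) hr.le
  have h1 : 0 ≤ C * (n + C) * r ^ 2 := by positivity
  have h2 : 0 ≤ (n + C) * r ^ 2 := by positivity
  rw [abs_le] at ht
  rcases le_total p.2 p'.2 with hpp | hpp
  · obtain ⟨e1, e2⟩ := h.compare_of_le hK h' hr hrN hx hpp ht.2 hr2 hC.ge
    refine ⟨(main e1).trans hle, e2.trans ?_⟩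
    linarith
  · rw [norm_sub_rev] at hx
    obtain ⟨e1, e2⟩ := h'.compare_of_le hK h hr hrN hx hpp (by linarith) hr2 hC.ge
    rw [norm_sub_rev] at e1
    have e3 := main e1
    refine ⟨e3.trans hle, ?_⟩
    have e4 : |inner ℝ ((8 : ℝ) • (p.1 - q.1) - (8 : ℝ) • (p'.1 - q'.1)) (q'.1 - q.1)| ≤
        (C * r) * ((n + C) * r) := (abs_real_inner_le_norm _ _).trans (by gcongr)
    rw [inner_sub_left] at e4
    rw [← neg_sub q'.1 q.1, inner_neg_right] at e2
    rw [abs_le] at e2 e4 ⊢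
    constructor <;> nlinarith

lemma volume_shearedBox_le (y G : SpN n) (a ρ σ : ℝ) :
    volume {q : SpN n × ℝ | ‖q.1 - y‖ ≤ ρ ∧ |q.2 - a - inner ℝ G (q.1 - y)| ≤ σ} ≤
      ENNReal.ofReal (2 * σ) * volume (Metric.closedBall y ρ) := by
  have hm : MeasurableSet {q : SpN n × ℝ | ‖q.1 - y‖ ≤ ρ ∧ |q.2 - a - inner ℝ G (q.1 - y)| ≤ σ} := by
    refine (IsClosed.inter (isClosed_le (f := fun q : SpN n × ℝ => ‖q.1 - y‖) ?_ continuous_const)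
      (isClosed_le (f := fun q : SpN n × ℝ => |q.2 - a - inner ℝ G (q.1 - y)|) ?_
        continuous_const)).measurableSet <;> fun_prop
  rw [Measure.volume_eq_prod, Measure.prod_apply hm,
    ← lintegral_indicator_const Metric.isClosed_closedBall.measurableSet]
  refine lintegral_mono fun x => ?_
  by_cases hx : x ∈ Metric.closedBall y ρ
  · rw [indicator_of_mem hx]
    refine (measure_mono (t := Icc (a + inner ℝ G (x - y) - σ) (a + inner ℝ G (x - y) + σ))
      fun s hs => ?_).trans ?_
    · have := abs_le.1 (show |s - a - inner ℝ G (x - y)| ≤ σ from hs.2)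
      constructor <;> linarith
    · rw [Real.volume_Icc]
      gcongr
      linarith
  · have : Prod.mk x ⁻¹' {q : SpN n × ℝ | ‖q.1 - y‖ ≤ ρ ∧ |q.2 - a - inner ℝ G (q.1 - y)| ≤ σ} =
        ∅ := by
      refine eq_empty_of_forall_notMem fun s hs => hx ?_
      rw [mem_closedBall_iff_norm]
      exact hs.1
    rw [this]
    simp

/-- A subsolution which is not very negative at a point is not very negative on a set of positive
measure. -/
lemma exists_measure_const (n : ℕ) {lam Lam : ℝ} (hl : 0 < lam) (hL : 0 ≤ Lam) :
    ∃ θ : ℝ, 0 < θ ∧ ∀ A : SpN n → Matrix (Fin n) (Fin n) ℝ, (∀ x, EllMat lam Lam (A x)) →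
      ∀ w : SpN n × ℝ → ℝ, RSub A w (Metric.closedBall 0 1 ×ˢ Icc 0 1) →
        (∀ p ∈ Metric.closedBall 0 1 ×ˢ Icc 0 1, w p ≤ 0) → -(1 / 2) < w (0, 1) →
        ENNReal.ofReal θ ≤ volume {p ∈ Metric.ball 0 1 ×ˢ Ioc 0 1 | -1 < w p} := by
  set K := (8 * (n * Lam) + 1) / lam + 8 * (n * Lam) + 1 with hK
  have hK0 : 0 ≤ K := by positivity
  obtain ⟨C, hC0, hC⟩ := ContactAt.exists_compare n hK0
  set v := volume (Metric.closedBall (0 : SpN n) C) with hv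
  have hvtop : v ≠ ⊤ := (isCompact_closedBall _ _).measure_ne_top
  set M : ENNReal := ENNReal.ofReal (2 * C) * v + 1 with hM
  have hMtop : M ≠ ⊤ := by
    rw [hM]
    exact ENNReal.add_ne_top.2 ⟨ENNReal.mul_ne_top ENNReal.ofReal_ne_top hvtop, ENNReal.one_ne_top⟩
  have hM0 : M ≠ 0 := by simp [hM]
  set Y : Set (SpN n × ℝ) := Metric.ball 0 (1 / 4) ×ˢ Ioo 0 (1 / 4) with hY
  have hYo : IsOpen Y := Metric.isOpen_ball.prod isOpen_Ioo
  have hYpos : 0 < volume Y := hYo.measure_pos volume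
    ⟨(0, 1 / 8), by simp, by norm_num, by norm_num⟩
  have hYtop : volume Y ≠ ⊤ := by
    rw [hY, Measure.volume_eq_prod, Measure.prod_prod]
    exact ENNReal.mul_ne_top measure_ball_lt_top.ne (by simp)
  refine ⟨(volume Y / M).toReal, ENNReal.toReal_pos (ENNReal.div_pos hYpos.ne' hMtop).ne'
    (ENNReal.div_ne_top hYtop hM0), ?_⟩
  intro A hA w hw hw0 h
  rw [ENNReal.ofReal_toReal (ENNReal.div_ne_top hYtop hM0)]
  have hex : ∀ q : SpN n × ℝ, ∃ p, q ∈ Y → ∃ N, ContactAt w K N q p := fun q => by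
    by_cases hq : q ∈ Y
    · obtain ⟨p, hp⟩ := exists_contact hl hL hA hw hw0 h hq
      exact ⟨p, fun _ => hp⟩
    · exact ⟨0, fun h => absurd h hq⟩
  choose Ψ hΨ using hex
  set YN : ℕ → Set (SpN n × ℝ) := fun N => {q ∈ Y | ContactAt w K N q (Ψ q)} with hYN
  have hmono : Monotone YN := by
    refine fun N N' hNN q hq => ⟨hq.1, ?_⟩
    have hle : 1 / (N' + 1 : ℝ) ≤ 1 / (N + 1 : ℝ) := by gcongr
    obtain ⟨a1, a2, a3, a4, a5, a6⟩ := hq.2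
    exact ⟨by linarith, a2, a3, a4, fun z hz => a5 z (hz.trans_le hle),
      fun s hs => a6 s ⟨hs.1, hs.2.trans_le hle⟩⟩
  have hYun : Y = ⋃ N, YN N := by
    refine Subset.antisymm (fun q hq => ?_) (iUnion_subset fun N q hq => hq.1)
    obtain ⟨N, hN⟩ := hΨ q hq
    exact mem_iUnion.2 ⟨N, hq, hN⟩
  have himg : Ψ '' Y ⊆ {p ∈ Metric.ball 0 1 ×ˢ Ioc 0 1 | -1 < w p} := by
    rintro _ ⟨q, hq, rfl⟩
    obtain ⟨N, hN⟩ := hΨ q hq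
    have e1 := hN.norm_add_le
    have e2 : (0 : ℝ) < 1 / (N + 1 : ℝ) := by positivity
    refine ⟨⟨mem_ball_zero_iff.2 (by linarith), hN.time_mem⟩, ?_⟩
    rw [hN.eq]
    have := hN.time_mem.2
    have := hq.2.1
    nlinarith [sq_nonneg ‖(Ψ q).1 - q.1‖]
  have hbox : ∀ N, volume (YN N) ≤ M * volume (Ψ '' YN N) := by
    intro N
    have t1 : Tendsto (fun k : ℕ => ((n : ℝ) + 1) * (1 / 2) ^ k) atTop (𝓝 ((n + 1) * 0)) :=
      (tendsto_pow_atTop_nhds_zero_of_lt_one (by norm_num) (by norm_num)).const_mul _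
    have t2 : Tendsto (fun k : ℕ => (1 / 4 : ℝ) ^ k) atTop (𝓝 0) :=
      tendsto_pow_atTop_nhds_zero_of_lt_one (by norm_num) (by norm_num)
    rw [mul_zero] at t1
    have hN0 : (0 : ℝ) < 1 / (N + 1 : ℝ) := by positivity
    obtain ⟨k₀, hk₀⟩ := eventually_atTop.1 ((t1.eventually (gt_mem_nhds hN0)).and
      (t2.eventually (gt_mem_nhds hN0)))
    refine measure_le_of_gridBox Ψ hMtop (N := k₀) fun k hk I hne => ?_
    obtain ⟨q, hq, hqI⟩ := hne
    obtain ⟨hk1, hk2⟩ := hk₀ k hk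
    set r : ℝ := 1 / 2 ^ k with hr
    have hr0 : 0 < r := by positivity
    have hrr : (1 / 4 : ℝ) ^ k = r ^ 2 := by
      rw [hr, ← one_div_pow, ← pow_mul, mul_comm, pow_mul]; norm_num
    rw [hrr] at hk2
    rw [one_div_pow] at hk1
    have hsub : YN N ∩ Ψ ⁻¹' gridBox k I ⊆ {q' : SpN n × ℝ | ‖q'.1 - q.1‖ ≤ C * r ∧
        |q'.2 - q.2 - inner ℝ ((8 : ℝ) • ((Ψ q).1 - q.1)) (q'.1 - q.1)| ≤ C * r ^ 2} := by
      rintro q' ⟨hq', hqI'⟩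
      have hidx : gridIdx k (Ψ q') = gridIdx k (Ψ q) := Eq.trans hqI' (Eq.symm hqI)
      have e2 := (abs_sub_lt_of_gridIdx_eq hidx).2
      rw [← one_div_pow, hrr] at e2
      exact hC w N q (Ψ q) q' (Ψ q') r hq.2 hq'.2 hr0 hk1 hk2
        (norm_sub_le_of_gridIdx_eq hidx) e2.le
    refine (measure_mono hsub).trans ((volume_shearedBox_le _ _ _ _ _).trans ?_)
    rw [volume_gridBox, ← hr, mul_comm C r, Measure.addHaar_closedBall_mul volume _ hr0.le hC0,
      finrank_euclideanSpace_fin, ← hv, ← mul_assoc 2,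
      ENNReal.ofReal_mul (p := 2 * C) (by positivity), pow_add,
      ENNReal.ofReal_mul (p := r ^ n) (by positivity), hM]
    calc ENNReal.ofReal (2 * C) * ENNReal.ofReal (r ^ 2) * (ENNReal.ofReal (r ^ n) * v)
        = ENNReal.ofReal (2 * C) * v * (ENNReal.ofReal (r ^ n) * ENNReal.ofReal (r ^ 2)) := by ring
      _ ≤ _ := by gcongr; exact le_self_add
  have hlim : volume Y ≤ M * volume {p ∈ Metric.ball 0 1 ×ˢ Ioc 0 1 | -1 < w p} := by
    calc volume Y = ⨆ N, volume (YN N) := by rw [hYun, hmono.measure_iUnion]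
      _ ≤ _ := iSup_le fun N => (hbox N).trans (by
          gcongr
          exact (image_mono fun q hq => hq.1).trans himg)
  exact ENNReal.div_le_of_le_mul' hlim

end contact

section densebox
variable {n : ℕ}

lemma volume_parScale_image (c : SpN n × ℝ) {r : ℝ} (hr : 0 ≤ r) (S : Set (SpN n × ℝ)) :
    volume (parScale c r '' S) = ENNReal.ofReal (r ^ (n + 2)) * volume S := by
  set f : SpN n × ℝ →ₗ[ℝ] SpN n × ℝ :=
    LinearMap.prodMap (r • LinearMap.id) ((r ^ 2) • LinearMap.id) with hf
  have e : parScale c r '' S = (c + ·) '' (f '' S) := by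
    rw [image_image]
    rfl
  have hd : LinearMap.det f = r ^ (n + 2) := by
    rw [hf, LinearMap.det_prodMap, LinearMap.det_smul, LinearMap.det_smul]
    simp [pow_add]
  have : Measure.IsAddHaarMeasure (volume : Measure (SpN n × ℝ)) :=
    inferInstanceAs (Measure.IsAddHaarMeasure ((volume : Measure (SpN n)).prod volume))
  rw [e, image_add_left, measure_preimage_add, Measure.addHaar_image_linearMap, hd,
    abs_of_nonneg (by positivity)]

lemma exists_measure_const_scaled (n : ℕ) {lam Lam : ℝ} (hl : 0 < lam) (hL : 0 ≤ Lam) :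
    ∃ θ : ℝ, 0 < θ ∧ ∀ (A : SpN n → Matrix (Fin n) (Fin n) ℝ), (∀ x, EllMat lam Lam (A x)) →
      ∀ (w : SpN n × ℝ → ℝ) (c : SpN n × ℝ) (r : ℝ), 0 < r →
        RSub A w (Metric.closedBall c.1 r ×ˢ Icc c.2 (c.2 + r ^ 2)) →
        (∀ p ∈ Metric.closedBall c.1 r ×ˢ Icc c.2 (c.2 + r ^ 2), w p ≤ 0) →
        -(1 / 2) < w (c.1, c.2 + r ^ 2) →
        ENNReal.ofReal (θ * r ^ (n + 2)) ≤
          volume {p ∈ Metric.ball c.1 r ×ˢ Ioc c.2 (c.2 + r ^ 2) | -1 < w p} := by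
  obtain ⟨θ, hθ, h⟩ := exists_measure_const n hl hL
  refine ⟨θ, hθ, fun A hA w c r hr hw hw0 hc => ?_⟩
  have hmap : ∀ p ∈ Metric.closedBall (0 : SpN n) 1 ×ˢ Icc (0 : ℝ) 1,
      parScale c r p ∈ Metric.closedBall c.1 r ×ˢ Icc c.2 (c.2 + r ^ 2) := by
    rintro ⟨x, t⟩ ⟨hx, ht⟩
    simp only [mem_closedBall_zero_iff, mem_Icc] at hx ht
    refine ⟨?_, ?_, ?_⟩
    · simp only [parScale, Metric.mem_closedBall, dist_self_add_left, norm_smul, Real.norm_eq_abs,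
        abs_of_pos hr]
      nlinarith
    · simp only [parScale]; nlinarith [mul_nonneg (sq_nonneg r) ht.1]
    · simp only [parScale]; nlinarith [sq_nonneg r]
  have key := h _ (fun x => hA _) (fun q => w (parScale c r q))
    ((hw.comp_parScale c r).mono hmap) (fun p hp => hw0 _ (hmap p hp))
    (by simpa [parScale] using hc)
  rw [mul_comm, ENNReal.ofReal_mul (by positivity)]
  refine (mul_le_mul_right key _).trans ?_
  rw [← volume_parScale_image c hr.le]
  refine measure_mono ?_
  rintro _ ⟨⟨x, t⟩, ⟨⟨hx, ht⟩, hxt⟩, rfl⟩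
  simp only [mem_ball_zero_iff, mem_Ioc] at hx ht
  refine ⟨⟨?_, ?_, ?_⟩, hxt⟩
  · simp only [parScale, Metric.mem_ball, dist_self_add_left, norm_smul, Real.norm_eq_abs,
      abs_of_pos hr]
    nlinarith
  · simp only [parScale]; nlinarith [mul_pos (sq_pos_of_pos hr) ht.1]
  · simp only [parScale]; nlinarith [sq_nonneg r]

lemma RSub.measurableSet_le {A : SpN n → Matrix (Fin n) (Fin n) ℝ} {w : SpN n × ℝ → ℝ}
    {D : Set (SpN n)} {J : Set ℝ} (hD : IsOpen D) (hJ : IsOpen J) (h : RSub A w (D ×ˢ J))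
    (a : ℝ) : MeasurableSet {p ∈ D ×ˢ J | w p ≤ a} := by
  have h1 : Measurable (Function.uncurry fun (t : J) (x : D) => w (x, t)) := by
    refine (stronglyMeasurable_uncurry_of_continuous_of_stronglyMeasurable
      (fun x => ?_) (fun t => ?_)).measurable
    · refine continuous_iff_continuousAt.2 fun t => ?_
      exact ContinuousAt.comp (f := ((↑) : J → ℝ)) (g := fun s => w (x, s))
        (h (x, t) ⟨x.2, t.2⟩).1.continuousAt_time continuous_subtype_val.continuousAt
    · refine (continuous_iff_continuousAt.2 fun x => ?_).stronglyMeasurable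
      exact ContinuousAt.comp (f := ((↑) : D → SpN n)) (g := fun y => w (y, t))
        (h (x, t) ⟨x.2, t.2⟩).1.continuousAt_space continuous_subtype_val.continuousAt
  have h2 : MeasurableSet {q : D × J | w (q.1, q.2) ≤ a} :=
    (h1.comp measurable_swap) measurableSet_Iic
  have h3 := ((MeasurableEmbedding.subtype_coe hD.measurableSet).prodMap
    (MeasurableEmbedding.subtype_coe hJ.measurableSet)).measurableSet_image' h2
  convert h3 using 1
  ext ⟨x, t⟩
  constructor
  · rintro ⟨⟨hx, ht⟩, hw⟩
    exact ⟨(⟨x, hx⟩, ⟨t, ht⟩), hw, rfl⟩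
  · rintro ⟨⟨y, s⟩, hw, he⟩
    simp only [Prod.map_apply, Prod.mk.injEq] at he
    obtain ⟨rfl, rfl⟩ := he
    exact ⟨⟨y.2, s.2⟩, hw⟩

/-- The centre of the spatial cube of level `k` with index `m`. -/
def gridCenter (k : ℕ) (m : Fin n → ℤ) : SpN n :=
  WithLp.toLp 2 fun i => (m i : ℝ) / 2 ^ k + 1 / 2 ^ k / 2

lemma exists_dense_box_const (n : ℕ) {lam Lam : ℝ} (hl : 0 < lam) (hL : 0 ≤ Lam) :
    ∃ θ : ℝ, 0 < θ ∧ θ < 1 ∧ ∀ (A : SpN n → Matrix (Fin n) (Fin n) ℝ),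
      (∀ x, EllMat lam Lam (A x)) → ∀ (w : SpN n × ℝ → ℝ) (D : Set (SpN n)) (J : Set ℝ),
      IsOpen D → IsOpen J → RSub A w (D ×ˢ J) → (∀ p ∈ D ×ˢ J, w p ≤ 0) →
      ∀ (k : ℕ) (I : (Fin n → ℤ) × ℤ), gridBox k I ⊆ D ×ˢ J →
        ENNReal.ofReal (1 - θ) * volume (gridBox (n := n) k I) <
          volume (gridBox k I ∩ {p | w p ≤ -1}) →
        ∀ x ∈ Metric.ball (gridCenter k I.1) (1 / 2 ^ k / 4),
          w (x, (I.2 : ℝ) / 4 ^ k + 1 / 4 ^ k / 2) ≤ -(1 / 2) := by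
  obtain ⟨θ₀, hθ₀, h⟩ := exists_measure_const_scaled n hl hL
  set θ := min (θ₀ * (1 / 4) ^ (n + 2)) (1 / 2) with hθ
  have hθ0 : 0 < θ := by positivity
  have hθ1 : θ < 1 := (min_le_right _ _).trans_lt (by norm_num)
  refine ⟨θ, hθ0, hθ1, fun A hA w D J hD hJ hw hw0 k I hI hdense x hx => ?_⟩
  by_contra! hcon
  set ℓ : ℝ := 1 / 2 ^ k with hℓ
  have hℓ0 : 0 < ℓ := by positivity
  have hℓ2 : (1 : ℝ) / 4 ^ k = ℓ ^ 2 := by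
    rw [hℓ, one_div_pow, ← pow_mul, mul_comm, pow_mul]; norm_num
  rw [hℓ2] at hcon
  set b : ℝ := (I.2 : ℝ) / 4 ^ k with hb
  have hsub : Metric.closedBall x (ℓ / 4) ×ˢ Icc (b + ℓ ^ 2 / 2 - (ℓ / 4) ^ 2)
      (b + ℓ ^ 2 / 2 - (ℓ / 4) ^ 2 + (ℓ / 4) ^ 2) ⊆ gridBox k I := by
    rintro ⟨y, s⟩ ⟨hy, hs⟩
    refine Prod.ext (gridX_eq_iff.2 fun i => ?_) (gridT_eq_iff.2 ?_)
    · have h1 : dist y (gridCenter k I.1) < ℓ / 2 := by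
        have := dist_triangle y x (gridCenter k I.1)
        rw [Metric.mem_closedBall] at hy
        rw [Metric.mem_ball] at hx
        linarith
      have h2 : |(y - gridCenter k I.1) i| < ℓ / 2 :=
        (PiLp.norm_apply_le (y - gridCenter k I.1) i).trans_lt (by rwa [← dist_eq_norm])
      rw [PiLp.sub_apply, abs_lt] at h2
      simp only [gridCenter, ← hℓ] at h2
      rw [← hℓ]
      constructor <;> linarith
    · rw [hℓ2]
      simp only [mem_Icc] at hs
      constructor <;> nlinarith [sq_pos_of_pos hℓ0]
  have key := h A hA w (x, b + ℓ ^ 2 / 2 - (ℓ / 4) ^ 2) (ℓ / 4) (by positivity)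
    (hw.mono (hsub.trans hI)) (fun p hp => hw0 p (hI (hsub hp)))
    (by simpa using hcon)
  have hS : MeasurableSet (gridBox k I ∩ {p | w p ≤ -1}) := by
    have : gridBox k I ∩ {p | w p ≤ -1} = gridBox k I ∩ {p ∈ D ×ˢ J | w p ≤ -1} := by
      ext p
      exact ⟨fun hp => ⟨hp.1, hI hp.1, hp.2⟩, fun hp => ⟨hp.1, hp.2.2⟩⟩
    rw [this]
    exact (measurableSet_gridBox k I).inter (hw.measurableSet_le hD hJ _)
  have hle : {p ∈ Metric.ball x (ℓ / 4) ×ˢ Ioc (b + ℓ ^ 2 / 2 - (ℓ / 4) ^ 2)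
      (b + ℓ ^ 2 / 2 - (ℓ / 4) ^ 2 + (ℓ / 4) ^ 2) | -1 < w p} ⊆
      gridBox k I \ (gridBox k I ∩ {p | w p ≤ -1}) := by
    rintro p ⟨hp, hp'⟩
    exact ⟨hsub ⟨Metric.ball_subset_closedBall hp.1, Ioc_subset_Icc_self hp.2⟩,
      fun h => absurd h.2 (not_le.2 hp')⟩
  have h3 := key.trans (measure_mono hle)
  rw [measure_sdiff inter_subset_left hS.nullMeasurableSet
    ((measure_mono inter_subset_left).trans_lt (by rw [volume_gridBox]; simp)).ne] at h3
  have h4 : ENNReal.ofReal θ * volume (gridBox (n := n) k I) ≤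
      volume (gridBox k I) - volume (gridBox k I ∩ {p | w p ≤ -1}) := by
    refine le_trans ?_ h3
    rw [volume_gridBox, ← ENNReal.ofReal_mul hθ0.le]
    refine ENNReal.ofReal_le_ofReal ?_
    rw [← hℓ, div_eq_mul_one_div ℓ, mul_pow, mul_comm (ℓ ^ (n + 2)), ← mul_assoc]
    gcongr
    exact min_le_left _ _
  refine absurd hdense (not_lt.2 ?_)
  have hfin : volume (gridBox (n := n) k I) ≠ ⊤ := by rw [volume_gridBox]; simp
  have hsum : volume (gridBox (n := n) k I) =
      ENNReal.ofReal (1 - θ) * volume (gridBox (n := n) k I) +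
        ENNReal.ofReal θ * volume (gridBox (n := n) k I) := by
    rw [← add_mul, ← ENNReal.ofReal_add (by linarith) hθ0.le]
    simp
  have h5 : volume (gridBox k I ∩ {p | w p ≤ -1}) + ENNReal.ofReal θ * volume (gridBox (n := n) k I)
      ≤ volume (gridBox (n := n) k I) := by
    refine (add_le_add_right h4 _).trans ?_
    rw [add_tsub_cancel_of_le (measure_mono inter_subset_left)]
  nth_rewrite 2 [hsum] at h5
  exact ENNReal.le_of_add_le_add_right (ENNReal.mul_ne_top (by simp) hfin) h5

end densebox

section parent
variable {n : ℕ}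

/-- The open cube `(-2, 2)ⁿ`. -/
def cubeTwo (n : ℕ) : Set (SpN n) := {x | ∀ i, |x i| < 2}

lemma isOpen_cubeTwo : IsOpen (cubeTwo n) := by
  have : cubeTwo n = ⋂ i, {x : SpN n | |x i| < 2} := by ext; simp [cubeTwo]
  rw [this]
  exact isOpen_iInter_of_finite fun i => isOpen_lt (by fun_prop) continuous_const

lemma abs_sub_gridCenter_le (k : ℕ) (x : SpN n) (i : Fin n) :
    |x i - gridCenter k (gridX k x) i| ≤ 1 / 2 ^ k / 2 := by
  have h := gridX_eq_iff.1 (rfl : gridX k x = _) i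
  simp only [gridCenter]
  rw [abs_le]
  constructor <;> linarith [h.1, h.2]

lemma exists_spread_parent (hn : 1 ≤ n) {lam Lam : ℝ} (hl : 0 < lam) (m : ℝ) :
    ∃ c : ℝ, 0 < c ∧ c ≤ 1 ∧ ∀ (A : SpN n → Matrix (Fin n) (Fin n) ℝ),
      (∀ x, EllMat lam Lam (A x)) → ∀ (w : SpN n × ℝ → ℝ),
      RSub A w (cubeTwo n ×ˢ Ioo (-4) 0) → (∀ p ∈ cubeTwo n ×ˢ Ioo (-4 : ℝ) 0, w p ≤ 0) →
      ∀ (k : ℕ) (z : SpN n × ℝ), (8 * n + 1) * (1 / 2 ^ (k + 1) : ℝ) ≤ 1 → (∀ i, |z.1 i| ≤ 1) →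
        z.2 ∈ Icc (-2) (-1) →
        (∀ x ∈ Metric.ball (gridCenter (k + 1) (gridX (k + 1) z.1)) (1 / 2 ^ (k + 1) / 4),
          w (x, (gridT (k + 1) z.2 : ℝ) / 4 ^ (k + 1) + 1 / 4 ^ (k + 1) / 2) ≤ -(1 / 2)) →
        ∀ x t, gridX k x = gridX k z.1 → t < 0 →
          t ∈ Ioo ((gridT k z.2 : ℝ) / 4 ^ k + 2 * (1 / 4 ^ k))
            ((gridT k z.2 : ℝ) / 4 ^ k + (m + 2) * (1 / 4 ^ k)) → w (x, t) ≤ -c := by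
  have hn1 : (1 : ℝ) ≤ n := by exact_mod_cast hn
  obtain ⟨c, hc, h⟩ := exists_spread_const n (Lam := Lam) hl (R := 16 * n) (Δ₁ := 1)
    (Δ₂ := 64 * (m + 2) + 8) (by linarith) one_pos
  refine ⟨min (c * (1 / 2)) 1, by positivity, min_le_right _ _, ?_⟩
  intro A hA w hw hw0 k z hk hz hzt hhalf x t hx ht0 ht
  set ℓ : ℝ := 1 / 2 ^ (k + 1) with hℓ
  have hℓ0 : 0 < ℓ := by positivity
  have hℓ2 : (1 : ℝ) / 4 ^ (k + 1) = ℓ ^ 2 := by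
    rw [hℓ, one_div_pow, ← pow_mul, mul_comm, pow_mul]; norm_num
  have hℓ3 : (1 : ℝ) / 4 ^ k = 4 * ℓ ^ 2 := by
    rw [← hℓ2, pow_succ]; field_simp
  have hℓ4 : (1 : ℝ) / 2 ^ k = 2 * ℓ := by
    rw [hℓ, pow_succ]; field_simp
  have hb := gridT_eq_iff.1 (rfl : gridT (k + 1) z.2 = _)
  have ha := gridT_eq_iff.1 (rfl : gridT k z.2 = _)
  set b : ℝ := (gridT (k + 1) z.2 : ℝ) / 4 ^ (k + 1) with hbdef
  set a : ℝ := (gridT k z.2 : ℝ) / 4 ^ k with hadef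
  rw [hℓ2] at hb hhalf
  rw [hℓ3] at ha ht
  set y := gridCenter (k + 1) (gridX (k + 1) z.1) with hy
  have hyz : ∀ i, |z.1 i - y i| ≤ ℓ / 2 := fun i => abs_sub_gridCenter_le (k + 1) z.1 i
  have hℓs : ℓ ≤ 1 / 9 := by nlinarith
  have hℓs2 : ℓ ^ 2 ≤ 1 / 81 := by nlinarith
  set Δ := (t - (b + ℓ ^ 2 / 2)) / (ℓ / 4) ^ 2 with hΔ
  have hρ : 0 < (ℓ / 4) ^ 2 := by positivity
  have hΔt : b + ℓ ^ 2 / 2 + (ℓ / 4) ^ 2 * Δ = t := by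
    rw [hΔ, mul_div_cancel₀ _ hρ.ne']; ring
  have hΔm : Δ ∈ Icc 1 (64 * (m + 2) + 8) := by
    rw [hΔ, mem_Icc, le_div_iff₀ hρ, div_le_iff₀ hρ]
    constructor <;> nlinarith [ht.1, ht.2, hb.1, hb.2, ha.1, ha.2]
  have hsub : Metric.closedBall y (2 * (16 * n) * (ℓ / 4)) ×ˢ Icc (b + ℓ ^ 2 / 2) t ⊆
      cubeTwo n ×ˢ Ioo (-4) 0 := by
    rintro ⟨v, s⟩ ⟨hv, hs⟩
    refine ⟨fun i => ?_, ?_, hs.2.trans_lt ht0⟩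
    · have h1 := PiLp.norm_apply_le (v - y) i
      rw [← dist_eq_norm, Real.norm_eq_abs, PiLp.sub_apply] at h1
      rw [Metric.mem_closedBall] at hv
      have h2 := abs_le.1 (h1.trans hv)
      have h3 := abs_le.1 (hyz i)
      have h4 := abs_le.1 (hz i)
      rw [abs_lt]
      constructor <;> nlinarith
    · linarith [hs.1, hb.2, hzt.1]
  rw [← hΔt] at hsub
  have hfin := h A hA w y (b + ℓ ^ 2 / 2) (ℓ / 4) Δ (1 / 2) (by positivity) (by norm_num) hΔm
    (hw.mono hsub) (fun p hp => hw0 p (hsub hp)) hhalf x ?_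
  · rw [hΔt] at hfin
    exact hfin.trans (neg_le_neg (min_le_left _ _))
  · rw [Metric.mem_closedBall, dist_eq_norm]
    refine (norm_le_of_coord_le (a := 5 / 2 * ℓ) fun i => ?_).trans (by nlinarith)
    have h1 := gridX_eq_iff.1 hx i
    have h2 := gridX_eq_iff.1 (rfl : gridX k z.1 = _) i
    rw [hℓ4] at h1 h2
    have h3 := abs_le.1 (hyz i)
    rw [PiLp.sub_apply, abs_le]
    constructor <;> linarith [h1.1, h1.2, h2.1, h2.2]

end parent

section covering
variable {n : ℕ}

/-- The box of level `k` containing `z` is dense for `E`: the density of `E` there exceeds `C`. -/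
def DenseBox (E : Set (SpN n × ℝ)) (C : ENNReal) (k : ℕ) (I : (Fin n → ℤ) × ℤ) : Prop :=
  C * volume (gridBox (n := n) k I) < volume (gridBox k I ∩ E)

/-- The level-`k` box of `z` is not dense but has a dense child. -/
def StopBox (E : Set (SpN n × ℝ)) (C : ENNReal) (k : ℕ) (z : SpN n × ℝ) : Prop :=
  ¬DenseBox E C k (gridIdx k z) ∧
    ∃ z', gridIdx k z' = gridIdx k z ∧ DenseBox E C (k + 1) (gridIdx (k + 1) z')

lemma StopBox.congr {E : Set (SpN n × ℝ)} {C : ENNReal} {k : ℕ} {z z' : SpN n × ℝ}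
    (h : StopBox E C k z) (hz : gridIdx k z = gridIdx k z') : StopBox E C k z' := by
  rwa [StopBox, ← hz]

lemma measure_le_of_stopBox {E : Set (SpN n × ℝ)} (hE : volume E ≠ ⊤) {C : ENNReal} (hC : C < 1)
    {k₀ : ℕ} (h₀ : ∀ I, ¬DenseBox E C k₀ I) :
    volume E ≤ C * volume {z | ∃ k ≥ k₀, StopBox E C k z} := by
  set U : Set (SpN n × ℝ) := {z | ∃ k ≥ k₀, StopBox E C k z} with hU
  have hCt : C ≠ ⊤ := hC.ne_top
  have hnull : volume (E \ U) = 0 := by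
    have h1 : ∀ z ∈ E \ U, ∀ k ≥ k₀, ¬DenseBox E C k (gridIdx k z) := by
      intro z hz k hk
      induction k, hk using Nat.le_induction with
      | base => exact h₀ _
      | succ k hk ih => exact fun hd => hz.2 ⟨k, hk, ih, z, rfl, hd⟩
    have h2 : volume (E \ U) ≤ C * volume (id '' (E \ U)) := by
      refine measure_le_of_gridBox id hCt (N := k₀) fun k hk I hne => ?_
      obtain ⟨z, hz, hzI⟩ := hne
      have h3 := h1 z hz k hk
      rw [show gridIdx k z = I from hzI, DenseBox, not_lt] at h3
      refine (measure_mono ?_).trans h3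
      exact fun p hp => ⟨hp.2, hp.1.1⟩
    rw [image_id] at h2
    by_contra h0
    have h4 : volume (E \ U) ≠ ⊤ := ((measure_mono sdiff_subset).trans_lt hE.lt_top).ne
    have h5 : C * volume (E \ U) < 1 * volume (E \ U) :=
      (ENNReal.mul_lt_mul_iff_left h0 h4).2 hC
    rw [one_mul] at h5
    exact absurd h2 (not_le.2 h5)
  set S : ℕ → Set (SpN n × ℝ) := fun k =>
    {z | (k₀ ≤ k ∧ StopBox E C k z) ∧ ∀ j < k, ¬(k₀ ≤ j ∧ StopBox E C j z)} with hS
  have hUS : U = ⋃ k, S k := by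
    ext z
    refine ⟨fun ⟨k, hk, hz⟩ => ?_, fun hz => ?_⟩
    · have hex : ∃ k, k₀ ≤ k ∧ StopBox E C k z := ⟨k, hk, hz⟩
      exact mem_iUnion.2 ⟨Nat.find hex, Nat.find_spec hex, fun j hj => Nat.find_min hex hj⟩
    · obtain ⟨k, hk⟩ := mem_iUnion.1 hz
      exact ⟨k, hk.1.1, hk.1.2⟩
  have hdisj : Pairwise (Function.onFun Disjoint S) := by
    intro i j hij
    refine Set.disjoint_left.2 fun z hi hj => ?_
    rcases lt_or_gt_of_ne hij with h | h
    · exact hj.2 i h hi.1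
    · exact hi.2 j h hj.1
  have hSg : ∀ k, S k = {z | gridIdx k z ∈ gridIdx k '' S k} := by
    intro k
    refine Subset.antisymm (fun z hz => ⟨z, hz, rfl⟩) ?_
    rintro z ⟨z', hz', he⟩
    refine ⟨⟨hz'.1.1, hz'.1.2.congr he⟩, fun j hj hjz => hz'.2 j hj ⟨hjz.1, ?_⟩⟩
    exact hjz.2.congr (gridIdx_eq_of_le hj.le he).symm
  have hSm : ∀ k, MeasurableSet (S k) := fun k => by
    rw [hSg]
    exact measurableSet_setOf_gridIdx_mem k _
  have hSle : ∀ k, volume (E ∩ S k) ≤ C * volume (S k) := by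
    intro k
    have h1 := measure_gridIdx_preimage_le (μ := volume) id (Y := E) (C := C) (k := k)
      (J := gridIdx k '' S k) (by
        rintro _ ⟨z, hz, rfl⟩
        rw [preimage_id, inter_comm]
        exact not_lt.1 hz.1.2.1)
    rw [← hSg, preimage_id] at h1
    exact h1
  calc volume E ≤ volume (E ∩ U) + volume (E \ U) :=
        measure_le_inter_add_sdiff _ _ _
    _ = volume (⋃ k, E ∩ S k) := by rw [hnull, add_zero, hUS, inter_iUnion]
    _ ≤ ∑' k, volume (E ∩ S k) := measure_iUnion_le _
    _ ≤ ∑' k, C * volume (S k) := ENNReal.tsum_le_tsum hSle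
    _ = C * volume U := by rw [ENNReal.tsum_mul_left, hUS, measure_iUnion hdisj hSm]

end covering

section stack

lemma volume_stack_inter_Ici_le {ι : Type*} (a L : ι → ℝ) (hL : ∀ i, 0 < L i) {m : ℝ}
    (hm : 0 < m) (F : Finset ι) (σ : ℝ) :
    volume ((⋃ i ∈ F, Ico (a i) (a i + L i)) ∩ Ici σ) ≤ ENNReal.ofReal (1 + 2 / m) *
      volume ((⋃ i ∈ F, Ioo (a i + 2 * L i) (a i + (m + 2) * L i)) ∩ Ici σ) := by
  induction F using Finset.strongInduction generalizing σ with
  | H F ih =>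
  by_cases hne : (F.filter fun i => σ < a i + L i).Nonempty
  · obtain ⟨j, hj, hjmin⟩ := Finset.exists_min_image _ a hne
    rw [Finset.mem_filter] at hj
    set d := a j + (m + 2) * L j with hd
    have hdσ : σ < d := by nlinarith [hL j]
    have h1 : (⋃ i ∈ F, Ico (a i) (a i + L i)) ∩ Ici σ ⊆
        Ico (a j) d ∪ ((⋃ i ∈ F.erase j, Ico (a i) (a i + L i)) ∩ Ici d) := by
      rintro s ⟨hs, hsσ⟩
      simp only [mem_iUnion, exists_prop] at hs
      obtain ⟨i, hi, his⟩ := hs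
      have hji : a j ≤ a i := hjmin i (Finset.mem_filter.2 ⟨hi, lt_of_le_of_lt hsσ his.2⟩)
      rcases lt_or_ge s d with h | h
      · exact Or.inl ⟨hji.trans his.1, h⟩
      · refine Or.inr ⟨mem_biUnion (Finset.mem_coe.2 (Finset.mem_erase.2 ⟨?_, hi⟩)) his, h⟩
        rintro rfl
        nlinarith [his.2, hL i]
    have h2 : Ioo (a j + 2 * L j) d ∪
        ((⋃ i ∈ F.erase j, Ioo (a i + 2 * L i) (a i + (m + 2) * L i)) ∩ Ici d) ⊆
        (⋃ i ∈ F, Ioo (a i + 2 * L i) (a i + (m + 2) * L i)) ∩ Ici σ := by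
      rintro s (hs | ⟨hs, hsd⟩)
      · refine ⟨mem_biUnion hj.1 hs, ?_⟩
        have := hs.1
        have := hL j
        simp only [mem_Ici]
        linarith
      · exact ⟨biUnion_subset_biUnion_left (Finset.erase_subset j F) hs, hdσ.le.trans hsd⟩
    have hdisj : Disjoint (Ioo (a j + 2 * L j) d)
        ((⋃ i ∈ F.erase j, Ioo (a i + 2 * L i) (a i + (m + 2) * L i)) ∩ Ici d) :=
      Set.disjoint_left.2 fun s hs hs' => absurd hs.2 (not_lt.2 hs'.2)
    calc _ ≤ volume (Ico (a j) d) +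
          volume ((⋃ i ∈ F.erase j, Ico (a i) (a i + L i)) ∩ Ici d) :=
          (measure_mono h1).trans (measure_union_le _ _)
      _ ≤ ENNReal.ofReal (1 + 2 / m) * volume (Ioo (a j + 2 * L j) d) +
          ENNReal.ofReal (1 + 2 / m) *
          volume ((⋃ i ∈ F.erase j, Ioo (a i + 2 * L i) (a i + (m + 2) * L i)) ∩ Ici d) := by
          gcongr
          · rw [Real.volume_Ico, Real.volume_Ioo, ← ENNReal.ofReal_mul (by positivity)]
            refine ENNReal.ofReal_le_ofReal (le_of_eq ?_)
            rw [hd]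
            field_simp
            ring
          · exact ih _ (Finset.erase_ssubset hj.1) d
      _ ≤ _ := by
          rw [← mul_add, ← measure_union' hdisj measurableSet_Ioo]
          gcongr
  · have : (⋃ i ∈ F, Ico (a i) (a i + L i)) ∩ Ici σ = ∅ := by
      refine eq_empty_of_forall_notMem fun s hs => ?_
      obtain ⟨hs, hsσ⟩ := hs
      simp only [mem_iUnion, exists_prop] at hs
      obtain ⟨i, hi, his⟩ := hs
      exact hne ⟨i, Finset.mem_filter.2 ⟨hi, lt_of_le_of_lt hsσ his.2⟩⟩
    rw [this, measure_empty]
    exact zero_le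

/-- Stacking lemma: intervals are controlled in measure by later, longer copies of themselves. -/
lemma volume_stack_le {ι : Type*} [Countable ι] (a L : ι → ℝ) (hL : ∀ i, 0 < L i) {m : ℝ}
    (hm : 0 < m) :
    volume (⋃ i, Ico (a i) (a i + L i)) ≤ ENNReal.ofReal (1 + 2 / m) *
      volume (⋃ i, Ioo (a i + 2 * L i) (a i + (m + 2) * L i)) := by
  have hdir : Directed (· ⊆ ·) fun F : Finset ι => ⋃ i ∈ F, Ico (a i) (a i + L i) :=
    Monotone.directed_le fun F F' h => biUnion_subset_biUnion_left h
  rw [iUnion_eq_iUnion_finset, hdir.measure_iUnion]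
  refine iSup_le fun F => ?_
  obtain ⟨σ, hσ⟩ := (F.image a).bddBelow
  have h1 : ⋃ i ∈ F, Ico (a i) (a i + L i) = (⋃ i ∈ F, Ico (a i) (a i + L i)) ∩ Ici σ := by
    refine (inter_eq_left.2 (iUnion₂_subset fun i hi s hs => ?_)).symm
    exact (hσ (Finset.mem_coe.2 (Finset.mem_image_of_mem a hi))).trans hs.1
  rw [h1]
  refine (volume_stack_inter_Ici_le a L hL hm F σ).trans ?_
  gcongr
  exact inter_subset_left.trans (iUnion₂_subset fun i _ => subset_iUnion_of_subset i subset_rfl)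

variable {n : ℕ}

/-- The points lying above a stopping box, at a moderate height. -/
def stopStack (E : Set (SpN n × ℝ)) (C : ENNReal) (k₀ : ℕ) (m : ℝ) : Set (SpN n × ℝ) :=
  {z | ∃ k ≥ k₀, ∃ s, StopBox E C k (z.1, s) ∧
    z.2 ∈ Ioo ((gridT k s : ℝ) / 4 ^ k + 2 * (1 / 4 ^ k))
      ((gridT k s : ℝ) / 4 ^ k + (m + 2) * (1 / 4 ^ k))}

lemma volume_setOf_stopBox_le (E : Set (SpN n × ℝ)) (C : ENNReal) (k₀ : ℕ) {m : ℝ} (hm : 0 < m) :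
    volume {z | ∃ k ≥ k₀, StopBox E C k z} ≤
      ENNReal.ofReal (1 + 2 / m) * volume (stopStack E C k₀ m) := by
  have hcongr : ∀ k x x' s s', gridX k x = gridX k x' → gridT k s = gridT k s' →
      StopBox E C k (x, s) → StopBox E C k (x', s') := fun k x x' s s' h1 h2 h =>
    h.congr (Prod.ext h1 h2)
  set J : ℕ → ℤ → Set (SpN n) := fun k j =>
    {x | k₀ ≤ k ∧ ∃ s, gridT k s = j ∧ StopBox E C k (x, s)} with hJ
  have hJm : ∀ k j, MeasurableSet (J k j) := by
    intro k j
    have : J k j = ⋃ m ∈ gridX k '' J k j, {x | gridX k x = m} := by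
      ext x
      simp only [mem_iUnion, mem_image, exists_prop]
      refine ⟨fun hx => ⟨_, ⟨x, hx, rfl⟩, rfl⟩, ?_⟩
      rintro ⟨m, ⟨x', ⟨hk, s, hs, hx'⟩, rfl⟩, hx⟩
      exact ⟨hk, s, hs, hcongr k _ _ _ _ (Eq.symm hx) rfl hx'⟩
    rw [this]
    exact MeasurableSet.biUnion (to_countable _) fun m _ => measurableSet_gridX k m
  have hU : {z | ∃ k ≥ k₀, StopBox E C k z} = ⋃ (k) (j),
      J k j ×ˢ Ico ((j : ℝ) / 4 ^ k) ((j : ℝ) / 4 ^ k + 1 / 4 ^ k) := by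
    ext ⟨x, t⟩
    simp only [mem_ofPred_eq, mem_iUnion]
    constructor
    · rintro ⟨k, hk, h⟩
      exact ⟨k, gridT k t, ⟨hk, t, rfl, h⟩, gridT_eq_iff.1 rfl⟩
    · rintro ⟨k, j, ⟨hk, s, hs, h⟩, ht⟩
      exact ⟨k, hk, hcongr k _ _ _ _ rfl (hs.trans (gridT_eq_iff.2 ht).symm) h⟩
  have hV : stopStack E C k₀ m = ⋃ (k) (j),
      J k j ×ˢ Ioo ((j : ℝ) / 4 ^ k + 2 * (1 / 4 ^ k)) ((j : ℝ) / 4 ^ k + (m + 2) * (1 / 4 ^ k)) := by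
    ext ⟨x, t⟩
    simp only [stopStack, mem_ofPred_eq, mem_iUnion]
    constructor
    · rintro ⟨k, hk, s, h, ht⟩
      exact ⟨k, gridT k s, ⟨hk, s, rfl, h⟩, ht⟩
    · rintro ⟨k, _, ⟨hk, s, rfl, h⟩, ht⟩
      exact ⟨k, hk, s, h, ht⟩
  have hUm : MeasurableSet {z | ∃ k ≥ k₀, StopBox E C k z} := by
    rw [hU]
    exact MeasurableSet.iUnion fun k => MeasurableSet.iUnion fun j => (hJm k j).prod measurableSet_Ico
  have hVm : MeasurableSet (stopStack E C k₀ m) := by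
    rw [hV]
    exact MeasurableSet.iUnion fun k => MeasurableSet.iUnion fun j => (hJm k j).prod measurableSet_Ioo
  rw [Measure.volume_eq_prod, Measure.prod_apply hUm, Measure.prod_apply hVm,
    ← lintegral_const_mul' _ _ ENNReal.ofReal_ne_top]
  refine lintegral_mono fun x => ?_
  have key := volume_stack_le (ι := {i : ℕ × ℤ // x ∈ J i.1 i.2})
    (fun i => (i.1.2 : ℝ) / 4 ^ i.1.1) (fun i => 1 / 4 ^ i.1.1) (fun i => by positivity) hm
  convert key using 3
  · ext t
    simp only [hU, mem_preimage, mem_iUnion, mem_prod, Subtype.exists, Prod.exists, exists_prop]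
  · ext t
    simp only [hV, mem_preimage, mem_iUnion, mem_prod, Subtype.exists, Prod.exists, exists_prop]

end stack

section chain
variable {n : ℕ}

lemma abs_convexCombo_le {s a b K : ℝ} (hs : 0 ≤ s) (hs1 : s ≤ 1) (ha : |a| ≤ K) (hb : |b| ≤ K) :
    |(1 - s) * a + s * b| ≤ K := by
  rw [abs_le] at *
  constructor <;> nlinarith

lemma exists_chain_const (n : ℕ) {lam Lam : ℝ} (hl : 0 < lam) {η : ℝ} (hη : 0 < η) {k : ℕ}
    (hk : (1 : ℝ) / 2 ^ k ≤ 1 / 2) (hkη : (1 : ℝ) / 4 ^ k ≤ η) :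
    ∃ c : ℝ, 0 < c ∧ ∀ (A : SpN n → Matrix (Fin n) (Fin n) ℝ),
      (∀ x, EllMat lam Lam (A x)) → ∀ (w : SpN n × ℝ → ℝ),
      RSub A w (cubeTwo n ×ˢ Ioo (-4) 0) → (∀ p ∈ cubeTwo n ×ˢ Ioo (-4 : ℝ) 0, w p ≤ 0) →
      ∀ z : SpN n × ℝ, (∀ i, |z.1 i| ≤ 1) → -2 ≤ z.2 → z.2 ≤ -1 - η →
        (∀ x ∈ Metric.ball (gridCenter k (gridX k z.1)) (1 / 2 ^ k / 4),
          w (x, (gridT k z.2 : ℝ) / 4 ^ k + 1 / 4 ^ k / 2) ≤ -(1 / 2)) →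
        ∀ x t, (∀ i, |x i| ≤ 1) → t ∈ Ioo (-1) 0 → w (x, t) ≤ -c := by
  set ℓ : ℝ := 1 / 2 ^ k with hℓ
  have hℓ0 : 0 < ℓ := by positivity
  have hℓ2 : (1 : ℝ) / 4 ^ k = ℓ ^ 2 := by
    rw [hℓ, one_div_pow, ← pow_mul, mul_comm, pow_mul]; norm_num
  rw [hℓ2] at hkη ⊢
  obtain ⟨M, hM⟩ := exists_nat_ge (4 * n / (ℓ / 4) + 1)
  have hM1 : (1 : ℝ) ≤ M := le_trans (by linarith [show 0 ≤ 4 * n / (ℓ / 4) by positivity]) hM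
  have hMn : 4 * n ≤ M * (ℓ / 4) := by
    rw [← div_le_iff₀ (by positivity)]
    linarith
  obtain ⟨c, hc, h⟩ := exists_spread_const n (Lam := Lam) hl (R := 2)
    (Δ₁ := η / 2 / (M * (ℓ / 4) ^ 2)) (Δ₂ := 3 / (M * (ℓ / 4) ^ 2)) (by norm_num) (by positivity)
  refine ⟨c ^ M * (1 / 2), by positivity, ?_⟩
  intro A hA w hw hw0 z hz hz2 hzη hhalf x t hx ht
  have hb := gridT_eq_iff.1 (rfl : gridT k z.2 = _)
  rw [hℓ2] at hb
  set y := gridCenter k (gridX k z.1) with hy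
  have hyz : ∀ i, |z.1 i - y i| ≤ ℓ / 2 := fun i => abs_sub_gridCenter_le k z.1 i
  have hℓ4 : ℓ ^ 2 ≤ 1 / 4 := by nlinarith
  set t₀ := (gridT k z.2 : ℝ) / 4 ^ k + ℓ ^ 2 / 2 with ht₀
  have ht1 : η / 2 ≤ t - t₀ := by linarith [ht.1, hb.1]
  have ht2 : t - t₀ ≤ 3 := by linarith [ht.2, hb.2]
  set Δ := (t - t₀) / (M * (ℓ / 4) ^ 2) with hΔ
  have hΔt : M * ((ℓ / 4) ^ 2 * Δ) = t - t₀ := by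
    rw [hΔ]; field_simp
  have hΔm : Δ ∈ Icc (η / 2 / (M * (ℓ / 4) ^ 2)) (3 / (M * (ℓ / 4) ^ 2)) := by
    constructor <;> · rw [hΔ]; gcongr
  have hΔ0 : 0 ≤ (ℓ / 4) ^ 2 * Δ := by
    have : 0 ≤ Δ := le_trans (by positivity) hΔm.1
    positivity
  have hyx : ‖x - y‖ ≤ 4 * n := by
    rw [mul_comm]
    refine norm_le_of_coord_le fun i => ?_
    have h1 := abs_le.1 (hyz i)
    have h2 := abs_le.1 (hz i)
    have h3 := abs_le.1 (hx i)
    rw [PiLp.sub_apply, abs_le]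
    constructor <;> linarith
  set X : ℕ → SpN n := fun i => y + ((i : ℝ) / M) • (x - y) with hX
  have hstep : ∀ i, dist (X (i + 1)) (X i) ≤ ℓ / 4 := by
    intro i
    have : X (i + 1) - X i = (1 / M : ℝ) • (x - y) := by
      simp only [hX, Nat.cast_add, Nat.cast_one, add_div, add_smul]
      abel
    rw [dist_eq_norm, this, norm_smul, Real.norm_eq_abs, abs_of_nonneg (by positivity),
      one_div_mul_eq_div, div_le_iff₀ (by positivity)]
    linarith
  have key : ∀ i ≤ M, ∀ v ∈ Metric.ball (X i) (ℓ / 4),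
      w (v, t₀ + i * ((ℓ / 4) ^ 2 * Δ)) ≤ -(c ^ i * (1 / 2)) := by
    intro i
    induction i with
    | zero =>
      intro _ v hv
      have := hhalf v (by simpa [hX] using hv)
      simpa using this
    | succ i ih =>
      intro hi v hv
      have hiM : ((i : ℝ) + 1) ≤ M := by exact_mod_cast hi
      have e : t₀ + i * ((ℓ / 4) ^ 2 * Δ) + (ℓ / 4) ^ 2 * Δ =
          t₀ + (i + 1 : ℕ) * ((ℓ / 4) ^ 2 * Δ) := by push_cast; ring
      have hsub : Metric.closedBall (X i) (2 * 2 * (ℓ / 4)) ×ˢ Icc (t₀ + i * ((ℓ / 4) ^ 2 * Δ))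
          (t₀ + i * ((ℓ / 4) ^ 2 * Δ) + (ℓ / 4) ^ 2 * Δ) ⊆ cubeTwo n ×ˢ Ioo (-4) 0 := by
        rintro ⟨v, s⟩ ⟨hv, hs⟩
        have h0 : 0 ≤ i * ((ℓ / 4) ^ 2 * Δ) := by positivity
        refine ⟨fun j => ?_, ?_, ?_⟩
        · have h1 := PiLp.norm_apply_le (v - X i) j
          rw [← dist_eq_norm, Real.norm_eq_abs, PiLp.sub_apply] at h1
          rw [Metric.mem_closedBall] at hv
          have h2 := abs_le.1 (h1.trans hv)
          have h3 := abs_le.1 (hyz j)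
          have h4 := abs_le.1 (hz j)
          have h5 := abs_le.1 (hx j)
          have h6 : X i j = (1 - i / M) * y j + i / M * x j := by
            simp only [hX, PiLp.add_apply, PiLp.smul_apply, PiLp.sub_apply, smul_eq_mul]
            ring
          have h7 : (i : ℝ) / M ≤ 1 := (div_le_one (by linarith)).2 (by linarith)
          have h8 : (0 : ℝ) ≤ i / M := by positivity
          have h9 : |X i j| ≤ 1 + ℓ / 2 := by
            rw [h6]
            exact abs_convexCombo_le h8 h7 (abs_le.2 ⟨by linarith, by linarith⟩)
              (abs_le.2 ⟨by linarith, by linarith⟩)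
          rw [abs_le] at h9
          rw [abs_lt]
          constructor <;> linarith
        · linarith [hs.1, hb.2]
        · have h10 : ((i : ℝ) + 1) * ((ℓ / 4) ^ 2 * Δ) ≤ M * ((ℓ / 4) ^ 2 * Δ) := by gcongr
          linarith [hs.2, ht.2]
      have h1 := h A hA w (X i) _ (ℓ / 4) Δ (c ^ i * (1 / 2)) (by positivity) (by positivity) hΔm
        (hw.mono hsub) (fun p hp => hw0 p (hsub hp)) (ih (by omega)) v (by
          have := hstep i
          rw [Metric.mem_ball] at hv
          rw [Metric.mem_closedBall]
          linarith [dist_triangle v (X (i + 1)) (X i)])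
      rw [e] at h1
      refine h1.trans (le_of_eq ?_)
      ring
  have hfin := key M le_rfl x (by
    have : X M = x := by
      simp only [hX]
      rw [div_self (by linarith), one_smul]
      abel
    rw [this]
    exact Metric.mem_ball_self (by positivity))
  rwa [hΔt, add_sub_cancel] at hfin

end chain

section iteration
variable {n : ℕ}

/-- The half-open cube `[-1, 1)ⁿ`. -/
def cubeOne (n : ℕ) : Set (SpN n) := {x | ∀ i, x i ∈ Ico (-1) 1}

lemma volume_cubeOne : volume (cubeOne n) = ENNReal.ofReal (2 ^ n) := by
  have e : cubeOne n = WithLp.ofLp ⁻¹' (Set.pi univ fun _ : Fin n => Ico (-1 : ℝ) 1) := by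
    ext x
    simp [cubeOne]
  rw [e, (PiLp.volume_preserving_ofLp (Fin n)).measure_preimage
    (MeasurableSet.univ_pi fun i => measurableSet_Ico).nullMeasurableSet, volume_pi_pi]
  simp only [Real.volume_Ico, Finset.prod_const, Finset.card_univ, Fintype.card_fin]
  rw [← ENNReal.ofReal_pow (by norm_num)]
  norm_num

lemma volume_cubeOne_prod_le {J : Set ℝ} {a : ℝ} (hJ : volume J ≤ ENNReal.ofReal a) :
    volume (cubeOne n ×ˢ J) ≤ ENNReal.ofReal (2 ^ n * a) := by
  rw [Measure.volume_eq_prod, Measure.prod_prod, volume_cubeOne,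
    ENNReal.ofReal_mul (by positivity)]
  gcongr

lemma mem_cubeOne_of_gridX_eq {k : ℕ} {x z : SpN n} (h : gridX k x = gridX k z)
    (hz : z ∈ cubeOne n) : x ∈ cubeOne n := by
  have h0 : gridIdx 0 (x, (0 : ℝ)) = gridIdx 0 (z, 0) :=
    gridIdx_eq_of_le (Nat.zero_le k) (Prod.ext h rfl)
  intro i
  have h1 : ⌊2 ^ 0 * x i⌋ = ⌊2 ^ 0 * z i⌋ := congrFun (congrArg Prod.fst h0) i
  rw [pow_zero, one_mul, one_mul] at h1
  have h2 : (-1 : ℤ) ≤ ⌊z i⌋ := Int.le_floor.2 (by simpa using (hz i).1)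
  have h3 : ⌊z i⌋ < 1 := Int.floor_lt.2 (by simpa using (hz i).2)
  rw [← h1] at h2 h3
  exact ⟨by simpa using Int.le_floor.1 h2, by simpa using Int.floor_lt.1 h3⟩

lemma abs_le_one_of_mem_cubeOne {x : SpN n} (hx : x ∈ cubeOne n) (i : Fin n) : |x i| ≤ 1 :=
  abs_le.2 ⟨(hx i).1, (hx i).2.le⟩

/-- The part of `[-1, 1)ⁿ × [-2, T)` where `w ≤ -1`. -/
def lowSet (w : SpN n × ℝ → ℝ) (T : ℝ) : Set (SpN n × ℝ) :=
  {p ∈ cubeOne n ×ˢ Ico (-2) T | w p ≤ -1}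

lemma volume_lowSet_le (w : SpN n × ℝ → ℝ) {T : ℝ} (hT : T ≤ -1) :
    volume (lowSet w T) ≤ ENNReal.ofReal (2 ^ n) := by
  refine (measure_mono fun p hp => ?_).trans
    ((volume_cubeOne_prod_le (n := n) (J := Ico (-2) (-1)) (a := 1) ?_).trans (by rw [mul_one]))
  · exact ⟨hp.1.1, hp.1.2.1, hp.1.2.2.trans_le hT⟩
  · rw [Real.volume_Ico]
    norm_num

lemma gridBox_subset_cubeTwo {k : ℕ} (hk : (1 : ℝ) / 2 ^ k ≤ 1 / 2) {z : SpN n × ℝ}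
    (hz : ∀ i, |z.1 i| ≤ 1) (hz2 : z.2 ∈ Icc (-2) (-1)) :
    gridBox k (gridIdx k z) ⊆ cubeTwo n ×ˢ Ioo (-4) 0 := by
  intro p hp
  obtain ⟨h1, h2⟩ := abs_sub_lt_of_gridIdx_eq (show gridIdx k p = gridIdx k z from hp)
  have h4 : (1 : ℝ) / 4 ^ k ≤ 1 / 4 := by
    have : (1 : ℝ) / 4 ^ k = (1 / 2 ^ k) ^ 2 := by
      rw [one_div_pow, ← pow_mul, mul_comm k, pow_mul]; norm_num
    rw [this]
    have h0 : (0 : ℝ) < 1 / 2 ^ k := by positivity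
    nlinarith
  rw [abs_lt] at h2
  refine ⟨fun i => ?_, ?_, ?_⟩
  · have h5 := abs_lt.1 (h1 i)
    have h6 := abs_le.1 (hz i)
    rw [abs_lt]
    constructor <;> linarith
  · linarith [hz2.1]
  · linarith [hz2.2]

lemma DenseBox.exists_mem {E : Set (SpN n × ℝ)} {C : ENNReal} {k : ℕ} {I : (Fin n → ℤ) × ℤ}
    (h : DenseBox E C k I) : ∃ z ∈ E, gridIdx k z = I := by
  have h0 : volume (gridBox k I ∩ E) ≠ 0 := (zero_le.trans_lt h).ne'
  obtain ⟨z, hz, hzE⟩ := nonempty_of_measure_ne_zero h0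
  exact ⟨z, hzE, hz⟩

lemma exists_iteration_const (hn : 1 ≤ n) {lam Lam : ℝ} (hl : 0 < lam) (hL : 0 ≤ Lam) :
    ∃ q > 0, q < 1 ∧ ∃ m > 0, ∀ η > 0, ∀ k₀ : ℕ, (8 * n + 1) * (1 / 2 ^ k₀ : ℝ) ≤ 1 →
      (1 : ℝ) / 4 ^ k₀ ≤ η → ∀ j : ℕ, ∃ c > 0, ∀ (A : SpN n → Matrix (Fin n) (Fin n) ℝ),
      (∀ x, EllMat lam Lam (A x)) → ∀ (w : SpN n × ℝ → ℝ),
      RSub A w (cubeTwo n ×ˢ Ioo (-4) 0) → (∀ p ∈ cubeTwo n ×ˢ Ioo (-4 : ℝ) 0, w p ≤ 0) →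
      ∀ T, T + j * (m * (1 / 4 ^ k₀)) ≤ -1 - η →
        ENNReal.ofReal (q ^ j * 2 ^ (n + 1)) ≤ volume (lowSet w T) →
        ∀ x t, (∀ i, |x i| ≤ 1) → t ∈ Ioo (-1 : ℝ) 0 → w (x, t) ≤ -c := by
  have hn1 : (1 : ℝ) ≤ n := by exact_mod_cast hn
  obtain ⟨θ, hθ0, hθ1, hdense⟩ := exists_dense_box_const n hl hL
  set m := 4 / θ with hm
  have hm0 : 0 < m := by positivity
  obtain ⟨c₁, hc₁, -, hpar⟩ := exists_spread_parent hn (Lam := Lam) hl m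
  refine ⟨1 - θ / 2, by linarith, by linarith, m + 3, by linarith, fun η hη k₀ hk₀ hkη j => ?_⟩
  have hsmall : ∀ k ≥ k₀, (8 * n + 1) * (1 / 2 ^ k : ℝ) ≤ 1 := by
    intro k hk
    refine le_trans ?_ hk₀
    gcongr
    norm_num
  have hhalf : ∀ k ≥ k₀, (1 / 2 ^ k : ℝ) ≤ 1 / 2 := by
    intro k hk
    have h0 : (0 : ℝ) < 1 / 2 ^ k := by positivity
    nlinarith [hsmall k hk]
  obtain ⟨c₂, hc₂, hchain⟩ := exists_chain_const n (Lam := Lam) hl hη (hhalf k₀ le_rfl) hkη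
  induction j with
  | zero =>
    refine ⟨1, one_pos, fun A hA w hw hw0 T hT hvol => absurd (volume_lowSet_le w (T := T) ?_) ?_⟩
    · simp only [Nat.cast_zero, zero_mul, add_zero] at hT
      linarith
    · rw [not_le]
      refine lt_of_lt_of_le ?_ hvol
      rw [ENNReal.ofReal_lt_ofReal_iff (by positivity)]
      have : (0 : ℝ) < 2 ^ n := by positivity
      rw [pow_succ]
      linarith
  | succ j ih =>
    obtain ⟨c, hc, ih⟩ := ih
    refine ⟨min c₂ (c₁ * c), by positivity, fun A hA w hw hw0 T hT hvol x t hx ht => ?_⟩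
    have hτ0 : (0 : ℝ) < (m + 3) * (1 / 4 ^ k₀) := by positivity
    have hTη : T ≤ -1 - η := by
      have : 0 ≤ ((j + 1 : ℕ) : ℝ) * ((m + 3) * (1 / 4 ^ k₀)) := by positivity
      linarith
    set E := lowSet w T with hE
    set C := ENNReal.ofReal (1 - θ) with hC
    have hEz : ∀ z ∈ E, (∀ i, |z.1 i| ≤ 1) ∧ -2 ≤ z.2 ∧ z.2 < T := fun z hz =>
      ⟨abs_le_one_of_mem_cubeOne hz.1.1, hz.1.2⟩
    have hboxhalf : ∀ k ≥ k₀, ∀ z ∈ E, DenseBox E C k (gridIdx k z) →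
        ∀ x ∈ Metric.ball (gridCenter k (gridX k z.1)) (1 / 2 ^ k / 4),
          w (x, (gridT k z.2 : ℝ) / 4 ^ k + 1 / 4 ^ k / 2) ≤ -(1 / 2) := by
      intro k hk z hz hd
      obtain ⟨hz1, hz2, hz3⟩ := hEz z hz
      refine hdense A hA w _ _ isOpen_cubeTwo isOpen_Ioo hw hw0 k (gridIdx k z)
        (gridBox_subset_cubeTwo (hhalf k hk) hz1 ⟨hz2, by linarith⟩) ?_
      exact hd.trans_le (measure_mono fun p hp => ⟨hp.1, hp.2.2⟩)
    by_cases hex : ∃ I, DenseBox E C k₀ I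
    · obtain ⟨I, hI⟩ := hex
      obtain ⟨z, hz, rfl⟩ := hI.exists_mem
      obtain ⟨hz1, hz2, hz3⟩ := hEz z hz
      exact (hchain A hA w hw hw0 z hz1 hz2 (by linarith) (hboxhalf k₀ le_rfl z hz hI) x t hx
        ht).trans (neg_le_neg (min_le_left _ _))
    · push Not at hex
      have hw' : RSub A (fun p => c₁⁻¹ * w p) (cubeTwo n ×ˢ Ioo (-4) 0) :=
        hw.const_mul (inv_pos.2 hc₁)
      have hfin : volume E ≠ ⊤ :=
        ((volume_lowSet_le w (by linarith)).trans_lt ENNReal.ofReal_lt_top).ne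
      have h1 := measure_le_of_stopBox hfin (C := C)
        (by rw [hC, ENNReal.ofReal_lt_one]; linarith) hex
      have h2 := volume_setOf_stopBox_le E C k₀ hm0
      have h3 : stopStack E C k₀ m ⊆
          lowSet (fun p => c₁⁻¹ * w p) (T + (m + 3) * (1 / 4 ^ k₀)) := by
        rintro ⟨x, t⟩ ⟨k, hk, s, ⟨-, z', hz', hd⟩, hts⟩
        obtain ⟨z, hz, hzz'⟩ := hd.exists_mem
        have hzx : gridIdx k z = gridIdx k (x, s) :=
          (gridIdx_eq_of_le (Nat.le_succ k) hzz').trans hz'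
        have hX : gridX k x = gridX k z.1 := (congrArg Prod.fst hzx).symm
        have hT' : gridT k s = gridT k z.2 := (congrArg Prod.snd hzx).symm
        obtain ⟨hz1, hz2, hz3⟩ := hEz z hz
        rw [← hzz'] at hd
        simp only [hT'] at hts
        have h4 := gridT_eq_iff.1 (rfl : gridT k z.2 = _)
        have h5 : (1 : ℝ) / 4 ^ k ≤ 1 / 4 ^ k₀ := by
          gcongr
          norm_num
        have h50 : (0 : ℝ) < 1 / 4 ^ k := by positivity
        have h6 : (m + 2) * (1 / 4 ^ k : ℝ) < (m + 3) * (1 / 4 ^ k₀) := by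
          linarith [mul_le_mul_of_nonneg_left h5 (by linarith : 0 ≤ m + 2)]
        have h7 : T + (m + 3) * (1 / 4 ^ k₀) ≤ -1 - η := by
          have : 0 ≤ (j : ℝ) * ((m + 3) * (1 / 4 ^ k₀)) := by positivity
          push_cast at hT
          linarith
        have h8 : t < T + (m + 3) * (1 / 4 ^ k₀) := by linarith [hts.2, h4.1]
        have h9 := hpar A hA w hw hw0 k z (hsmall (k + 1) (by omega)) hz1 ⟨hz2, by linarith⟩
          (hboxhalf (k + 1) (by omega) z hz hd) x t hX (by linarith) hts
        refine ⟨⟨mem_cubeOne_of_gridX_eq hX hz.1.1, by linarith [hts.1, h4.2], h8⟩, ?_⟩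
        simp only
        rw [inv_mul_le_iff₀ hc₁]
        linarith
      have h4 : ENNReal.ofReal ((1 - θ / 2) ^ (j + 1) * 2 ^ (n + 1)) ≤
          ENNReal.ofReal (1 - θ / 2) *
            volume (lowSet (fun p => c₁⁻¹ * w p) (T + (m + 3) * (1 / 4 ^ k₀))) := by
        refine (hvol.trans (h1.trans (mul_le_mul_right h2 C))).trans ?_
        rw [← mul_assoc, hC, ← ENNReal.ofReal_mul (by linarith)]
        gcongr
        rw [hm, show 2 / (4 / θ) = θ / 2 by field_simp; norm_num]
        nlinarith [sq_nonneg θ]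
      have h5 : ENNReal.ofReal ((1 - θ / 2) ^ j * 2 ^ (n + 1)) ≤
          volume (lowSet (fun p => c₁⁻¹ * w p) (T + (m + 3) * (1 / 4 ^ k₀))) := by
        rw [pow_succ', mul_assoc, ENNReal.ofReal_mul (by linarith)] at h4
        refine (ENNReal.mul_le_mul_iff_right ?_ ENNReal.ofReal_ne_top).1 h4
        exact (ENNReal.ofReal_pos.2 (by linarith)).ne'
      have h6 := ih A hA _ hw' (fun p hp => mul_nonpos_of_nonneg_of_nonpos
        (inv_pos.2 hc₁).le (hw0 p hp)) _ (by push_cast at hT; linarith) h5 x t hx ht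
      rw [inv_mul_le_iff₀ hc₁] at h6
      have := min_le_right c₂ (c₁ * c)
      linarith

end iteration

section main
variable {n : ℕ}

lemma exists_level (n : ℕ) {a η : ℝ} (hη : 0 < η) :
    ∃ k : ℕ, (8 * n + 1) * (1 / 2 ^ k : ℝ) ≤ 1 ∧ (1 : ℝ) / 4 ^ k ≤ η ∧ a * (1 / 4 ^ k) ≤ η := by
  have t1 : Tendsto (fun k : ℕ => (8 * (n : ℝ) + 1) * (1 / 2) ^ k) atTop (𝓝 ((8 * n + 1) * 0)) :=
    (tendsto_pow_atTop_nhds_zero_of_lt_one (by norm_num) (by norm_num)).const_mul _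
  have t2 : Tendsto (fun k : ℕ => (1 / 4 : ℝ) ^ k) atTop (𝓝 0) :=
    tendsto_pow_atTop_nhds_zero_of_lt_one (by norm_num) (by norm_num)
  have t3 := t2.const_mul a
  rw [mul_zero] at t1 t3
  obtain ⟨k, h1, h2, h3⟩ := ((t1.eventually (gt_mem_nhds one_pos)).and
    ((t2.eventually (gt_mem_nhds hη)).and (t3.eventually (gt_mem_nhds hη)))).exists
  rw [one_div_pow] at h1 h2 h3
  exact ⟨k, h1.le, h2.le, h3.le⟩

end main

end auxiliary

/-- **Measure-to-pointwise estimate for subsolutions** (Theorem 2.4). -/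
theorem measure_to_pointwise (n : ℕ) (hn : 2 ≤ n) (lam Lam δ : ℝ)
    (hlam : 0 < lam) (hlamLam : lam ≤ Lam) (hδ : 0 < δ) :
    ∃ c : ℝ, 0 < c ∧
      ∀ (A : SpN n → Matrix (Fin n) (Fin n) ℝ), IsEllipticN lam Lam A →
      ∀ u : SpN n × ℝ → ℝ,
        SubSolvesLN A u (Qcube n 2 (0, 0)) →
        (∀ p ∈ Qcube n 2 (0, 0), 0 ≤ u p ∧ u p ≤ 1) →
        ENNReal.ofReal δ ≤ MeasureTheory.volume {p ∈ Qcube n 1 (0, -1) | u p = 0} →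
        ∀ p ∈ Qcube n 1 (0, 0), u p ≤ 1 - c := by
  open Set Filter Topology MeasureTheory in
  obtain ⟨q, hq0, hq1, m, hm, hiter⟩ := exists_iteration_const (n := n) (by omega) hlam
    (hlam.le.trans hlamLam)
  obtain ⟨K, hK⟩ : ∃ K : ℕ, q ^ K * 2 ^ (n + 1) ≤ δ / 2 := by
    have h := (tendsto_pow_atTop_nhds_zero_of_lt_one hq0.le hq1).mul_const ((2 : ℝ) ^ (n + 1))
    rw [zero_mul] at h
    obtain ⟨K, hK⟩ := (h.eventually (gt_mem_nhds (half_pos hδ))).exists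
    exact ⟨K, hK.le⟩
  set η := δ / 2 ^ (n + 2) with hη
  have hη0 : 0 < η := by positivity
  obtain ⟨k₀, hk1, hk2, hk3⟩ := exists_level n (a := K * m) hη0
  obtain ⟨c, hc, h⟩ := hiter η hη0 k₀ hk1 hk2 K
  refine ⟨c, hc, fun A hA u hu hu01 hvol => ?_⟩
  have hsub : cubeTwo n ×ˢ Ioo (-4 : ℝ) 0 ⊆ Qcube n 2 (0, 0) := by
    rintro ⟨x, t⟩ ⟨hx, ht⟩
    refine ⟨fun i => ?_, ?_, ht.2.le⟩
    · have := abs_lt.1 (hx i)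
      simpa using this
    · have := ht.1
      norm_num
      exact this
  have hw : RSub A (fun p => u p - 1) (cubeTwo n ×ˢ Ioo (-4) 0) :=
    SubSolvesLN.rSub hlam.le (hlam.le.trans hlamLam) hA.ellMat isOpen_cubeTwo
      (fun p hp => hu p (hsub hp)) (fun p hp => hu01 p (hsub hp))
  have hcover : {p ∈ Qcube n 1 (0, -1) | u p = 0} ⊆
      lowSet (fun p => u p - 1) (-1 - 2 * η) ∪ cubeOne n ×ˢ Icc (-1 - 2 * η) (-1) := by
    rintro ⟨x, t⟩ ⟨⟨hx, ht1, ht2⟩, hu0⟩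
    have hx1 : x ∈ cubeOne n := fun i => by
      have := hx i
      simp only [PiLp.zero_apply, sub_zero] at this
      exact ⟨this.1.le, this.2⟩
    norm_num at ht1 ht2
    rcases lt_or_ge t (-1 - 2 * η) with ht | ht
    · refine Or.inl ⟨⟨hx1, ht1.le, ht⟩, ?_⟩
      simp only [hu0]
      norm_num
    · exact Or.inr ⟨hx1, ht, ht2⟩
  have hlow : ENNReal.ofReal (q ^ K * 2 ^ (n + 1)) ≤
      volume (lowSet (fun p => u p - 1) (-1 - 2 * η)) := by
    have h1 : volume (cubeOne n ×ˢ Icc (-1 - 2 * η) (-1)) ≤ ENNReal.ofReal (δ / 2) := by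
      refine (volume_cubeOne_prod_le (a := 2 * η) (le_of_eq ?_)).trans
        (ENNReal.ofReal_le_ofReal (le_of_eq ?_))
      · rw [Real.volume_Icc]
        congr 1
        ring
      · rw [hη, pow_add]
        field_simp
    have h2 : ENNReal.ofReal (δ / 2) + ENNReal.ofReal (δ / 2) ≤
        volume (lowSet (fun p => u p - 1) (-1 - 2 * η)) + ENNReal.ofReal (δ / 2) := by
      rw [← ENNReal.ofReal_add (by positivity) (by positivity), add_halves]
      refine hvol.trans ((measure_mono hcover).trans ((measure_union_le _ _).trans ?_))
      gcongr
    exact (ENNReal.ofReal_le_ofReal hK).trans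
      (ENNReal.le_of_add_le_add_right ENNReal.ofReal_ne_top h2)
  have hmain := h A hA.ellMat _ hw (fun p hp => by linarith [(hu01 p (hsub hp)).2]) _
    (by linarith) hlow
  rintro ⟨x, t⟩ ⟨hx, ht1, ht2⟩
  have hx1 : ∀ i, |x i| ≤ 1 := fun i => by
    have := hx i
    simp only [PiLp.zero_apply, sub_zero] at this
    exact abs_le.2 ⟨this.1.le, this.2.le⟩
  norm_num at ht1 ht2
  have hneg : ∀ s ∈ Ioo (-1 : ℝ) 0, u (x, s) ≤ 1 - c := fun s hs => by
    linarith [hmain x s hx1 hs]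
  rcases ht2.lt_or_eq with ht | rfl
  · exact hneg t ⟨ht1, ht⟩
  · have hmem : ((x, 0) : SpN n × ℝ) ∈ Qcube n 2 (0, 0) := by
      refine ⟨fun i => ?_, by norm_num, le_rfl⟩
      have := abs_le.1 (hx1 i)
      simp only [PiLp.zero_apply, sub_zero]
      constructor <;> linarith
    have hcont : ContinuousAt (fun s => u (x, s)) 0 := (hu _ hmem).2.1.continuousAt
    refine le_of_tendsto (hcont.tendsto.mono_left (nhdsWithin_le_nhds (s := Iio 0))) ?_
    filter_upwards [Ioo_mem_nhdsLT (show (-1 : ℝ) < 0 by norm_num)] with s hs using hneg s hs
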